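/- Let d ≥ 2 and let Λ ⊂ (0,1) be a compact set. There exist functions η, ω : (0,∞) → (0,∞) with η(δ) → 0 and ω(δ) → 0 as δ → 0, and a constant c > 0 depending only on d and Λ, with the following property. For every t ∈ Λ, every sufficiently small δ > 0, and all Borel sets A, B ⊆ ℝ^d satisfying ||A| − 1| < δ, ||B| − 1| < δ, and |tA + (1−t)B| < 1 + δ, there exist a Lebesgue-measure-preserving linear map L : ℝ^d → ℝ^d and vectors a, b ∈ ℝ^d such that, writing A' = L(A) + a, B' = L(B) + b, and S' = tA' + (1−t)B', there exist a convex set 𝒞 ⊆ ℝ^{d−1} and a measurable subset 𝒟 ⊆ 𝒞 with: c ≤ |𝒞| ≤ c^{−1}; |𝒞 ∖ 𝒟| ≤ ω(δ); |A' ∩ π^{−1}(ℝ^{d−1} ∖ 𝒟)| ≤ ω(δ); |B' ∩ π^{−1}(ℝ^{d−1} ∖ 𝒟)| ≤ ω(δ); and moreover for every x ∈ 𝒟, min(|A'_x|, |B'_x|) ≥ η(δ) and |S'_x| − t|A'_x| − (1−t)|B'_x| ≤ η(δ)^{3/2} (with |S'_x| the inner Lebesgue measure of S'_x). -/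

import Mathlib

open MeasureTheory Set Pointwise Filter ENNReal

noncomputable section

abbrev Edim (n : ℕ) := EuclideanSpace ℝ (Fin n)

/-- We identify `ℝ^d` with `ℝ^{d-1} × ℝ`. -/
abbrev Sp (n : ℕ) := Edim n × ℝ

/-- The vertical slice `A_x ⊆ ℝ` of a set `A ⊆ ℝ^{n} × ℝ`. -/
def vslice {n : ℕ} (A : Set (Sp n)) (x : Edim n) : Set ℝ := {y | (x, y) ∈ A}

/-- The horizontal slice of `A ⊆ ℝ^n × ℝ` at height `t`. -/
def hslice {n : ℕ} (A : Set (Sp n)) (t : ℝ) : Set (Edim n) := {x | (x, t) ∈ A}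

/-- Steiner symmetrization `A^⋆`: the slice `(A^⋆)_x` is the open interval
`(-|A_x|/2, |A_x|/2)` centered at `0` of length `|A_x|` (empty if `|A_x| = 0`). -/
def steiner {n : ℕ} (A : Set (Sp n)) : Set (Sp n) :=
  {p | ENNReal.ofReal (2 * |p.2|) < volume (vslice A p.1)}

/-- Schwarz symmetrization `A^*`: the horizontal slice of `A^*` at height `t` is the open
ball in `ℝ^n` centered at `0` whose measure equals that of the corresponding slice of `A`. -/
def schwarz {n : ℕ} (A : Set (Sp n)) : Set (Sp n) :=
  {p | volume (Metric.ball (0 : Edim n) ‖p.1‖) < volume (hslice A p.2)}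

/-- The symmetrization `A^♮ = (A^⋆)^*`. -/
def natSymm {n : ℕ} (A : Set (Sp n)) : Set (Sp n) := schwarz (steiner A)


/-- Inner Lebesgue measure of a subset of `ℝ`: the supremum of the measures of its
measurable subsets. -/
def innerVol (s : Set ℝ) : ℝ≥0∞ :=
  ⨆ (K : Set ℝ) (_ : K ⊆ s) (_ : MeasurableSet K), volume K

/-- The one-dimensional Brunn-Minkowski inequality for compact sets. -/
lemma volume_combo_ge_of_isCompact {K L S : Set ℝ} (hK : IsCompact K) (hL : IsCompact L)
    (hK0 : K.Nonempty) (hL0 : L.Nonempty) {a b : ℝ} (ha : 0 ≤ a) (hb : 0 ≤ b)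
    (hS : ∀ x ∈ K, ∀ y ∈ L, a * x + b * y ∈ S) :
    ENNReal.ofReal a * volume K + ENNReal.ofReal b * volume L ≤ volume S := by
  obtain ⟨p, hpK, hp⟩ := hK.exists_isGreatest hK0
  obtain ⟨q, hqL, hq⟩ := hL.exists_isLeast hL0
  have e1 : volume ((fun x => x + b * q) '' (a • K)) = ENNReal.ofReal a * volume K := by
    rw [image_add_right, measure_preimage_add_right, Measure.addHaar_smul]
    simp [abs_of_nonneg ha]
  have e2 : volume ((fun x => x + a * p) '' (b • L)) = ENNReal.ofReal b * volume L := by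
    rw [image_add_right, measure_preimage_add_right, Measure.addHaar_smul]
    simp [abs_of_nonneg hb]
  have c2 : MeasurableSet ((fun x => x + a * p) '' (b • L)) :=
    ((hL.smul b).image (by fun_prop)).measurableSet
  rw [← e1, ← e2, ← measure_union₀ c2.nullMeasurableSet]
  · refine measure_mono ?_
    rintro z (⟨_, ⟨x, hx, rfl⟩, rfl⟩ | ⟨_, ⟨y, hy, rfl⟩, rfl⟩)
    · exact hS x hx q hqL
    · have := hS p hpK y hy
      simpa [add_comm] using this
  · refine measure_mono_null (t := {a * p + b * q}) ?_ (by simp)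
    rintro z ⟨⟨_, ⟨x, hx, rfl⟩, rfl⟩, ⟨_, ⟨y, hy, rfl⟩, h⟩⟩
    have h1 : a * x ≤ a * p := mul_le_mul_of_nonneg_left (hp hx) ha
    have h2 : b * q ≤ b * y := mul_le_mul_of_nonneg_left (hq hy) hb
    simp only [smul_eq_mul, mem_singleton_iff] at *
    linarith

/-- The one-dimensional Brunn-Minkowski inequality. -/
lemma volume_combo_ge {X Y S : Set ℝ} (hX : MeasurableSet X) (hY : MeasurableSet Y)
    (hX0 : X.Nonempty) (hY0 : Y.Nonempty) {a b : ℝ} (ha : 0 ≤ a) (hb : 0 ≤ b)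
    (hS : ∀ x ∈ X, ∀ y ∈ Y, a * x + b * y ∈ S) :
    ENNReal.ofReal a * volume X + ENNReal.ofReal b * volume Y ≤ volume S := by
  obtain ⟨x0, hx0⟩ := hX0
  obtain ⟨y0, hy0⟩ := hY0
  have key : ∀ K ⊆ X, IsCompact K → ∀ L ⊆ Y, IsCompact L →
      ENNReal.ofReal a * volume K + ENNReal.ofReal b * volume L ≤ volume S := by
    intro K hKX hK L hLY hL
    refine le_trans ?_ (volume_combo_ge_of_isCompact (K := insert x0 K) (L := insert y0 L)
      (hK.insert x0) (hL.insert y0) (insert_nonempty _ _) (insert_nonempty _ _) ha hb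
      fun x hx y hy => hS x (insert_subset hx0 hKX hx) y (insert_subset hy0 hLY hy))
    gcongr <;> exact subset_insert _ _
  rw [hX.measure_eq_iSup_isCompact, hY.measure_eq_iSup_isCompact]
  simp only [ENNReal.mul_iSup]
  refine ENNReal.biSup_add_biSup_le' (p := fun K => K ⊆ X) (q := fun L => L ⊆ Y) ⟨∅, by simp⟩
    ⟨∅, by simp⟩ ?_
  intro K hKX L hLY
  by_cases hK : IsCompact K <;> by_cases hL : IsCompact L
  · simpa [hK, hL] using key K hKX hK L hLY hL
  · simpa [hK, hL] using key K hKX hK ∅ (by simp) isCompact_empty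
  · simpa [hK, hL] using key ∅ (by simp) isCompact_empty L hLY hL
  · simp [hK, hL]

lemma ENNReal.rpow_mul_rpow_le_add {a b : ℝ} (ha : 0 < a) (hb : 0 < b) (hab : a + b = 1)
    (X Y : ℝ≥0∞) : X ^ a * Y ^ b ≤ ENNReal.ofReal a * X + ENNReal.ofReal b * Y := by
  rcases eq_or_ne X ⊤ with rfl | hX
  · rw [ENNReal.mul_top (by simpa using ha)]; simp
  rcases eq_or_ne Y ⊤ with rfl | hY
  · rw [ENNReal.mul_top (by simpa using hb)]; simp
  lift X to NNReal using hX
  lift Y to NNReal using hY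
  have h : (X : ℝ) ^ a * (Y : ℝ) ^ b ≤ a * (X : ℝ) + b * (Y : ℝ) :=
    Real.geom_mean_le_arith_mean2_weighted ha.le hb.le X.2 Y.2 hab
  have h' := ENNReal.ofReal_le_ofReal h
  rw [ENNReal.ofReal_mul (by positivity), ENNReal.ofReal_add (by positivity) (by positivity),
    ENNReal.ofReal_mul ha.le, ENNReal.ofReal_mul hb.le,
    ← ENNReal.ofReal_rpow_of_nonneg X.coe_nonneg ha.le,
    ← ENNReal.ofReal_rpow_of_nonneg Y.coe_nonneg hb.le] at h'
  simpa using h'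

/-- One-dimensional Prékopa-Leindler inequality for functions with supremum one. -/
lemma lintegral_add_le_of_sup_eq_one {f g h : ℝ → ℝ} (hf : Measurable f) (hg : Measurable g)
    (hh : Measurable h) (f0 : ∀ x, 0 ≤ f x) (g0 : ∀ x, 0 ≤ g x) (h0 : ∀ x, 0 ≤ h x)
    (f1 : ∀ x, f x ≤ 1) (g1 : ∀ x, g x ≤ 1) (fs : ∀ u < 1, ∃ x, u < f x)
    (gs : ∀ u < 1, ∃ x, u < g x)
    {a b : ℝ} (ha : 0 < a) (hb : 0 < b) (hab : a + b = 1)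
    (hfgh : ∀ x y, f x ^ a * g y ^ b ≤ h (a * x + b * y)) :
    ENNReal.ofReal a * (∫⁻ x, ENNReal.ofReal (f x)) + ENNReal.ofReal b * ∫⁻ x, ENNReal.ofReal (g x)
      ≤ ∫⁻ x, ENNReal.ofReal (h x) := by
  have one : ∀ f : ℝ → ℝ, (∀ x, f x ≤ 1) →
      ∫⁻ t in Ioi (0:ℝ), volume {x | t < f x} = ∫⁻ t in Ioo (0:ℝ) 1, volume {x | t < f x} := by
    intro f f1
    rw [← Ioo_union_Ici_eq_Ioi (zero_lt_one' ℝ), lintegral_union measurableSet_Ici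
      (disjoint_left.2 fun x hx hx' => not_lt.2 hx' hx.2)]
    have : ∫⁻ t in Ici (1:ℝ), volume {x | t < f x} = 0 := by
      rw [setLIntegral_congr_fun (g := fun _ => 0) measurableSet_Ici]
      · simp
      · intro t ht
        have : {x | t < f x} = ∅ := by
          ext x; simpa using (f1 x).trans ht
        simp [this]
    rw [this, add_zero]
  rw [lintegral_eq_lintegral_meas_lt _ (ae_of_all _ f0) hf.aemeasurable,
    lintegral_eq_lintegral_meas_lt _ (ae_of_all _ g0) hg.aemeasurable,
    lintegral_eq_lintegral_meas_lt _ (ae_of_all _ h0) hh.aemeasurable, one f f1, one g g1]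
  have anti : ∀ f : ℝ → ℝ, Measurable fun t : ℝ => volume {x | t < f x} := fun f =>
    Antitone.measurable fun s t hst => measure_mono fun x hx => lt_of_le_of_lt hst hx
  rw [← lintegral_const_mul _ (anti f), ← lintegral_const_mul _ (anti g),
    ← lintegral_add_left ((anti f).const_mul _)]
  refine le_trans ?_ (lintegral_mono_set (show Ioo (0:ℝ) 1 ⊆ _ from Ioo_subset_Ioi_self))
  refine setLIntegral_mono (anti h) fun t ht => ?_
  refine volume_combo_ge (hf measurableSet_Ioi) (hg measurableSet_Ioi) (fs t ht.2) (gs t ht.2)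
    ha.le hb.le ?_
  intro x hx y hy
  refine lt_of_lt_of_le ?_ (hfgh x y)
  have h1 : t ^ a < f x ^ a := Real.rpow_lt_rpow ht.1.le hx ha
  have h2 : t ^ b < g y ^ b := Real.rpow_lt_rpow ht.1.le hy hb
  calc t = t ^ a * t ^ b := by rw [← Real.rpow_add ht.1, hab, Real.rpow_one]
    _ < _ := mul_lt_mul'' h1 h2 (Real.rpow_nonneg ht.1.le _) (Real.rpow_nonneg ht.1.le _)

lemma prekopaLeindler_bdd {f g h : ℝ → ℝ} (hf : Measurable f) (hg : Measurable g)
    (hh : Measurable h) (f0 : ∀ x, 0 ≤ f x) (g0 : ∀ x, 0 ≤ g x) (h0 : ∀ x, 0 ≤ h x)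
    {C : ℝ} (f1 : ∀ x, f x ≤ C) (g1 : ∀ x, g x ≤ C)
    {a b : ℝ} (ha : 0 < a) (hb : 0 < b) (hab : a + b = 1)
    (hfgh : ∀ x y, f x ^ a * g y ^ b ≤ h (a * x + b * y)) :
    (∫⁻ x, ENNReal.ofReal (f x)) ^ a * (∫⁻ x, ENNReal.ofReal (g x)) ^ b
      ≤ ∫⁻ x, ENNReal.ofReal (h x) := by
  have bf : BddAbove (range f) := ⟨C, by rintro _ ⟨x, rfl⟩; exact f1 x⟩
  have bg : BddAbove (range g) := ⟨C, by rintro _ ⟨x, rfl⟩; exact g1 x⟩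
  by_cases hfz : ∀ x, f x ≤ 0
  · have : ∀ x, ENNReal.ofReal (f x) = 0 := fun x => ENNReal.ofReal_of_nonpos (hfz x)
    simp [this, ENNReal.zero_rpow_of_pos ha]
  by_cases hgz : ∀ x, g x ≤ 0
  · have : ∀ x, ENNReal.ofReal (g x) = 0 := fun x => ENNReal.ofReal_of_nonpos (hgz x)
    simp [this, ENNReal.zero_rpow_of_pos hb]
  push Not at hfz hgz
  obtain ⟨x0, hx0⟩ := hfz
  obtain ⟨y0, hy0⟩ := hgz
  set P := ⨆ x, f x with hP
  set Q := ⨆ x, g x with hQ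
  have P0 : 0 < P := hx0.trans_le (le_ciSup bf x0)
  have Q0 : 0 < Q := hy0.trans_le (le_ciSup bg y0)
  set W := P ^ a * Q ^ b with hW
  have W0 : 0 < W := mul_pos (Real.rpow_pos_of_pos P0 _) (Real.rpow_pos_of_pos Q0 _)
  have main := lintegral_add_le_of_sup_eq_one (f := fun x => P⁻¹ * f x) (g := fun x => Q⁻¹ * g x)
    (h := fun x => W⁻¹ * h x) (hf.const_mul _) (hg.const_mul _) (hh.const_mul _)
    (fun x => mul_nonneg (inv_nonneg.2 P0.le) (f0 x))
    (fun x => mul_nonneg (inv_nonneg.2 Q0.le) (g0 x))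
    (fun x => mul_nonneg (inv_nonneg.2 W0.le) (h0 x))
    (fun x => by rw [inv_mul_le_iff₀ P0, mul_one]; exact le_ciSup bf x)
    (fun x => by rw [inv_mul_le_iff₀ Q0, mul_one]; exact le_ciSup bg x)
    (fun u hu => by
      obtain ⟨x, hx⟩ := exists_lt_of_lt_ciSup (show P * u < ⨆ x, f x by nlinarith)
      exact ⟨x, by rwa [lt_inv_mul_iff₀ P0]⟩)
    (fun u hu => by
      obtain ⟨x, hx⟩ := exists_lt_of_lt_ciSup (show Q * u < ⨆ x, g x by nlinarith)
      exact ⟨x, by rwa [lt_inv_mul_iff₀ Q0]⟩) ha hb hab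
    (fun x y => by
      rw [Real.mul_rpow (inv_nonneg.2 P0.le) (f0 x), Real.mul_rpow (inv_nonneg.2 Q0.le) (g0 y),
        Real.inv_rpow P0.le, Real.inv_rpow Q0.le]
      calc _ = W⁻¹ * (f x ^ a * g y ^ b) := by rw [hW, mul_inv]; ring
        _ ≤ _ := mul_le_mul_of_nonneg_left (hfgh x y) (inv_nonneg.2 W0.le))
  have pull : ∀ (c : ℝ), 0 < c → ∀ f : ℝ → ℝ, Measurable f → ∫⁻ x, ENNReal.ofReal (c⁻¹ * f x) =
      (ENNReal.ofReal c)⁻¹ * ∫⁻ x, ENNReal.ofReal (f x) := by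
    intro c hc f hf
    rw [← lintegral_const_mul _ hf.ennreal_ofReal]
    simp_rw [ENNReal.ofReal_mul (inv_nonneg.2 hc.le), ENNReal.ofReal_inv_of_pos hc]
  rw [pull P P0 f hf, pull Q Q0 g hg, pull W W0 h hh] at main
  have main' := (ENNReal.rpow_mul_rpow_le_add ha hb hab _ _).trans main
  rw [ENNReal.mul_rpow_of_nonneg _ _ ha.le, ENNReal.mul_rpow_of_nonneg _ _ hb.le,
    ENNReal.inv_rpow, ENNReal.inv_rpow, ENNReal.ofReal_rpow_of_pos P0,
    ENNReal.ofReal_rpow_of_pos Q0] at main'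
  have eW : (ENNReal.ofReal W)⁻¹ = (ENNReal.ofReal (P ^ a))⁻¹ * (ENNReal.ofReal (Q ^ b))⁻¹ := by
    rw [← ENNReal.mul_inv (by simp) (by simp), hW, ENNReal.ofReal_mul (by positivity)]
  rw [mul_mul_mul_comm, ← eW] at main'
  exact (ENNReal.mul_le_mul_iff_right (by simp) (by simp [W0])).1 main'

/-- The Prékopa-Leindler inequality holds for the measure `μ`. -/
def PrekopaLeindler {E : Type*} [AddCommGroup E] [Module ℝ E] [MeasurableSpace E]
    (μ : Measure E) : Prop :=
  ∀ ⦃a b : ℝ⦄, 0 < a → 0 < b → a + b = 1 → ∀ ⦃f g h : E → ℝ≥0∞⦄, Measurable f → Measurable g →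
    Measurable h → (∀ x y, f x ^ a * g y ^ b ≤ h (a • x + b • y)) →
    (∫⁻ x, f x ∂μ) ^ a * (∫⁻ x, g x ∂μ) ^ b ≤ ∫⁻ x, h x ∂μ

lemma prekopaLeindler_real : PrekopaLeindler (volume : Measure ℝ) := by
  intro a b ha hb hab f g h hf hg hh hfgh
  have trunc : ∀ f : ℝ → ℝ≥0∞, Measurable f →
      ∫⁻ x, f x = ⨆ n : ℕ, ∫⁻ x, min (f x) n := by
    intro f hf
    rw [← lintegral_iSup (fun n => hf.min measurable_const)
      (fun m n hmn x => min_le_min le_rfl (by exact_mod_cast hmn))]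
    congr with x
    refine le_antisymm ?_ (iSup_le fun n => min_le_left _ _)
    rcases eq_or_ne (f x) ⊤ with h | h
    · simp [h, ENNReal.iSup_natCast]
    · obtain ⟨n, hn⟩ := ENNReal.exists_nat_gt h
      exact le_iSup_of_le n (by simp [hn.le])
  have mono : ∀ f : ℝ → ℝ≥0∞, Monotone fun n : ℕ => ∫⁻ x, min (f x) n := fun f m n hmn =>
    lintegral_mono fun x => min_le_min le_rfl (by exact_mod_cast hmn)
  have key : ∀ n : ℕ, (∫⁻ x, min (f x) n) ^ a * (∫⁻ x, min (g x) n) ^ b ≤ ∫⁻ x, h x := by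
    intro n
    have tr : ∀ f : ℝ → ℝ≥0∞, ∀ x, ENNReal.ofReal (min (f x) n).toReal = min (f x) n := fun f x =>
      ENNReal.ofReal_toReal (by simp)
    have := prekopaLeindler_bdd (f := fun x => (min (f x) n).toReal)
      (g := fun x => (min (g x) n).toReal) (h := fun x => (min (h x) n).toReal) (C := n)
      (hf.min measurable_const).ennreal_toReal (hg.min measurable_const).ennreal_toReal
      (hh.min measurable_const).ennreal_toReal (by simp) (by simp) (by simp)
      (fun x => by simpa using ENNReal.toReal_mono (by simp) (min_le_right (f x) n))
      (fun x => by simpa using ENNReal.toReal_mono (by simp) (min_le_right (g x) n)) ha hb hab ?_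
    · simp only [tr] at this
      exact this.trans (lintegral_mono fun x => min_le_left _ _)
    · intro x y
      rw [ENNReal.toReal_rpow, ENNReal.toReal_rpow, ← ENNReal.toReal_mul]
      refine ENNReal.toReal_mono (by simp) (le_min ?_ ?_)
      · refine le_trans ?_ (hfgh x y)
        gcongr <;> simp
      · calc _ ≤ (n : ℝ≥0∞) ^ a * (n : ℝ≥0∞) ^ b := by gcongr <;> simp
          _ = n := by rw [← ENNReal.rpow_add_of_nonneg _ _ ha.le hb.le, hab, ENNReal.rpow_one]
  have l1 : Tendsto (fun n : ℕ => ∫⁻ x, min (f x) n) atTop (nhds (∫⁻ x, f x)) := by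
    rw [trunc f hf]; exact tendsto_atTop_iSup (mono f)
  have l2 : Tendsto (fun n : ℕ => ∫⁻ x, min (g x) n) atTop (nhds (∫⁻ x, g x)) := by
    rw [trunc g hg]; exact tendsto_atTop_iSup (mono g)
  by_cases hf0 : ∫⁻ x, f x = 0
  · simp [hf0, ENNReal.zero_rpow_of_pos ha]
  by_cases hg0 : ∫⁻ x, g x = 0
  · simp [hg0, ENNReal.zero_rpow_of_pos hb]
  refine le_of_tendsto (ENNReal.Tendsto.mul (l1.ennrpow_const a) (Or.inl ?_)
    (l2.ennrpow_const b) (Or.inl ?_)) (Eventually.of_forall key)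
  · simp [ENNReal.rpow_eq_zero_iff, hf0, ha.le]
  · simp [ENNReal.rpow_eq_zero_iff, hg0, hb.le]

lemma PrekopaLeindler.prod {E F : Type*} [AddCommGroup E] [Module ℝ E] [MeasurableSpace E]
    [AddCommGroup F] [Module ℝ F] [MeasurableSpace F] {μ : Measure E} {ν : Measure F} [SFinite ν]
    [SFinite μ]
    (hμ : PrekopaLeindler μ) (hν : PrekopaLeindler ν) : PrekopaLeindler (μ.prod ν) := by
  intro a b ha hb hab f g h hf hg hh hfgh
  rw [lintegral_prod _ hf.aemeasurable, lintegral_prod _ hg.aemeasurable,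
    lintegral_prod _ hh.aemeasurable]
  refine hμ ha hb hab hf.lintegral_prod_right' hg.lintegral_prod_right' hh.lintegral_prod_right' ?_
  intro x y
  refine hν ha hb hab (hf.comp measurable_prodMk_left) (hg.comp measurable_prodMk_left)
    (hh.comp measurable_prodMk_left) fun u v => hfgh (x, u) (y, v)

lemma PrekopaLeindler.map {E F : Type*} [AddCommGroup E] [Module ℝ E] [MeasurableSpace E]
    [AddCommGroup F] [Module ℝ F] [MeasurableSpace F] {μ : Measure E} (hμ : PrekopaLeindler μ)
    {e : E → F} (he : Measurable e) (hl : ∀ (a b : ℝ) x y, e (a • x + b • y) = a • e x + b • e y) :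
    PrekopaLeindler (μ.map e) := by
  intro a b ha hb hab f g h hf hg hh hfgh
  rw [lintegral_map hf he, lintegral_map hg he, lintegral_map hh he]
  refine hμ ha hb hab (hf.comp he) (hg.comp he) (hh.comp he) fun x y => ?_
  have := hfgh (e x) (e y)
  rwa [← hl] at this

lemma PrekopaLeindler.smul {E : Type*} [AddCommGroup E] [Module ℝ E] [MeasurableSpace E]
    {μ : Measure E} (hμ : PrekopaLeindler μ) (c : ℝ≥0∞) : PrekopaLeindler (c • μ) := by
  intro a b ha hb hab f g h hf hg hh hfgh
  simp only [lintegral_smul_measure, smul_eq_mul]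
  rw [ENNReal.mul_rpow_of_nonneg _ _ ha.le, ENNReal.mul_rpow_of_nonneg _ _ hb.le,
    mul_mul_mul_comm, ← ENNReal.rpow_add_of_nonneg _ _ ha.le hb.le, hab, ENNReal.rpow_one]
  gcongr
  exact hμ ha hb hab hf hg hh hfgh

lemma prekopaLeindler_pi (n : ℕ) : PrekopaLeindler (volume : Measure (Fin n → ℝ)) := by
  induction n with
  | zero =>
    intro a b ha hb hab f g h hf hg hh hfgh
    have : (volume : Measure (Fin 0 → ℝ)) = Measure.dirac 0 := by
      rw [volume_pi, Measure.pi_of_empty _ 0]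
    rw [this, lintegral_dirac' _ hf, lintegral_dirac' _ hg, lintegral_dirac' _ hh]
    simpa using hfgh 0 0
  | succ n ih =>
    have h := (volume_preserving_piFinSuccAbove (fun _ : Fin (n + 1) => ℝ) 0).symm
    rw [← h.map_eq]
    refine PrekopaLeindler.map (prekopaLeindler_real.prod ih) h.measurable ?_
    intro a b x y
    ext i
    refine Fin.cases ?_ (fun j => ?_) i <;>
    simp [MeasurableEquiv.piFinSuccAbove]

/-- The Prékopa-Leindler inequality for Haar measures on finite-dimensional spaces. -/
lemma prekopaLeindler_addHaar {E : Type*} [NormedAddCommGroup E] [NormedSpace ℝ E]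
    [FiniteDimensional ℝ E] [MeasurableSpace E] [BorelSpace E] (μ : Measure E)
    [μ.IsAddHaarMeasure] : PrekopaLeindler μ := by
  let e : (Fin (Module.finrank ℝ E) → ℝ) ≃L[ℝ] E :=
    (ContinuousLinearEquiv.ofFinrankEq (by simp))
  have : (Measure.map e volume).IsAddHaarMeasure := e.isAddHaarMeasure_map _
  rw [Measure.isAddLeftInvariant_eq_smul μ (Measure.map e volume)]
  exact ((prekopaLeindler_pi _).map e.continuous.measurable (by simp)).smul _

section BM

variable {E : Type*} [NormedAddCommGroup E] [NormedSpace ℝ E]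
    [FiniteDimensional ℝ E] [MeasurableSpace E] [BorelSpace E] (μ : Measure E)
    [μ.IsAddHaarMeasure]

/-- The exponential form of the Brunn-Minkowski inequality. -/
lemma setLIntegral_exp_ge {a b : ℝ} (ha : 0 < a) (hb : 0 < b) (hab : a + b = 1)
    {A B S : Set E} (hA : MeasurableSet A) (hB : MeasurableSet B) (hS : MeasurableSet S)
    (hABS : ∀ x ∈ A, ∀ y ∈ B, a • x + b • y ∈ S) (ℓ : E →L[ℝ] ℝ) (c : ℝ) :
    (∫⁻ x in A, ENNReal.ofReal (Real.exp (c * ℓ x)) ∂μ) ^ a *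
      (∫⁻ x in B, ENNReal.ofReal (Real.exp (c * ℓ x)) ∂μ) ^ b ≤
      ∫⁻ x in S, ENNReal.ofReal (Real.exp (c * ℓ x)) ∂μ := by
  have hm : Measurable fun x => ENNReal.ofReal (Real.exp (c * ℓ x)) := by fun_prop
  rw [← lintegral_indicator hA, ← lintegral_indicator hB, ← lintegral_indicator hS]
  refine prekopaLeindler_addHaar μ ha hb hab (hm.indicator hA) (hm.indicator hB)
    (hm.indicator hS) fun x y => ?_
  by_cases hx : x ∈ A
  · by_cases hy : y ∈ B
    · rw [indicator_of_mem hx, indicator_of_mem hy, indicator_of_mem (hABS x hx y hy),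
        ENNReal.ofReal_rpow_of_pos (Real.exp_pos _), ENNReal.ofReal_rpow_of_pos (Real.exp_pos _),
        ← ENNReal.ofReal_mul (by positivity), ← Real.exp_mul, ← Real.exp_mul, ← Real.exp_add]
      refine le_of_eq ?_
      congr 2
      simp only [map_add, map_smul, smul_eq_mul]
      ring
    · rw [indicator_of_notMem hy, ENNReal.zero_rpow_of_pos hb, mul_zero]; exact zero_le
  · rw [indicator_of_notMem hx, ENNReal.zero_rpow_of_pos ha, zero_mul]; exact zero_le

/-- The multiplicative Brunn-Minkowski inequality. -/
lemma measure_rpow_mul_rpow_le {a b : ℝ} (ha : 0 < a) (hb : 0 < b) (hab : a + b = 1)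
    {A B S : Set E} (hA : MeasurableSet A) (hB : MeasurableSet B)
    (hABS : ∀ x ∈ A, ∀ y ∈ B, a • x + b • y ∈ S) :
    μ A ^ a * μ B ^ b ≤ μ S := by
  have := setLIntegral_exp_ge μ ha hb hab hA hB (measurableSet_toMeasurable μ S)
    (fun x hx y hy => subset_toMeasurable μ S (hABS x hx y hy)) 0 0
  simpa using this

lemma min_measure_le {a b : ℝ} (ha : 0 < a) (hb : 0 < b) (hab : a + b = 1)
    {A B S : Set E} (hA : MeasurableSet A) (hB : MeasurableSet B)
    (hABS : ∀ x ∈ A, ∀ y ∈ B, a • x + b • y ∈ S) :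
    min (μ A) (μ B) ≤ μ S := by
  refine le_trans ?_ (measure_rpow_mul_rpow_le μ ha hb hab hA hB hABS)
  calc min (μ A) (μ B) = min (μ A) (μ B) ^ a * min (μ A) (μ B) ^ b := by
        rw [← ENNReal.rpow_add_of_nonneg _ _ ha.le hb.le, hab, ENNReal.rpow_one]
    _ ≤ _ := by gcongr <;> simp

end BM

lemma Ultrafilter.exists_tendsto {α X : Type*} [TopologicalSpace X] [CompactSpace X]
    (U : Ultrafilter α) (f : α → X) : ∃ x, Tendsto f U (nhds x) := by
  obtain ⟨x, -, hx⟩ := isCompact_univ.ultrafilter_le_nhds (U.map f) (by simp)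
  exact ⟨x, hx⟩

section SetwiseLimit

variable {α : Type*} [MeasurableSpace α]

/-- A sequence of measures dominated by a finite measure converges setwise along any
ultrafilter. -/
theorem exists_setwise_limit (U : Ultrafilter ℕ) (ρ : ℕ → Measure α) (M : Measure α)
    [IsFiniteMeasure M] (hρ : ∀ k, ρ k ≤ M) :
    ∃ σ : Measure α, σ ≤ M ∧ ∀ E, MeasurableSet E →
      Tendsto (fun k => ρ k E) U (nhds (σ E)) := by
  choose m hm using fun E : Set α => U.exists_tendsto (fun k => ρ k E)
  have hmM : ∀ E, m E ≤ M E := fun E => le_of_tendsto' (hm E) fun k => hρ k E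
  have hfin : ∀ E, m E ≠ ⊤ := fun E => ((hmM E).trans_lt (measure_lt_top M E)).ne
  have hfin' : ∀ k E, ρ k E ≠ ⊤ := fun k E => ((hρ k E).trans_lt (measure_lt_top M E)).ne
  let σ : Measure α := Measure.ofMeasurable (fun E _ => m E)
    (tendsto_nhds_unique (hm ∅) (by simp)) (by
      intro f hf hd
      have h1 : Tendsto (fun k => ∑' i, (ρ k (f i)).toReal) U
          (nhds (∑' i, (m (f i)).toReal)) := by
        refine tendsto_tsum_of_dominated_convergence (bound := fun i => (M (f i)).toReal) ?_ ?_ ?_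
        · refine ENNReal.summable_toReal ?_
          rw [← measure_iUnion hd hf]
          exact measure_ne_top _ _
        · exact fun i => (ENNReal.tendsto_toReal (hfin _)).comp (hm (f i))
        · refine Eventually.of_forall fun k i => ?_
          rw [Real.norm_of_nonneg ENNReal.toReal_nonneg]
          exact ENNReal.toReal_mono (measure_ne_top _ _) (hρ k _)
      have h2 : Tendsto (fun k => (ρ k (⋃ i, f i)).toReal) U (nhds (m (⋃ i, f i)).toReal) :=
        (ENNReal.tendsto_toReal (hfin _)).comp (hm _)
      have h3 : (fun k => (ρ k (⋃ i, f i)).toReal) = fun k => ∑' i, (ρ k (f i)).toReal := by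
        ext k
        rw [measure_iUnion hd hf, ENNReal.tsum_toReal_eq fun i => hfin' k _]
      rw [h3] at h2
      have h4 := tendsto_nhds_unique h2 h1
      rw [← ENNReal.tsum_toReal_eq fun i => hfin _] at h4
      refine (ENNReal.toReal_eq_toReal_iff' (hfin _) ?_).1 h4
      refine ne_top_of_le_ne_top (measure_ne_top M (⋃ i, f i)) ?_
      rw [measure_iUnion hd hf]
      exact ENNReal.tsum_le_tsum fun i => hmM _)
  have hσ : ∀ E, MeasurableSet E → σ E = m E := fun E hE => Measure.ofMeasurable_apply E hE
  refine ⟨σ, Measure.le_iff.2 fun E hE => (hσ E hE).trans_le (hmM E), fun E hE => ?_⟩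
  rw [hσ E hE]
  exact hm E

lemma sum_steps_eq {ε t : ℝ} (hε : 0 ≤ ε) (N : ℕ) (h : N * ε ≤ t) :
    ∑ j ∈ Finset.range N, (if (j + 1) * ε ≤ t then ε else 0) = N * ε := by
  rw [Finset.sum_congr rfl (g := fun _ => ε)]
  · simp
  · intro j hj
    have : (j : ℝ) + 1 ≤ N := by exact_mod_cast Finset.mem_range.1 hj
    rw [if_pos]
    nlinarith

lemma sum_steps_le {ε t : ℝ} (hε : 0 ≤ ε) (ht : 0 ≤ t) (N : ℕ) :
    ∑ j ∈ Finset.range N, (if (j + 1) * ε ≤ t then ε else 0) ≤ t := by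
  induction N with
  | zero => simpa
  | succ N ih =>
    by_cases h : (N + 1) * ε ≤ t
    · rw [sum_steps_eq hε _ (by exact_mod_cast h)]; exact_mod_cast h
    · rw [Finset.sum_range_succ, if_neg h]; simpa using ih

lemma le_sum_steps {ε t : ℝ} (hε : 0 ≤ ε) (N : ℕ) (h : t ≤ N * ε) :
    t ≤ ∑ j ∈ Finset.range N, (if (j + 1) * ε ≤ t then ε else 0) + ε := by
  induction N with
  | zero => simp at h; simp; linarith
  | succ N ih =>
    push_cast at h
    by_cases h' : N * ε ≤ t
    · rw [Finset.sum_range_succ, sum_steps_eq hε N h']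
      have : 0 ≤ (if ((N:ℝ) + 1) * ε ≤ t then ε else 0) := by positivity
      linarith
    · rw [Finset.sum_range_succ]
      have : 0 ≤ (if ((N:ℝ) + 1) * ε ≤ t then ε else 0) := by positivity
      linarith [ih (not_le.1 h').le]

/-- Setwise convergence implies convergence of integrals of bounded measurable functions. -/
theorem tendsto_lintegral_of_setwise {U : Ultrafilter ℕ} {ρ : ℕ → Measure α} {M σ : Measure α}
    [IsFiniteMeasure M] (hρ : ∀ k, ρ k ≤ M) (hσM : σ ≤ M)
    (hσ : ∀ E, MeasurableSet E → Tendsto (fun k => ρ k E) U (nhds (σ E)))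
    {φ : α → ℝ} (hφ : Measurable φ) (h0 : ∀ x, 0 ≤ φ x) {C : ℝ} (hC : ∀ x, φ x ≤ C) :
    Tendsto (fun k => ∫⁻ x, ENNReal.ofReal (φ x) ∂(ρ k)) U
      (nhds (∫⁻ x, ENNReal.ofReal (φ x) ∂σ)) := by
  obtain ⟨L, hL⟩ := U.exists_tendsto (fun k => ∫⁻ x, ENNReal.ofReal (φ x) ∂(ρ k))
  suffices L = ∫⁻ x, ENNReal.ofReal (φ x) ∂σ by rwa [this] at hL
  have approx : ∀ ε : ℝ, 0 < ε → L ≤ ∫⁻ x, ENNReal.ofReal (φ x) ∂σ + ENNReal.ofReal ε * M univ ∧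
      ∫⁻ x, ENNReal.ofReal (φ x) ∂σ ≤ L + ENNReal.ofReal ε * M univ := by
    intro ε hε
    obtain ⟨N, hN⟩ := exists_nat_ge (C / ε)
    rw [div_le_iff₀ hε] at hN
    let I : Measure α → ℝ≥0∞ := fun ν =>
      ∑ j ∈ Finset.range N, ENNReal.ofReal ε * ν {x | (j + 1) * ε ≤ φ x}
    have hms : ∀ j : ℕ, MeasurableSet {x | (j + 1) * ε ≤ φ x} := fun j =>
      measurableSet_le measurable_const hφ
    have hI : ∀ ν : Measure α, ∫⁻ x, ENNReal.ofReal
        (∑ j ∈ Finset.range N, (if (j + 1) * ε ≤ φ x then ε else 0)) ∂ν = I ν := by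
      intro ν
      have : ∀ x, ENNReal.ofReal (∑ j ∈ Finset.range N, (if (j + 1) * ε ≤ φ x then ε else 0)) =
          ∑ j ∈ Finset.range N,
            {x | (j + 1) * ε ≤ φ x}.indicator (fun _ => ENNReal.ofReal ε) x := by
        intro x
        rw [ENNReal.ofReal_sum_of_nonneg fun i _ => by positivity]
        refine Finset.sum_congr rfl fun j _ => ?_
        simp only [indicator, mem_ofPred_eq]
        split_ifs <;> simp
      simp_rw [this]
      rw [lintegral_finsetSum _ fun j _ => measurable_const.indicator (hms j)]
      exact Finset.sum_congr rfl fun j _ => lintegral_indicator_const (hms j) _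
    have lo : ∀ ν : Measure α, I ν ≤ ∫⁻ x, ENNReal.ofReal (φ x) ∂ν := fun ν => by
      rw [← hI]
      exact lintegral_mono fun x => ENNReal.ofReal_le_ofReal (sum_steps_le hε.le (h0 x) N)
    have hi : ∀ ν : Measure α, ν ≤ M →
        ∫⁻ x, ENNReal.ofReal (φ x) ∂ν ≤ I ν + ENNReal.ofReal ε * M univ := fun ν hν => by
      rw [← hI]
      calc _ ≤ ∫⁻ x, (ENNReal.ofReal
            (∑ j ∈ Finset.range N, (if (j + 1) * ε ≤ φ x then ε else 0)) + ENNReal.ofReal ε) ∂ν :=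
            lintegral_mono fun x => by
              dsimp only
              rw [← ENNReal.ofReal_add (Finset.sum_nonneg fun i _ => by positivity) hε.le]
              exact ENNReal.ofReal_le_ofReal (le_sum_steps hε.le N ((hC x).trans hN))
        _ ≤ _ := by
          rw [lintegral_add_right _ measurable_const, lintegral_const]
          gcongr
    have hIt : Tendsto (fun k => I (ρ k)) U (nhds (I σ)) :=
      tendsto_finsetSum _ fun j _ => ENNReal.Tendsto.const_mul (hσ _ (hms j)) (Or.inr (by simp))
    constructor
    · calc L ≤ I σ + ENNReal.ofReal ε * M univ :=
            le_of_tendsto_of_tendsto' hL (hIt.add_const _) fun k => hi _ (hρ k)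
        _ ≤ _ := by gcongr; exact lo σ
    · refine (hi σ hσM).trans ?_
      gcongr
      exact le_of_tendsto_of_tendsto' hIt hL fun k => lo _
  have lim : ∀ X : ℝ≥0∞, Tendsto (fun ε : ℝ => X + ENNReal.ofReal ε * M univ)
      (nhdsWithin 0 (Ioi 0)) (nhds X) := by
    intro X
    have : Tendsto (fun ε : ℝ => X + ENNReal.ofReal ε * M univ) (nhds 0)
        (nhds (X + ENNReal.ofReal 0 * M univ)) := by
      refine tendsto_const_nhds.add (ENNReal.Tendsto.mul_const ?_ (Or.inr (measure_ne_top _ _)))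
      exact (ENNReal.continuous_ofReal.tendsto 0)
    simp only [ENNReal.ofReal_zero, zero_mul, add_zero] at this
    exact this.mono_left nhdsWithin_le_nhds
  refine le_antisymm ?_ ?_
  · exact ge_of_tendsto (lim _) (eventually_nhdsWithin_of_forall fun ε hε => (approx ε hε).1)
  · exact ge_of_tendsto (lim _) (eventually_nhdsWithin_of_forall fun ε hε => (approx ε hε).2)

end SetwiseLimit

open ProbabilityTheory in
lemma integrableExpSet_id_eq_univ {μ : Measure ℝ} [IsFiniteMeasure μ] {R : ℝ}
    (hμ : ∀ᵐ x ∂μ, x ∈ Icc (-R) R) : integrableExpSet id μ = univ := by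
  ext c
  simpa [integrableExpSet] using integrable_exp_mul_of_mem_Icc (X := id) (t := c)
    aemeasurable_id hμ

open ProbabilityTheory in
/-- An inequality between moment generating functions gives one between variances. -/
lemma variance_le_of_mgf_le {μ ν σ : Measure ℝ} [IsProbabilityMeasure μ] [IsProbabilityMeasure ν]
    [IsProbabilityMeasure σ] {R : ℝ} (hμ : ∀ᵐ x ∂μ, x ∈ Icc (-R) R) (hν : ∀ᵐ x ∂ν, x ∈ Icc (-R) R)
    (hσ : ∀ᵐ x ∂σ, x ∈ Icc (-R) R) {a b : ℝ}
    (hE : ∀ c, mgf id μ c ^ a * mgf id ν c ^ b ≤ mgf id σ c) :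
    a * Var[id; μ] + b * Var[id; ν] ≤ Var[id; σ] := by
  have smooth : ∀ {μ : Measure ℝ} [IsProbabilityMeasure μ], (∀ᵐ x ∂μ, x ∈ Icc (-R) R) →
      (Differentiable ℝ (cgf id μ) ∧ Differentiable ℝ (deriv (cgf id μ))) ∧
      deriv (deriv (cgf id μ)) 0 = Var[id; μ] := by
    intro μ _ hμ
    have hu := integrableExpSet_id_eq_univ hμ
    have han : ∀ c, AnalyticAt ℝ (cgf id μ) c := fun c => analyticAt_cgf (by simp [hu])
    refine ⟨⟨fun c => (han c).differentiableAt, fun c => (han c).deriv.differentiableAt⟩, ?_⟩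
    have h := iteratedDeriv_two_cgf_eq_integral (X := id) (μ := μ) (v := 0) (by simp [hu])
    rw [deriv_cgf_zero (by simp [hu])] at h
    rw [variance_eq_integral aemeasurable_id]
    simpa [iteratedDeriv_succ, iteratedDeriv_zero] using h
  obtain ⟨⟨μ1, μ2⟩, μ3⟩ := smooth hμ
  obtain ⟨⟨ν1, ν2⟩, ν3⟩ := smooth hν
  obtain ⟨⟨σ1, σ2⟩, σ3⟩ := smooth hσ
  have pos : ∀ {μ : Measure ℝ} [IsProbabilityMeasure μ], (∀ᵐ x ∂μ, x ∈ Icc (-R) R) →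
      ∀ c, 0 < mgf id μ c := fun {μ} _ hμ c =>
    mgf_pos (by simpa [integrableExpSet] using (integrableExpSet_id_eq_univ hμ).ge (mem_univ c))
  set D : ℝ → ℝ := fun c => cgf id σ c - a * cgf id μ c - b * cgf id ν c with hD
  have D0 : ∀ c, 0 ≤ D c := by
    intro c
    have h := Real.log_le_log (mul_pos (Real.rpow_pos_of_pos (pos hμ c) _)
      (Real.rpow_pos_of_pos (pos hν c) _)) (hE c)
    rw [Real.log_mul (Real.rpow_pos_of_pos (pos hμ c) _).ne'
      (Real.rpow_pos_of_pos (pos hν c) _).ne', Real.log_rpow (pos hμ c),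
      Real.log_rpow (pos hν c)] at h
    simp only [hD, cgf]
    linarith
  have Dz : D 0 = 0 := by simp [hD]
  have D1 : deriv D = fun c => deriv (cgf id σ) c - a * deriv (cgf id μ) c
      - b * deriv (cgf id ν) c := by
    ext c
    exact (((σ1 c).hasDerivAt.sub ((μ1 c).hasDerivAt.const_mul a)).sub
      ((ν1 c).hasDerivAt.const_mul b)).deriv
  have Dd : Differentiable ℝ D := fun c => by fun_prop
  have Ddd : Differentiable ℝ (deriv D) := by rw [D1]; fun_prop
  have D2 : deriv (deriv D) 0 = Var[id; σ] - a * Var[id; μ] - b * Var[id; ν] := by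
    rw [D1, ← μ3, ← ν3, ← σ3]
    exact (((σ2 0).hasDerivAt.sub ((μ2 0).hasDerivAt.const_mul a)).sub
      ((ν2 0).hasDerivAt.const_mul b)).deriv
  have D10 : deriv D 0 = 0 :=
    IsLocalMin.deriv_eq_zero (Eventually.of_forall fun c => by rw [Dz]; exact D0 c)
  by_contra! hlt
  have neg : deriv (deriv D) 0 < 0 := by rw [D2]; linarith
  set κ := -(deriv (deriv D) 0) / 4 with hκ
  have κ0 : 0 < κ := by rw [hκ]; linarith
  set f : ℝ → ℝ := fun c => D c + κ * c ^ 2 with hf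
  have f1 : deriv f = fun c => deriv D c + κ * (2 * c) := by
    ext c
    have := (Dd c).hasDerivAt.add ((hasDerivAt_pow 2 c).const_mul κ)
    exact this.deriv.trans (by simp)
  have f2 : deriv (deriv f) 0 = deriv (deriv D) 0 + κ * 2 := by
    rw [f1]
    have := (Ddd 0).hasDerivAt.add (((hasDerivAt_id (0:ℝ)).const_mul 2).const_mul κ)
    exact this.deriv.trans (by simp)
  have hmax : IsLocalMax f 0 := by
    refine isLocalMax_of_deriv_deriv_neg ?_ ?_ ?_
    · rw [f2, hκ]; linarith
    · rw [f1]; simp [D10]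
    · exact (Dd.continuous.add (by fun_prop)).continuousAt
  have hmax' : ∀ᶠ c in nhdsWithin (0:ℝ) {0}ᶜ, f c ≤ f 0 := hmax.filter_mono nhdsWithin_le_nhds
  obtain ⟨c, hc, hc0⟩ := (hmax'.and self_mem_nhdsWithin).exists
  have : 0 < κ * c ^ 2 := mul_pos κ0 (by have : c ≠ 0 := hc0; positivity)
  have h0 : f 0 = 0 := by simp [hf, Dz]
  have := D0 c
  simp only [h0] at hc
  simp only [hf] at hc
  linarith

/-- A function behaving like the quantile function of `σ` has law `σ`. -/
lemma map_eq_of_quantile {σ : Measure ℝ} [IsProbabilityMeasure σ] {r : ℝ → ℝ}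
    (hr : AEMeasurable r (volume.restrict (Ioo 0 1)))
    (h1 : ∀ s ∈ Ioo (0:ℝ) 1, s ≤ σ.real (Iic (r s)))
    (h2 : ∀ s ∈ Ioo (0:ℝ) 1, σ.real (Iio (r s)) ≤ s) :
    (volume.restrict (Ioo (0:ℝ) 1)).map r = σ := by
  have : IsProbabilityMeasure (volume.restrict (Ioo (0:ℝ) 1)) := ⟨by simp⟩
  have := Measure.isProbabilityMeasure_map hr
  refine Measure.ext_of_Iic _ _ fun z => ?_
  set Φ := σ.real (Iic z) with hΦ
  have Φ1 : Φ ≤ 1 := measureReal_le_one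
  have e : volume.restrict (Ioo (0:ℝ) 1) (r ⁻¹' Iic z) = ENNReal.ofReal Φ := by
    refine le_antisymm ?_ ?_
    · rw [Measure.restrict_apply' measurableSet_Ioo]
      have hs : r ⁻¹' Iic z ∩ Ioo 0 1 ⊆ Ioc 0 Φ := by
        rintro s ⟨hs, hs'⟩
        exact ⟨hs'.1, (h1 s hs').trans (measureReal_mono (Iic_subset_Iic.2 hs))⟩
      exact (measure_mono hs).trans (by simp)
    · have hs : Ioo 0 Φ ⊆ r ⁻¹' Iic z ∩ Ioo 0 1 := by
        rintro s ⟨hs, hs'⟩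
        have hs1 : s ∈ Ioo (0:ℝ) 1 := ⟨hs, hs'.trans_le Φ1⟩
        refine ⟨?_, hs1⟩
        by_contra hlt
        have hlt : z < r s := not_le.1 hlt
        have : Φ ≤ s := (measureReal_mono (fun x hx => lt_of_le_of_lt hx hlt)).trans (h2 s hs1)
        linarith
      rw [Measure.restrict_apply' measurableSet_Ioo]
      refine le_trans ?_ (measure_mono hs)
      simp
  rw [Measure.map_apply_of_aemeasurable hr measurableSet_Iic, e, hΦ, ofReal_measureReal]

/-- A measure with bounded support has a quantile function. -/
lemma exists_quantile {μ : Measure ℝ} [IsProbabilityMeasure μ] {R : ℝ}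
    (hμ : ∀ᵐ x ∂μ, x ∈ Icc (-R) R) :
    ∃ p : ℝ → ℝ, MonotoneOn p (Ioo 0 1) ∧ (∀ s ∈ Ioo (0:ℝ) 1, p s ∈ Icc (-R) R) ∧
      (∀ s ∈ Ioo (0:ℝ) 1, s ≤ μ.real (Iic (p s))) ∧
      (∀ s ∈ Ioo (0:ℝ) 1, μ.real (Iio (p s)) ≤ s) := by
  have hbelow : ∀ x, x < -R → μ.real (Iic x) = 0 := by
    intro x hx
    rw [measureReal_eq_zero_iff]
    refine measure_mono_null (t := {y | ¬ y ∈ Icc (-R) R}) ?_ hμ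
    intro y hy hy'
    have : y ≤ x := hy
    linarith [hy'.1]
  have habove : μ.real (Iic R) = 1 := by
    rw [measureReal_def, (prob_compl_eq_zero_iff measurableSet_Iic).1, ENNReal.toReal_one]
    refine measure_mono_null (t := {y | ¬ y ∈ Icc (-R) R}) ?_ hμ
    intro y hy hy'
    exact hy hy'.2
  let T : ℝ → Set ℝ := fun s => {x | s ≤ μ.real (Iic x)}
  have hT : ∀ s ∈ Ioo (0:ℝ) 1, R ∈ T s := fun s hs => by simpa [T, habove] using hs.2.le
  have hTb : ∀ s ∈ Ioo (0:ℝ) 1, ∀ x ∈ T s, -R ≤ x := fun s hs x hx => by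
    by_contra! h
    have h' : s ≤ μ.real (Iic x) := hx
    rw [hbelow x h] at h'
    linarith [hs.1]
  have bdd : ∀ s ∈ Ioo (0:ℝ) 1, BddBelow (T s) := fun s hs => ⟨-R, hTb s hs⟩
  refine ⟨fun s => sInf (T s), ?_, ?_, ?_, ?_⟩
  · intro s hs t ht hst
    exact csInf_le_csInf (bdd s hs) ⟨R, hT t ht⟩ fun x hx => hst.trans hx
  · intro s hs
    exact ⟨le_csInf ⟨R, hT s hs⟩ (hTb s hs), csInf_le (bdd s hs) (hT s hs)⟩
  · intro s hs
    have hc := (ProbabilityTheory.cdf μ).right_continuous (sInf (T s))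
    have hc' := hc.mono_left (nhdsWithin_mono (sInf (T s)) Ioi_subset_Ici_self)
    have := ge_of_tendsto (b := s) hc' ?_
    · rwa [ProbabilityTheory.cdf_eq_real] at this
    · refine eventually_nhdsWithin_of_forall fun x hx => ?_
      obtain ⟨y, hy, hyx⟩ := exists_lt_of_csInf_lt ⟨R, hT s hs⟩ hx
      rw [ProbabilityTheory.cdf_eq_real]
      exact le_trans hy (measureReal_mono (Iic_subset_Iic.2 hyx.le))
  · intro s hs
    have hlt : ∀ x < sInf (T s), μ.real (Iic x) ≤ s := by
      intro x hx
      by_contra! h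
      exact not_le.2 hx (csInf_le (bdd s hs) h.le)
    obtain ⟨u, hu, hul, hut⟩ := exists_seq_strictMono_tendsto (sInf (T s))
    have hU : Iio (sInf (T s)) = ⋃ n, Iic (u n) := by
      ext x
      simp only [mem_Iio, mem_iUnion, mem_Iic]
      refine ⟨fun hx => ?_, fun ⟨n, hn⟩ => hn.trans_lt (hul n)⟩
      obtain ⟨n, hn⟩ := (hut.eventually (lt_mem_nhds hx)).exists
      exact ⟨n, hn.le⟩
    have ht := tendsto_measure_iUnion_atTop (μ := μ) (s := fun n => Iic (u n))
      (fun m n h => Iic_subset_Iic.2 (hu.monotone h))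
    rw [← hU] at ht
    have ht' := (ENNReal.tendsto_toReal (measure_ne_top μ _)).comp ht
    exact le_of_tendsto' ht' fun n => hlt _ (hul n)

open ProbabilityTheory in
/-- The equality case of one-dimensional Prékopa-Leindler type inequalities for measures. -/
theorem eq_translate_of_combo {μ ν σ : Measure ℝ} [IsProbabilityMeasure μ]
    [IsProbabilityMeasure ν] [IsProbabilityMeasure σ] {R : ℝ}
    (hμ : ∀ᵐ x ∂μ, x ∈ Icc (-R) R) (hν : ∀ᵐ x ∂ν, x ∈ Icc (-R) R)
    (hσ : ∀ᵐ x ∂σ, x ∈ Icc (-R) R) {a b : ℝ} (ha : 0 < a) (hb : 0 < b) (hab : a + b = 1)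
    (hE : ∀ c, mgf id μ c ^ a * mgf id ν c ^ b ≤ mgf id σ c)
    (hL : ∀ x y, min (μ.real (Iic x)) (ν.real (Iic y)) ≤ σ.real (Iic (a * x + b * y)))
    (hU : ∀ x y, min (μ.real (Ici x)) (ν.real (Ici y)) ≤ σ.real (Ici (a * x + b * y))) :
    ∃ v : ℝ, μ = ν.map (· + v) ∧ σ = ν.map (· + a * v) := by
  obtain ⟨p, pm, pR, p1, p2⟩ := exists_quantile hμ
  obtain ⟨q, qm, qR, q1, q2⟩ := exists_quantile hν
  set lam := (volume.restrict (Ioo (0:ℝ) 1)) with hlam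
  have hprob : IsProbabilityMeasure lam := ⟨by simp [hlam]⟩
  have pa : AEMeasurable p lam := aemeasurable_restrict_of_monotoneOn measurableSet_Ioo pm
  have qa : AEMeasurable q lam := aemeasurable_restrict_of_monotoneOn measurableSet_Ioo qm
  have ra : AEMeasurable (fun s => a * p s + b * q s) lam := (pa.const_mul a).add (qa.const_mul b)
  have iio : ∀ {μ : Measure ℝ} [IsProbabilityMeasure μ] (x : ℝ),
      μ.real (Iio x) = 1 - μ.real (Ici x) := by
    intro μ _ x
    rw [← compl_Ici, probReal_compl_eq_one_sub measurableSet_Ici]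
  have law1 : lam.map p = μ := map_eq_of_quantile pa p1 p2
  have law2 : lam.map q = ν := map_eq_of_quantile qa q1 q2
  have law3 : lam.map (fun s => a * p s + b * q s) = σ := by
    refine map_eq_of_quantile ra (fun s hs => ?_) (fun s hs => ?_)
    · exact (le_min (p1 s hs) (q1 s hs)).trans (hL _ _)
    · have h1 := p2 s hs
      have h2 := q2 s hs
      rw [iio] at h1 h2 ⊢
      have := hU (p s) (q s)
      have : 1 - s ≤ min (μ.real (Ici (p s))) (ν.real (Ici (q s))) :=
        le_min (by linarith) (by linarith)
      linarith
  have pL : MemLp p 2 lam := memLp_of_bounded (a := -R) (b := R)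
    (ae_restrict_of_forall_mem measurableSet_Ioo pR) pa.aestronglyMeasurable _
  have qL : MemLp q 2 lam := memLp_of_bounded (a := -R) (b := R)
    (ae_restrict_of_forall_mem measurableSet_Ioo qR) qa.aestronglyMeasurable _
  have var := variance_le_of_mgf_le hμ hν hσ hE
  rw [← law1, ← law2, ← law3, variance_map aemeasurable_id pa, variance_map aemeasurable_id qa,
    variance_map aemeasurable_id ra] at var
  simp only [Function.id_comp] at var
  have v1 : Var[fun s => a * p s + b * q s; lam] =
      a ^ 2 * Var[p; lam] + 2 * (a * (b * cov[p, q; lam])) + b ^ 2 * Var[q; lam] := by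
    have h := variance_add (pL.const_mul a) (qL.const_mul b)
    rw [variance_const_mul, variance_const_mul, covariance_const_mul_left,
      covariance_const_mul_right] at h
    exact h
  have v2 := variance_sub pL qL
  have hz : Var[p - q; lam] = 0 := by
    refine le_antisymm ?_ (variance_nonneg _ _)
    rw [v1] at var
    have hb' : b = 1 - a := by linarith
    have : a * b * Var[p - q; lam] ≤ 0 := by
      rw [v2]; subst hb'; nlinarith
    have hab' : 0 < a * b := mul_pos ha hb
    nlinarith
  have hev : eVar[p - q; lam] = 0 := by
    rw [← ofReal_variance (pL.sub qL), hz]; simp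
  rw [evariance_eq_zero_iff (pa.sub qa)] at hev
  set v := ∫ x, (p - q) x ∂lam
  refine ⟨v, ?_, ?_⟩
  · rw [← law1, ← law2, AEMeasurable.map_map_of_aemeasurable (by fun_prop) qa]
    refine Measure.map_congr ?_
    filter_upwards [hev] with s hs
    simp only [Pi.sub_apply, Function.comp] at hs ⊢
    linarith
  · rw [← law3, ← law2, AEMeasurable.map_map_of_aemeasurable (by fun_prop) qa]
    refine Measure.map_congr ?_
    filter_upwards [hev] with s hs
    simp only [Pi.sub_apply, Function.comp] at hs ⊢
    have : p s = q s + v := by linarith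
    rw [this]
    linear_combination (q s) * hab

lemma le_measureReal_Iic_of_forall_pos {σ : Measure ℝ} [IsProbabilityMeasure σ] {c z : ℝ}
    (h : ∀ ε > 0, c ≤ σ.real (Iic (z + ε))) : c ≤ σ.real (Iic z) := by
  have hc := (ProbabilityTheory.cdf σ).right_continuous z
  have hc' := hc.mono_left (nhdsWithin_mono z Ioi_subset_Ici_self)
  have := ge_of_tendsto (b := c) hc' ?_
  · rwa [ProbabilityTheory.cdf_eq_real] at this
  · refine eventually_nhdsWithin_of_forall fun x hx => ?_
    have := h (x - z) (sub_pos.2 hx)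
    rwa [add_sub_cancel, ← ProbabilityTheory.cdf_eq_real] at this

lemma le_measureReal_Ici_of_forall_pos {σ : Measure ℝ} [IsProbabilityMeasure σ] {c z : ℝ}
    (h : ∀ ε > 0, c ≤ σ.real (Ici (z - ε))) : c ≤ σ.real (Ici z) := by
  have : IsProbabilityMeasure (σ.map Neg.neg) :=
    Measure.isProbabilityMeasure_map measurable_neg.aemeasurable
  have e : ∀ z, (σ.map Neg.neg).real (Iic z) = σ.real (Ici (-z)) := by
    intro z
    rw [measureReal_def, Measure.map_apply measurable_neg measurableSet_Iic, measureReal_def]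
    congr 2
    ext x
    simp
  have := le_measureReal_Iic_of_forall_pos (σ := σ.map Neg.neg) (c := c) (z := -z) fun ε hε => by
    rw [e]; convert h ε hε using 3; ring
  rwa [e, neg_neg] at this

section

variable {E : Type*} [NormedAddCommGroup E] [NormedSpace ℝ E]
    [FiniteDimensional ℝ E] [MeasurableSpace E] [BorelSpace E] (μ : Measure E)
    [μ.IsAddHaarMeasure]

/-- Limits of marginals of asymptotically extremal sequences in the Brunn-Minkowski inequality
are translates of each other. -/
theorem limit_eq_translate (U : Ultrafilter ℕ) {a b : ℕ → ℝ} {a0 b0 : ℝ}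
    (hab : ∀ k, a k + b k = 1) (ha : ∀ k, 0 < a k) (hb : ∀ k, 0 < b k) (ha0 : 0 < a0)
    (hb0 : 0 < b0) (hat : Tendsto a U (nhds a0)) (hbt : Tendsto b U (nhds b0))
    {A B S : ℕ → Set E} (hA : ∀ k, MeasurableSet (A k)) (hB : ∀ k, MeasurableSet (B k))
    (hS : ∀ k, MeasurableSet (S k))
    (hABS : ∀ k, ∀ x ∈ A k, ∀ y ∈ B k, a k • x + b k • y ∈ S k) (ℓ : E →L[ℝ] ℝ) {R : ℝ}
    (hAR : ∀ k, ∀ x ∈ A k, |ℓ x| ≤ R) (hBR : ∀ k, ∀ x ∈ B k, |ℓ x| ≤ R)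
    (hSR : ∀ k, ∀ x ∈ S k, |ℓ x| ≤ R) (M : Measure ℝ) [IsFiniteMeasure M]
    (hAM : ∀ k, (μ.restrict (A k)).map ℓ ≤ M) (hBM : ∀ k, (μ.restrict (B k)).map ℓ ≤ M)
    (hSM : ∀ k, (μ.restrict (S k)).map ℓ ≤ M)
    {μ' ν' σ' : Measure ℝ} [IsProbabilityMeasure μ'] [IsProbabilityMeasure ν']
    [IsProbabilityMeasure σ']
    (hμ' : ∀ I, MeasurableSet I → Tendsto (fun k => (μ.restrict (A k)).map ℓ I) U (nhds (μ' I)))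
    (hν' : ∀ I, MeasurableSet I → Tendsto (fun k => (μ.restrict (B k)).map ℓ I) U (nhds (ν' I)))
    (hσ' : ∀ I, MeasurableSet I → Tendsto (fun k => (μ.restrict (S k)).map ℓ I) U (nhds (σ' I))) :
    ∃ v : ℝ, μ' = ν'.map (· + v) ∧ σ' = ν'.map (· + a0 * v) := by
  have hℓ : Measurable ℓ := ℓ.continuous.measurable
  have hab0 : a0 + b0 = 1 :=
    tendsto_nhds_unique (hat.add hbt) (by simp [hab])
  have supp : ∀ {A : ℕ → Set E} {μ' : Measure ℝ}, (∀ k, MeasurableSet (A k)) →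
      (∀ k, ∀ x ∈ A k, |ℓ x| ≤ R) →
      (∀ I, MeasurableSet I → Tendsto (fun k => (μ.restrict (A k)).map ℓ I) U (nhds (μ' I))) →
      ∀ᵐ x ∂μ', x ∈ Icc (-R) R := by
    intro A μ' hA hAR hμ'
    have h := hμ' (Icc (-R) R)ᶜ measurableSet_Icc.compl
    have hz : ∀ k, (μ.restrict (A k)).map ℓ (Icc (-R) R)ᶜ = 0 := by
      intro k
      rw [Measure.map_apply hℓ measurableSet_Icc.compl, Measure.restrict_apply' (hA k)]
      refine measure_mono_null (t := ∅) ?_ (by simp)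
      rintro x ⟨hx, hxA⟩
      exact hx (abs_le.1 (hAR k x hxA))
    simp only [hz] at h
    exact (tendsto_nhds_unique h tendsto_const_nhds : μ' (Icc (-R) R)ᶜ = 0)
  have sμ := supp hA hAR hμ'
  have sν := supp hB hBR hν'
  have sσ := supp hS hSR hσ'
  have leM : ∀ {A : ℕ → Set E} {μ' : Measure ℝ}, (∀ k, (μ.restrict (A k)).map ℓ ≤ M) →
      (∀ I, MeasurableSet I → Tendsto (fun k => (μ.restrict (A k)).map ℓ I) U (nhds (μ' I))) →
      μ' ≤ M := fun hAM hμ' => Measure.le_iff.2 fun I hI => le_of_tendsto' (hμ' I hI)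
        fun k => hAM k I
  have conv : ∀ c, ∀ {A : ℕ → Set E} {μ' : Measure ℝ} [IsProbabilityMeasure μ'],
      (∀ k, MeasurableSet (A k)) →
      (∀ k, ∀ x ∈ A k, |ℓ x| ≤ R) → (∀ k, (μ.restrict (A k)).map ℓ ≤ M) →
      (∀ I, MeasurableSet I → Tendsto (fun k => (μ.restrict (A k)).map ℓ I) U (nhds (μ' I))) →
      Tendsto (fun k => (∫⁻ x in A k, ENNReal.ofReal (Real.exp (c * ℓ x)) ∂μ).toReal) U
        (nhds (ProbabilityTheory.mgf id μ' c)) := by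
    intro c A μ' _ hA hAR hAM hμ'
    have hle : ∀ y, |y| ≤ R → Real.exp (c * y) ≤ Real.exp (|c| * R) := by
      intro y hy
      refine Real.exp_le_exp.2 ((le_abs_self _).trans ?_)
      rw [abs_mul]
      gcongr
    have h := tendsto_lintegral_of_setwise hAM (leM hAM hμ') hμ'
      (φ := fun y => min (Real.exp (c * y)) (Real.exp (|c| * R))) (C := Real.exp (|c| * R))
      (by fun_prop) (fun y => by positivity) (fun y => min_le_right _ _)
    have sμ := supp hA hAR hμ'
    have e1 : ∫⁻ x, ENNReal.ofReal (min (Real.exp (c * x)) (Real.exp (|c| * R))) ∂μ' =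
        ENNReal.ofReal (ProbabilityTheory.mgf id μ' c) := by
      rw [ProbabilityTheory.mgf, ofReal_integral_eq_lintegral_ofReal]
      · refine lintegral_congr_ae ?_
        filter_upwards [sμ] with x hx
        rw [min_eq_left (hle x (abs_le.2 hx))]; rfl
      · simpa [ProbabilityTheory.integrableExpSet] using
          (integrableExpSet_id_eq_univ sμ).ge (mem_univ c)
      · exact ae_of_all _ fun x => (Real.exp_pos _).le
    have e2 : ∀ k, ∫⁻ x, ENNReal.ofReal (min (Real.exp (c * x)) (Real.exp (|c| * R)))
        ∂((μ.restrict (A k)).map ℓ) = ∫⁻ x in A k, ENNReal.ofReal (Real.exp (c * ℓ x)) ∂μ := by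
      intro k
      rw [lintegral_map (by fun_prop) hℓ]
      refine setLIntegral_congr_fun (hA k) fun x hx => ?_
      rw [min_eq_left (hle _ (hAR k x hx))]
    simp only [e1, e2] at h
    have h' := (ENNReal.tendsto_toReal (by simp)).comp h
    rwa [ENNReal.toReal_ofReal ProbabilityTheory.mgf_nonneg] at h'
  have finint : ∀ {A : Set E}, (μ.restrict A).map ℓ ≤ M → (∀ x ∈ A, |ℓ x| ≤ R) →
      MeasurableSet A → ∀ c,
      ∫⁻ x in A, ENNReal.ofReal (Real.exp (c * ℓ x)) ∂μ ≠ ⊤ := by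
    intro A hAM hAR hA c
    have hfin : μ A ≠ ⊤ := by
      have := hAM univ
      rw [Measure.map_apply hℓ MeasurableSet.univ] at this
      simp only [preimage_univ, Measure.restrict_apply_univ] at this
      exact ne_top_of_le_ne_top (measure_ne_top M _) this
    refine ne_top_of_le_ne_top ?_ (setLIntegral_mono (g := fun _ => ENNReal.ofReal
      (Real.exp (|c| * R))) measurable_const fun x hx => ?_)
    · simp only [lintegral_const, Measure.restrict_apply_univ]
      exact ENNReal.mul_ne_top (by simp) hfin
    · refine ENNReal.ofReal_le_ofReal (Real.exp_le_exp.2 ((le_abs_self _).trans ?_))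
      rw [abs_mul]
      have := hAR x hx
      gcongr
  have half : ∀ {I J K : ℕ → Set ℝ} , (∀ k, MeasurableSet (I k)) → (∀ k, MeasurableSet (J k)) →
      (∀ k, MeasurableSet (K k)) → (∀ k, ∀ x ∈ I k, ∀ y ∈ J k, a k * x + b k * y ∈ K k) → ∀ k,
      min ((μ.restrict (A k)).map ℓ (I k)) ((μ.restrict (B k)).map ℓ (J k)) ≤
        (μ.restrict (S k)).map ℓ (K k) := by
    intro I J K hI hJ hK hIJK k
    rw [Measure.map_apply hℓ (hI k), Measure.map_apply hℓ (hJ k), Measure.map_apply hℓ (hK k),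
      Measure.restrict_apply (hℓ (hI k)), Measure.restrict_apply (hℓ (hJ k)),
      Measure.restrict_apply (hℓ (hK k))]
    refine min_measure_le μ (ha k) (hb k) (hab k) ((hℓ (hI k)).inter (hA k))
      ((hℓ (hJ k)).inter (hB k)) ?_
    rintro x ⟨hx, hxA⟩ y ⟨hy, hyB⟩
    refine ⟨?_, hABS k x hxA y hyB⟩
    have := hIJK k _ hx _ hy
    simpa using this
  refine eq_translate_of_combo sμ sν sσ ha0 hb0 hab0 ?_ ?_ ?_
  · intro c
    refine le_of_tendsto_of_tendsto'
      (((conv c hA hAR hAM hμ').rpow hat (Or.inr ha0)).mul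
        ((conv c hB hBR hBM hν').rpow hbt (Or.inr hb0))) (conv c hS hSR hSM hσ') ?_
    intro k
    rw [ENNReal.toReal_rpow, ENNReal.toReal_rpow, ← ENNReal.toReal_mul]
    refine ENNReal.toReal_mono (finint (hSM k) (hSR k) (hS k) c) ?_
    exact setLIntegral_exp_ge μ (ha k) (hb k) (hab k) (hA k) (hB k) (hS k) (hABS k) ℓ c
  · intro x y
    refine le_measureReal_Iic_of_forall_pos fun ε hε => ?_
    have hz : Tendsto (fun k => a k * x + b k * y) U (nhds (a0 * x + b0 * y)) :=
      (hat.mul_const x).add (hbt.mul_const y)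
    have hev := hz.eventually (gt_mem_nhds (show a0 * x + b0 * y < a0 * x + b0 * y + ε by linarith))
    have := le_of_tendsto_of_tendsto ((hμ' (Iic x) measurableSet_Iic).min
      (hν' (Iic y) measurableSet_Iic)) (hσ' (Iic (a0 * x + b0 * y + ε)) measurableSet_Iic) ?_
    · simp only [measureReal_def]
      rw [← ENNReal.toReal_min (measure_ne_top _ _) (measure_ne_top _ _)]
      exact ENNReal.toReal_mono (measure_ne_top _ _) this
    · filter_upwards [hev] with k hk
      refine (half (I := fun _ => Iic x) (J := fun _ => Iic y)
        (K := fun k => Iic (a k * x + b k * y)) (by simp) (by simp) (by simp) ?_ k).trans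
        (measure_mono (Iic_subset_Iic.2 hk.le))
      intro k u hu v hv
      have hu : u ≤ x := hu
      have hv : v ≤ y := hv
      have := ha k
      have := hb k
      simp only [mem_Iic]
      gcongr
  · intro x y
    refine le_measureReal_Ici_of_forall_pos fun ε hε => ?_
    have hz : Tendsto (fun k => a k * x + b k * y) U (nhds (a0 * x + b0 * y)) :=
      (hat.mul_const x).add (hbt.mul_const y)
    have hev := hz.eventually (lt_mem_nhds (show a0 * x + b0 * y - ε < a0 * x + b0 * y by linarith))
    have := le_of_tendsto_of_tendsto ((hμ' (Ici x) measurableSet_Ici).min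
      (hν' (Ici y) measurableSet_Ici)) (hσ' (Ici (a0 * x + b0 * y - ε)) measurableSet_Ici) ?_
    · simp only [measureReal_def]
      rw [← ENNReal.toReal_min (measure_ne_top _ _) (measure_ne_top _ _)]
      exact ENNReal.toReal_mono (measure_ne_top _ _) this
    · filter_upwards [hev] with k hk
      refine (half (I := fun _ => Ici x) (J := fun _ => Ici y)
        (K := fun k => Ici (a k * x + b k * y)) (by simp) (by simp) (by simp) ?_ k).trans
        (measure_mono (Ici_subset_Ici.2 hk.le))
      intro k u hu v hv
      have hu : x ≤ u := hu
      have hv : y ≤ v := hv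
      have := ha k
      have := hb k
      simp only [mem_Ici]
      gcongr

end

/-- If a closed set contains `a0 • x + b0 • y` whenever it contains `x` and `y`, then it is
convex. -/
lemma convex_of_isClosed_of_combo {E : Type*} [NormedAddCommGroup E] [NormedSpace ℝ E] {K : Set E}
    (hK : IsClosed K) {a0 b0 : ℝ} (ha0 : 0 < a0) (hb0 : 0 < b0) (hab0 : a0 + b0 = 1)
    (h : ∀ x ∈ K, ∀ y ∈ K, a0 • x + b0 • y ∈ K) : Convex ℝ K := by
  rw [convex_iff_segment_subset]
  intro x hx y hy
  rw [segment_eq_image_lineMap]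
  rintro _ ⟨t0, ht0, rfl⟩
  by_contra hcon
  set T : Set ℝ := (fun t => AffineMap.lineMap x y t) ⁻¹' K with hT
  have hTc : IsClosed T := hK.preimage AffineMap.lineMap_continuous
  have h0 : (0 : ℝ) ∈ T := by simpa [hT] using hx
  have h1 : (1 : ℝ) ∈ T := by simpa [hT] using hy
  have hcombo : ∀ t ∈ T, ∀ s ∈ T, a0 * t + b0 * s ∈ T := by
    intro t ht s hs
    have := h _ ht _ hs
    simp only [hT, mem_preimage]
    convert this using 1
    simp only [AffineMap.lineMap_apply_module]
    have e : a0 = 1 - b0 := by linarith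
    rw [e]
    module
  have ht0T : t0 ∉ T := hcon
  have hp := (hTc.inter (isClosed_Icc (a := (0:ℝ)) (b := t0))).csSup_mem ⟨0, h0, le_rfl, ht0.1⟩
    ⟨t0, fun s hs => hs.2.2⟩
  have hq := (hTc.inter (isClosed_Icc (a := t0) (b := (1:ℝ)))).csInf_mem ⟨1, h1, ht0.2, le_rfl⟩
    ⟨t0, fun s hs => hs.2.1⟩
  set p := sSup (T ∩ Icc 0 t0)
  set q := sInf (T ∩ Icc t0 1)
  have hpt : p < t0 := lt_of_le_of_ne hp.2.2 fun e => ht0T (e ▸ hp.1)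
  have hqt : t0 < q := lt_of_le_of_ne hq.2.1 fun e => ht0T (e ▸ hq.1)
  have hz := hcombo p hp.1 q hq.1
  have hz1 : p < a0 * p + b0 * q := by
    have := mul_lt_mul_of_pos_left (hpt.trans hqt) hb0
    have e : a0 = 1 - b0 := by linarith
    rw [e]; linarith
  have hz2 : a0 * p + b0 * q < q := by
    have := mul_lt_mul_of_pos_left (hpt.trans hqt) ha0
    have e : b0 = 1 - a0 := by linarith
    rw [e]; linarith
  have := hp.2.1
  have := hq.2.2
  rcases le_total (a0 * p + b0 * q) t0 with hle | hle
  · have := le_csSup (s := T ∩ Icc 0 t0) ⟨t0, fun s hs => hs.2.2⟩ ⟨hz, by linarith, hle⟩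
    linarith
  · have := csInf_le (s := T ∩ Icc t0 1) ⟨t0, fun s hs => hs.2.1⟩ ⟨hz, hle, by linarith⟩
    linarith

section

set_option linter.unusedSectionVars false

variable {E : Type*} [NormedAddCommGroup E] [NormedSpace ℝ E]
    [FiniteDimensional ℝ E] [MeasurableSpace E] [BorelSpace E]

/-- Sequences of uniformly bounded sets which are asymptotically extremal in the Brunn-Minkowski
inequality, along an ultrafilter, together with the setwise limits of their restrictions. -/
structure ExtremalSeq (m : Measure E) where
  U : Ultrafilter ℕ
  a : ℕ → ℝ
  b : ℕ → ℝ
  a0 : ℝ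
  b0 : ℝ
  hab : ∀ k, a k + b k = 1
  ha : ∀ k, 0 < a k
  hb : ∀ k, 0 < b k
  ha0 : 0 < a0
  hb0 : 0 < b0
  hat : Tendsto a U (nhds a0)
  hbt : Tendsto b U (nhds b0)
  A : ℕ → Set E
  B : ℕ → Set E
  S : ℕ → Set E
  hA : ∀ k, MeasurableSet (A k)
  hB : ∀ k, MeasurableSet (B k)
  hS : ∀ k, MeasurableSet (S k)
  hABS : ∀ k, ∀ x ∈ A k, ∀ y ∈ B k, a k • x + b k • y ∈ S k
  R : ℝ
  hAR : ∀ k, A k ⊆ Metric.closedBall 0 R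
  hBR : ∀ k, B k ⊆ Metric.closedBall 0 R
  hSR : ∀ k, S k ⊆ Metric.closedBall 0 R
  μ : Measure E
  ν : Measure E
  σ : Measure E
  hμ1 : μ univ = 1
  hν1 : ν univ = 1
  hσ1 : σ univ = 1
  hμ : ∀ I, MeasurableSet I → Tendsto (fun k => m (A k ∩ I)) U (nhds (μ I))
  hν : ∀ I, MeasurableSet I → Tendsto (fun k => m (B k ∩ I)) U (nhds (ν I))
  hσ : ∀ I, MeasurableSet I → Tendsto (fun k => m (S k ∩ I)) U (nhds (σ I))

namespace ExtremalSeq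

variable {m : Measure E} [m.IsAddHaarMeasure] (X : ExtremalSeq m)

instance : IsProbabilityMeasure X.μ := ⟨X.hμ1⟩
instance : IsProbabilityMeasure X.ν := ⟨X.hν1⟩
instance : IsProbabilityMeasure X.σ := ⟨X.hσ1⟩

lemma hab0 : X.a0 + X.b0 = 1 := tendsto_nhds_unique (X.hat.add X.hbt) (by simp [X.hab])

lemma measure_eq_zero_of_subset {A : ℕ → Set E} {μ : Measure E} {F : Set E}
    (hμ : ∀ I, MeasurableSet I → Tendsto (fun k => m (A k ∩ I)) X.U (nhds (μ I)))
    (hF : MeasurableSet F) (hAF : ∀ k, A k ⊆ F) : μ Fᶜ = 0 := by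
  have h := hμ _ hF.compl
  have : ∀ k, A k ∩ Fᶜ = ∅ := fun k => by
    rw [← sdiff_eq, sdiff_eq_empty]; exact hAF k
  simp only [this, measure_empty] at h
  exact tendsto_nhds_unique h tendsto_const_nhds

lemma exists_eq_map_add :
    ∃ v : E, X.μ = X.ν.map (· + v) ∧ X.σ = X.ν.map (· + X.a0 • v) := by
  have bd : ∀ {A : ℕ → Set E} {μ : Measure E},
      (∀ I, MeasurableSet I → Tendsto (fun k => m (A k ∩ I)) X.U (nhds (μ I))) →
      (∀ k, A k ⊆ Metric.closedBall 0 X.R) → ∀ᵐ x ∂μ, ‖x‖ ≤ X.R := by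
    intro A μ hμ hA
    have := X.measure_eq_zero_of_subset hμ Metric.isClosed_closedBall.measurableSet hA
    filter_upwards [compl_mem_ae_iff.2 this] with x hx
    simpa using hx
  have iμ : Integrable (fun x => x) X.μ := Integrable.of_bound (by fun_prop) X.R (bd X.hμ X.hAR)
  have iν : Integrable (fun x => x) X.ν := Integrable.of_bound (by fun_prop) X.R (bd X.hν X.hBR)
  set v := ∫ x, x ∂X.μ - ∫ x, x ∂X.ν with hv
  have key : ∀ ℓ : E →L[ℝ] ℝ, X.μ.map ℓ = (X.ν.map ℓ).map (· + ℓ v) ∧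
      X.σ.map ℓ = (X.ν.map ℓ).map (· + X.a0 * ℓ v) := by
    intro ℓ
    have hℓ : Measurable ℓ := ℓ.continuous.measurable
    have hbnd : ∀ {A : ℕ → Set E}, (∀ k, A k ⊆ Metric.closedBall 0 X.R) → ∀ k, ∀ x ∈ A k,
        |ℓ x| ≤ ‖ℓ‖ * X.R := by
      intro A hA k x hx
      have h1 := ℓ.le_opNorm x
      have h2 : ‖x‖ ≤ X.R := by simpa using hA k hx
      exact h1.trans (by gcongr)
    have hdom : ∀ {A : ℕ → Set E}, (∀ k, A k ⊆ Metric.closedBall 0 X.R) → ∀ k,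
        (m.restrict (A k)).map ℓ ≤ (m.restrict (Metric.closedBall 0 X.R)).map ℓ :=
      fun hA k => Measure.map_mono (Measure.restrict_mono (hA k) le_rfl) hℓ
    have hconv : ∀ {A : ℕ → Set E} {μ : Measure E}, (∀ k, MeasurableSet (A k)) →
        (∀ I, MeasurableSet I → Tendsto (fun k => m (A k ∩ I)) X.U (nhds (μ I))) →
        ∀ I, MeasurableSet I →
          Tendsto (fun k => (m.restrict (A k)).map ℓ I) X.U (nhds (μ.map ℓ I)) := by
      intro A μ hA hμ I hI
      simp only [Measure.map_apply hℓ hI, Measure.restrict_apply (hℓ hI), inter_comm _ (A _)]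
      exact hμ _ (hℓ hI)
    have : IsFiniteMeasure (m.restrict (Metric.closedBall (0 : E) X.R)) :=
      ⟨by simpa using measure_closedBall_lt_top⟩
    have := Measure.isProbabilityMeasure_map (μ := X.μ) hℓ.aemeasurable
    have := Measure.isProbabilityMeasure_map (μ := X.ν) hℓ.aemeasurable
    have := Measure.isProbabilityMeasure_map (μ := X.σ) hℓ.aemeasurable
    obtain ⟨w, hw1, hw2⟩ := limit_eq_translate m X.U X.hab X.ha X.hb X.ha0 X.hb0 X.hat X.hbt X.hA
      X.hB X.hS X.hABS ℓ (hbnd X.hAR) (hbnd X.hBR) (hbnd X.hSR)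
      ((m.restrict (Metric.closedBall 0 X.R)).map ℓ) (hdom X.hAR) (hdom X.hBR) (hdom X.hSR)
      (hconv X.hA X.hμ) (hconv X.hB X.hν) (hconv X.hS X.hσ)
    have hwv : w = ℓ v := by
      have e1 : ∫ x, x ∂(X.μ.map ℓ) = ℓ (∫ x, x ∂X.μ) := by
        rw [integral_map hℓ.aemeasurable (by fun_prop), ← ℓ.integral_comp_comm iμ]
      have e2 : ∫ x, x ∂((X.ν.map ℓ).map (· + w)) = ℓ (∫ x, x ∂X.ν) + w := by
        rw [integral_map (by fun_prop) (by fun_prop), integral_map hℓ.aemeasurable (by fun_prop),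
          integral_add (ℓ.integrable_comp iν) (integrable_const _), ← ℓ.integral_comp_comm iν]
        simp
      rw [hw1, e2] at e1
      rw [hv, map_sub, ← e1]; ring
    rw [← hwv]
    exact ⟨hw1, hw2⟩
  refine ⟨v, ?_, ?_⟩
  · have := Measure.isProbabilityMeasure_map (μ := X.ν) (f := (· + v)) (by fun_prop)
    refine Measure.ext_of_charFunDual ?_
    ext ℓ
    have hℓ : Measurable ℓ := ContinuousLinearMap.measurable (R := ℝ) ℓ
    rw [charFunDual_eq_charFun_map_one, charFunDual_eq_charFun_map_one, (key ℓ).1,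
      Measure.map_map (by fun_prop) hℓ, Measure.map_map hℓ (by fun_prop)]
    congr 2
    ext x; simp
  · have := Measure.isProbabilityMeasure_map (μ := X.ν) (f := (· + X.a0 • v)) (by fun_prop)
    refine Measure.ext_of_charFunDual ?_
    ext ℓ
    have hℓ : Measurable ℓ := ContinuousLinearMap.measurable (R := ℝ) ℓ
    rw [charFunDual_eq_charFun_map_one, charFunDual_eq_charFun_map_one, (key ℓ).2,
      Measure.map_map (by fun_prop) hℓ, Measure.map_map hℓ (by fun_prop)]
    congr 2
    ext x; simp

/-- The translation vector between the limits. -/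
def v : E := X.exists_eq_map_add.choose

lemma μ_eq : X.μ = X.ν.map (· + X.v) := X.exists_eq_map_add.choose_spec.1

lemma σ_eq : X.σ = X.ν.map (· + X.a0 • X.v) := X.exists_eq_map_add.choose_spec.2

lemma ν_closedBall (x : E) (r : ℝ) :
    X.ν (Metric.closedBall x r) = X.μ (Metric.closedBall (x + X.v) r) := by
  rw [X.μ_eq, Measure.map_apply (by fun_prop) Metric.isClosed_closedBall.measurableSet]
  congr 1; ext y; simp

lemma σ_closedBall (x : E) (r : ℝ) :
    X.σ (Metric.closedBall x r) = X.μ (Metric.closedBall (x + X.b0 • X.v) r) := by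
  rw [X.σ_eq, Measure.map_apply (by fun_prop) Metric.isClosed_closedBall.measurableSet, X.μ_eq,
    Measure.map_apply (by fun_prop) Metric.isClosed_closedBall.measurableSet]
  congr 1; ext y
  have : y + X.v - (x + X.b0 • X.v) = y + X.a0 • X.v - x := by
    have e : X.a0 = 1 - X.b0 := by linarith [X.hab0]
    rw [e]; module
  simp only [mem_preimage, mem_closedBall_iff_norm, this]

/-- The support of the limit. -/
def K : Set E := X.μ.support

lemma exists_mem_near {y : E} (hy : y ∈ X.K) {ε : ℝ} (hε : 0 < ε) :
    ∀ᶠ k in X.U, ∃ z ∈ X.B k, ‖z - (y - X.v)‖ ≤ ε := by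
  have h1 : 0 < X.ν (Metric.closedBall (y - X.v) ε) := by
    rw [ν_closedBall, sub_add_cancel]
    exact (Measure.mem_support_iff_forall y).1 hy _ (Metric.closedBall_mem_nhds y hε)
  filter_upwards [(X.hν _ Metric.isClosed_closedBall.measurableSet).eventually
    (lt_mem_nhds h1)] with k hk
  obtain ⟨z, hz, hz'⟩ := nonempty_of_measure_ne_zero hk.ne'
  exact ⟨z, hz, mem_closedBall_iff_norm.1 hz'⟩

lemma contract (x : E) {y : E} (hy : y ∈ X.K) {r : ℝ} (hr : 0 ≤ r) :
    ENNReal.ofReal (X.a0 ^ Module.finrank ℝ E) * X.μ (Metric.closedBall x r) ≤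
      X.μ (Metric.closedBall (X.a0 • x + X.b0 • y) (X.a0 * r)) := by
  set z := X.a0 • x + X.b0 • (y - X.v) with hz
  have e1 : X.μ (Metric.closedBall (X.a0 • x + X.b0 • y) (X.a0 * r)) =
      X.σ (Metric.closedBall z (X.a0 * r)) := by
    rw [σ_closedBall]; congr 2; rw [hz]; module
  rw [e1]
  have hlim := tendsto_measure_cthickening_of_isClosed (μ := X.σ)
    (s := Metric.closedBall z (X.a0 * r)) ⟨1, one_pos, measure_ne_top _ _⟩
    Metric.isClosed_closedBall
  refine ge_of_tendsto (hlim.mono_left (nhdsWithin_le_nhds (s := Ioi 0))) ?_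
  refine eventually_nhdsWithin_of_forall fun ε hε => ?_
  have hε : 0 < ε := hε
  have ha0 := X.ha0
  rw [cthickening_closedBall hε.le (by positivity)]
  have hmeas := (Metric.isClosed_closedBall (x := z) (ε := ε + X.a0 * r)).measurableSet
  have hf : Tendsto (fun k => ENNReal.ofReal (X.a k ^ Module.finrank ℝ E)) X.U
      (nhds (ENNReal.ofReal (X.a0 ^ Module.finrank ℝ E))) :=
    ENNReal.tendsto_ofReal (X.hat.pow _)
  refine le_of_tendsto_of_tendsto (ENNReal.Tendsto.mul hf
    (Or.inr (measure_ne_top X.μ (Metric.closedBall x r)))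
    (X.hμ _ Metric.isClosed_closedBall.measurableSet) (Or.inr (by simp))) (X.hσ _ hmeas) ?_
  have hε2 : 0 < ε / 2 := by linarith
  have hcont : Tendsto (fun k => ‖X.a k • x - X.a0 • x‖ + ‖X.b k • (y - X.v) - X.b0 • (y - X.v)‖ +
      X.a k * r) X.U (nhds (‖X.a0 • x - X.a0 • x‖ + ‖X.b0 • (y - X.v) - X.b0 • (y - X.v)‖ +
      X.a0 * r)) :=
    ((((X.hat.smul_const x).sub_const _).norm).add
      (((X.hbt.smul_const (y - X.v)).sub_const _).norm)).add (X.hat.mul_const r)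
  simp only [sub_self, norm_zero, zero_add] at hcont
  filter_upwards [X.exists_mem_near hy hε2, hcont.eventually
    (gt_mem_nhds (show X.a0 * r < X.a0 * r + ε / 2 by linarith))] with k ⟨w, hw, hwy⟩ hk
  have hak := X.ha k
  have hbk := X.hb k
  have hbk1 : X.b k ≤ 1 := by linarith [X.hab k]
  have e2 : ENNReal.ofReal (X.a k ^ Module.finrank ℝ E) * m (X.A k ∩ Metric.closedBall x r) =
      m ((· + (- X.b k • w)) ⁻¹' (X.a k • (X.A k ∩ Metric.closedBall x r))) := by
    rw [measure_preimage_add_right, Measure.addHaar_smul, abs_of_pos (by positivity)]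
  rw [e2]
  refine measure_mono ?_
  rintro p ⟨q, ⟨hq, hqx⟩, hqp⟩
  have hp : p = X.a k • q + X.b k • w := by
    simp only at hqp
    rw [hqp]; module
  refine ⟨hp ▸ X.hABS k q hq w hw, ?_⟩
  rw [mem_closedBall_iff_norm, hp, hz]
  have e3 : X.a k • q + X.b k • w - (X.a0 • x + X.b0 • (y - X.v)) =
      X.a k • (q - x) + X.b k • (w - (y - X.v)) + (X.a k • x - X.a0 • x) +
      (X.b k • (y - X.v) - X.b0 • (y - X.v)) := by module
  rw [e3]
  have n1 : ‖X.a k • (q - x)‖ ≤ X.a k * r := by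
    rw [norm_smul, Real.norm_of_nonneg hak.le]
    rw [mem_closedBall_iff_norm] at hqx
    gcongr
  have n2 : ‖X.b k • (w - (y - X.v))‖ ≤ ε / 2 := by
    rw [norm_smul, Real.norm_of_nonneg hbk.le]
    calc _ ≤ 1 * (ε / 2) := by gcongr
      _ = _ := one_mul _
  refine (norm_add_le _ _).trans ?_
  have := (norm_add_le (X.a k • (q - x) + X.b k • (w - (y - X.v))) (X.a k • x - X.a0 • x)).trans
    (add_le_add_left (norm_add_le _ _) _)
  linarith

lemma isClosed_K : IsClosed X.K := Measure.isClosed_support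

lemma convex_K : Convex ℝ X.K := by
  refine convex_of_isClosed_of_combo X.isClosed_K X.ha0 X.hb0 X.hab0 fun x hx y hy => ?_
  refine (Measure.mem_support_iff_forall _).2 fun V hV => ?_
  obtain ⟨r, hr, hrV⟩ := Metric.nhds_basis_closedBall.mem_iff.1 hV
  have ha0 := X.ha0
  have h := X.contract x hy (r := r / X.a0) (by positivity)
  rw [mul_div_cancel₀ _ ha0.ne'] at h
  refine lt_of_lt_of_le ?_ (h.trans (measure_mono hrV))
  have h2 : 0 < X.μ (Metric.closedBall x (r / X.a0)) :=
    (Measure.mem_support_iff_forall x).1 hx _ (Metric.closedBall_mem_nhds x (by positivity))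
  exact ENNReal.mul_pos (by simpa using pow_pos ha0 _) h2.ne'

lemma K_subset : X.K ⊆ Metric.closedBall 0 X.R :=
  Measure.support_subset_of_isClosed Metric.isClosed_closedBall
    (compl_mem_ae_iff.1 (by
      rw [compl_compl]
      exact X.measure_eq_zero_of_subset X.hμ Metric.isClosed_closedBall.measurableSet X.hAR))

lemma μ_le : X.μ ≤ m := Measure.le_iff.2 fun I hI => le_of_tendsto' (X.hμ I hI) fun _ =>
  measure_mono inter_subset_right

lemma μ_compl_K : X.μ X.Kᶜ = 0 := Measure.measure_compl_support

lemma m_K_pos : 0 < m X.K := by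
  refine lt_of_lt_of_le ?_ (X.μ_le X.K)
  rw [(prob_compl_eq_zero_iff X.isClosed_K.measurableSet).1 X.μ_compl_K]
  exact one_pos

lemma m_K_ne_top : m X.K ≠ ⊤ :=
  ne_top_of_le_ne_top measure_closedBall_lt_top.ne (measure_mono X.K_subset)

lemma m_interior_K : m (interior X.K) = m X.K := by
  refine le_antisymm (measure_mono interior_subset) ?_
  calc m X.K ≤ m (interior X.K ∪ frontier X.K) := by
        rw [← closure_eq_interior_union_frontier]; exact measure_mono subset_closure
    _ ≤ m (interior X.K) + m (frontier X.K) := measure_union_le _ _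
    _ = _ := by rw [X.convex_K.addHaar_frontier m, add_zero]

lemma interior_K_nonempty : (interior X.K).Nonempty :=
  nonempty_of_measure_ne_zero (μ := m) (by rw [m_interior_K]; exact X.m_K_pos.ne')

lemma iterate_contract (x : E) {y : E} (hy : y ∈ X.K) {r : ℝ} (hr : 0 ≤ r) (j : ℕ) :
    ENNReal.ofReal ((X.a0 ^ j) ^ Module.finrank ℝ E) * X.μ (Metric.closedBall x r) ≤
      X.μ (Metric.closedBall (X.a0 ^ j • x + (1 - X.a0 ^ j) • y) (X.a0 ^ j * r)) := by
  have ha0 := X.ha0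
  induction j with
  | zero => simp
  | succ j ih =>
    have h := X.contract (X.a0 ^ j • x + (1 - X.a0 ^ j) • y) hy (r := X.a0 ^ j * r) (by positivity)
    have e1 : X.a0 • (X.a0 ^ j • x + (1 - X.a0 ^ j) • y) + X.b0 • y =
        X.a0 ^ (j + 1) • x + (1 - X.a0 ^ (j + 1)) • y := by
      have e : X.b0 = 1 - X.a0 := by linarith [X.hab0]
      rw [e]; module
    rw [e1] at h
    have e2 : X.a0 * (X.a0 ^ j * r) = X.a0 ^ (j + 1) * r := by ring
    rw [e2] at h
    refine le_trans ?_ h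
    calc _ = ENNReal.ofReal (X.a0 ^ Module.finrank ℝ E) *
        (ENNReal.ofReal ((X.a0 ^ j) ^ Module.finrank ℝ E) * X.μ (Metric.closedBall x r)) := by
          rw [← mul_assoc, ← ENNReal.ofReal_mul (by positivity), ← mul_pow, ← pow_succ']
      _ ≤ _ := by gcongr

lemma a0_lt_one : X.a0 < 1 := by linarith [X.hab0, X.hb0]

lemma density_le {x z : E} (hz : z ∈ interior X.K) {f : E → ℝ≥0∞}
    (hfz : Tendsto (fun r => X.μ (Metric.closedBall z r) / m (Metric.closedBall z r))
      (nhdsWithin 0 (Ioi 0)) (nhds (f z))) {r : ℝ} (hr : 0 < r) :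
    X.μ (Metric.closedBall x r) / m (Metric.closedBall x r) ≤ f z := by
  have ha0 := X.ha0
  have ht : Tendsto (fun j : ℕ => X.a0 ^ j) atTop (nhds 0) :=
    tendsto_pow_atTop_nhds_zero_of_lt_one ha0.le X.a0_lt_one
  have hs : Tendsto (fun j : ℕ => X.a0 ^ j * r) atTop (nhdsWithin 0 (Ioi 0)) := by
    refine tendsto_nhdsWithin_iff.2 ⟨by simpa using ht.mul_const r, ?_⟩
    exact Eventually.of_forall fun j => by simp only [mem_Ioi]; positivity
  refine ge_of_tendsto (hfz.comp hs) ?_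
  have hy : Tendsto (fun j : ℕ => (1 - X.a0 ^ j)⁻¹ • (z - X.a0 ^ j • x)) atTop (nhds z) := by
    have := ((ht.const_sub 1).inv₀ (by simp)).smul ((ht.smul_const x).const_sub z)
    simpa using this
  filter_upwards [hy.eventually (mem_interior_iff_mem_nhds.1 hz), eventually_ge_atTop 1]
    with j hj hj1
  have hlt : X.a0 ^ j < 1 := pow_lt_one₀ ha0.le X.a0_lt_one (by omega)
  have h := X.iterate_contract x hj hr.le j
  rw [smul_inv_smul₀ (by linarith), add_sub_cancel] at h
  have e : m (Metric.closedBall z (X.a0 ^ j * r)) =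
      ENNReal.ofReal ((X.a0 ^ j) ^ Module.finrank ℝ E) * m (Metric.closedBall x r) := by
    rw [Measure.addHaar_closedBall_mul m z (by positivity) hr.le,
      Measure.addHaar_closedBall_center m x]
  simp only [Function.comp]
  have hp : 0 < ENNReal.ofReal ((X.a0 ^ j) ^ Module.finrank ℝ E) := by
    rw [ENNReal.ofReal_pos]; positivity
  calc _ = (ENNReal.ofReal ((X.a0 ^ j) ^ Module.finrank ℝ E) * X.μ (Metric.closedBall x r)) /
        m (Metric.closedBall z (X.a0 ^ j * r)) := by
        rw [e, ENNReal.mul_div_mul_left _ _ hp.ne' (by simp)]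
    _ ≤ _ := by gcongr

/-- The limit is a multiple of the Haar measure on the convex body `K`. -/
lemma exists_density : ∃ α : ℝ≥0∞, α ≤ 1 ∧ 0 < α ∧
    ∀ I, MeasurableSet I → X.μ I = α * m (I ∩ X.K) := by
  have hgood := Besicovitch.ae_tendsto_rnDeriv X.μ m
  set f := X.μ.rnDeriv m with hf
  have hne : ∃ x0 ∈ interior X.K, Tendsto (fun r => X.μ (Metric.closedBall x0 r) /
      m (Metric.closedBall x0 r)) (nhdsWithin 0 (Ioi 0)) (nhds (f x0)) := by
    by_contra! hcon
    have : m (interior X.K) = 0 := measure_mono_null (fun x hx => hcon x hx) hgood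
    rw [m_interior_K] at this
    exact X.m_K_pos.ne' this
  obtain ⟨x0, hx0, hx0f⟩ := hne
  have hμ : ∀ I, MeasurableSet I → X.μ I = f x0 * m (I ∩ X.K) := by
    intro I hI
    have hac : X.μ ≪ m := Measure.absolutelyContinuous_of_le X.μ_le
    have hfr : X.μ (frontier X.K) = 0 := hac (X.convex_K.addHaar_frontier m)
    have h1 : ∀ κ : Measure E, κ (frontier X.K) = 0 → κ (I ∩ X.K) = κ (I ∩ interior X.K) := by
      intro κ hκ
      refine le_antisymm ?_ (measure_mono (inter_subset_inter_right _ interior_subset))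
      calc κ (I ∩ X.K) ≤ κ ((I ∩ interior X.K) ∪ frontier X.K) := by
            refine measure_mono fun x hx => ?_
            by_cases h : x ∈ interior X.K
            · exact Or.inl ⟨hx.1, h⟩
            · exact Or.inr ⟨subset_closure hx.2, h⟩
        _ ≤ _ := (measure_union_le _ _).trans (by rw [hκ, add_zero])
    have h2 : X.μ I = X.μ (I ∩ X.K) := by
      refine (measure_inter_conull X.μ_compl_K).symm
    rw [h2, h1 _ hfr, h1 m (X.convex_K.addHaar_frontier m)]
    have hmI : MeasurableSet (I ∩ interior X.K) := hI.inter isOpen_interior.measurableSet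
    conv_lhs => rw [← Measure.withDensity_rnDeriv_eq X.μ m hac, withDensity_apply _ hmI]
    rw [← setLIntegral_const]
    refine setLIntegral_congr_fun_ae hmI ?_
    filter_upwards [hgood] with z hz hzI
    refine le_antisymm ?_ ?_
    · exact le_of_tendsto hz (eventually_nhdsWithin_of_forall fun r hr =>
        X.density_le hx0 hx0f hr)
    · exact le_of_tendsto hx0f (eventually_nhdsWithin_of_forall fun r hr =>
        X.density_le hzI.2 hz hr)
  have hK := hμ X.K X.isClosed_K.measurableSet
  rw [inter_self] at hK
  refine ⟨f x0, ?_, ?_, hμ⟩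
  · have h := X.μ_le X.K
    rw [hK] at h
    by_contra! hcon
    have := ENNReal.mul_lt_mul_left X.m_K_pos.ne' X.m_K_ne_top hcon
    rw [one_mul] at this
    exact absurd h (not_le.2 this)
  · rw [(prob_compl_eq_zero_iff X.isClosed_K.measurableSet).1 X.μ_compl_K] at hK
    by_contra! hcon
    rw [nonpos_iff_eq_zero.1 hcon, zero_mul] at hK
    exact one_ne_zero hK

end ExtremalSeq

end

section

set_option linter.unusedSectionVars false

variable {E : Type*} [NormedAddCommGroup E] [NormedSpace ℝ E]
    [FiniteDimensional ℝ E] [MeasurableSpace E] [BorelSpace E]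

lemma tendsto_measure_inter_closedBall {m : Measure E} [m.IsAddHaarMeasure] {U : Filter ℕ}
    {D : ℕ → Set E} {κ : Measure E}
    (hκ : ∀ I, MeasurableSet I → Tendsto (fun k => m (D k ∩ I)) U (nhds (κ I)))
    {α : ℝ≥0∞} (hα : α ≠ ⊤) {x : E} {r r1 : ℝ} (hr : 0 < r) (hr1 : r < r1)
    (hball : ∀ s ≤ r1, κ (Metric.closedBall x s) = α * m (Metric.closedBall x s))
    {xk : ℕ → E} {rk : ℕ → ℝ} (hx : Tendsto xk U (nhds x)) (hrk : Tendsto rk U (nhds r)) :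
    Tendsto (fun k => m (D k ∩ Metric.closedBall (xk k) (rk k))) U
      (nhds (α * m (Metric.closedBall x r))) := by
  set G : ℝ → ℝ≥0∞ := fun s => α * (ENNReal.ofReal (s ^ Module.finrank ℝ E) *
    m (Metric.closedBall 0 1)) with hG
  have hGs : ∀ s, 0 ≤ s → α * m (Metric.closedBall x s) = G s := fun s hs => by
    rw [hG, Measure.addHaar_closedBall' m x hs]
  have hGc : Tendsto G (nhds r) (nhds (G r)) := by
    refine ENNReal.Tendsto.const_mul (ENNReal.Tendsto.mul_const (ENNReal.tendsto_ofReal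
      ((continuous_pow _).tendsto r)) (Or.inr measure_closedBall_lt_top.ne)) (Or.inr hα)
  rw [hGs r hr.le]
  have hdist : Tendsto (fun k => dist (xk k) x) U (nhds 0) := tendsto_iff_dist_tendsto_zero.1 hx
  refine tendsto_order.2 ⟨fun c hc => ?_, fun c hc => ?_⟩
  · obtain ⟨s, hcs, hs0, hsr⟩ := ((hGc.eventually (lt_mem_nhds hc)).filter_mono
      (nhdsWithin_le_nhds (s := Iio r)) |>.and (Ioo_mem_nhdsLT hr)).exists
    have h1 := hκ (Metric.closedBall x s) Metric.isClosed_closedBall.measurableSet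
    rw [hball s (by linarith), hGs s hs0.le] at h1
    filter_upwards [h1.eventually (lt_mem_nhds hcs), (hdist.add_const s).eventually
      (gt_mem_nhds (show 0 + s < (s + r) / 2 by linarith)), hrk.eventually
      (lt_mem_nhds (show (s + r) / 2 < r by linarith))] with k hk1 hk2 hk3
    refine hk1.trans_le (measure_mono (inter_subset_inter_right _ ?_))
    exact Metric.closedBall_subset_closedBall' (by rw [dist_comm]; linarith)
  · obtain ⟨s, hcs, hs0, hsr⟩ := ((hGc.eventually (gt_mem_nhds hc)).filter_mono
      (nhdsWithin_le_nhds (s := Ioi r)) |>.and (Ioo_mem_nhdsGT hr1)).exists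
    have h1 := hκ (Metric.closedBall x s) Metric.isClosed_closedBall.measurableSet
    rw [hball s (by linarith), hGs s (by linarith)] at h1
    filter_upwards [h1.eventually (gt_mem_nhds hcs), hdist.eventually
      (gt_mem_nhds (show 0 < (s - r) / 2 by linarith)), hrk.eventually
      (gt_mem_nhds (show r < (s + r) / 2 by linarith))] with k hk1 hk2 hk3
    refine (measure_mono (inter_subset_inter_right _ ?_)).trans_lt hk1
    exact Metric.closedBall_subset_closedBall' (by linarith)

lemma exists_tendsto_of_eventually_norm_le {U : Ultrafilter ℕ} {y : ℕ → E} {c : E} {r : ℝ}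
    (h : ∀ᶠ k in U, ‖y k - c‖ ≤ r) : ∃ y0, ‖y0 - c‖ ≤ r ∧ Tendsto y U (nhds y0) := by
  have := FiniteDimensional.proper_real E
  obtain ⟨y0, hy0, hlim⟩ := (isCompact_closedBall c r).ultrafilter_le_nhds' (U.map y)
    (by
      rw [Ultrafilter.mem_map]
      filter_upwards [h] with k hk
      exact mem_closedBall_iff_norm.2 hk)
  exact ⟨y0, mem_closedBall_iff_norm.1 hy0, hlim⟩

namespace ExtremalSeq

variable {m : Measure E} [m.IsAddHaarMeasure] (X : ExtremalSeq m)

lemma tendsto_measure_shift_of_mem {α : ℝ≥0∞} (hα1 : α ≤ 1)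
    (hα : ∀ I, MeasurableSet I → X.μ I = α * m (I ∩ X.K)) {c0 : E} {ρ : ℝ} (hρ : 0 < ρ)
    (hc : Metric.closedBall c0 (4 * ρ) ⊆ X.K) {y y' τ : ℕ → E}
    (hy : ∀ᶠ k in X.U, y k ∈ X.B k ∧ ‖y k - (c0 - X.v)‖ ≤ ρ) (hy' : ∀ᶠ k in X.U, y' k ∈ X.B k)
    (hτ : ∀ᶠ k in X.U, X.a k • τ k = X.b k • (y k - y' k)) (hτρ : ∀ᶠ k in X.U, ‖τ k‖ ≤ ρ) :
    Tendsto (fun k => m {x | x ∈ X.A k ∧ x ∈ Metric.closedBall c0 ρ ∧ x + τ k ∉ X.A k}) X.U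
      (nhds 0) := by
  have hαt : α ≠ ⊤ := ne_top_of_le_ne_top one_ne_top hα1
  have ha0 := X.ha0
  have hb0 := X.hb0
  have hab0 := X.hab0
  have hμball : ∀ x s, dist x c0 ≤ ρ → s ≤ 2 * ρ →
      X.μ (Metric.closedBall x s) = α * m (Metric.closedBall x s) := by
    intro x s hx hs
    rw [hα _ Metric.isClosed_closedBall.measurableSet, inter_eq_left.2]
    exact (Metric.closedBall_subset_closedBall' (by linarith)).trans hc
  obtain ⟨y0, hy0, hylim⟩ := exists_tendsto_of_eventually_norm_le (hy.mono fun k hk => hk.2)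
  obtain ⟨τ0, hτ0, hτlim⟩ := exists_tendsto_of_eventually_norm_le (c := (0 : E)) (r := ρ)
    (hτρ.mono fun k hk => by simpa using hk)
  rw [sub_zero] at hτ0
  set T : ℕ → Set E := fun k =>
    {x | x ∈ Metric.closedBall c0 ρ ∧ X.a k • x + X.b k • y k ∈ X.S k} with hT
  set G : ℕ → Set E := fun k => {x | x ∈ Metric.closedBall c0 ρ ∧ x + τ k ∈ X.A k} with hG
  have hGlim : Tendsto (fun k => m (G k)) X.U (nhds (α * m (Metric.closedBall c0 ρ))) := by
    have h := tendsto_measure_inter_closedBall X.hμ hαt (x := c0 + τ0) hρ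
      (show ρ < 2 * ρ by linarith)
      (fun s hs => hμball _ _ (by simpa [dist_eq_norm] using hτ0) hs)
      (hτlim.const_add c0) (tendsto_const_nhds (x := ρ))
    rw [Measure.addHaar_closedBall_center m] at h
    rw [Measure.addHaar_closedBall_center m]
    refine h.congr fun k => ?_
    rw [← measure_preimage_add_right m (τ k)]
    congr 1
    ext x
    simp [hG, and_comm, dist_eq_norm]
  have hTS : ∀ k, ENNReal.ofReal (X.a k ^ Module.finrank ℝ E) * m (T k) =
      m (X.S k ∩ Metric.closedBall (X.a k • c0 + X.b k • y k) (X.a k * ρ)) := by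
    intro k
    have hak := X.ha k
    have e : ENNReal.ofReal (X.a k ^ Module.finrank ℝ E) * m (T k) =
        m ((· + (- X.b k • y k)) ⁻¹' (X.a k • T k)) := by
      rw [measure_preimage_add_right, Measure.addHaar_smul, abs_of_pos (by positivity)]
    rw [e]
    congr 1
    ext p
    simp only [mem_preimage, mem_smul_set, hT, mem_ofPred_eq, mem_inter_iff]
    constructor
    · rintro ⟨x, ⟨hx, hxS⟩, hxp⟩
      have hp : p = X.a k • x + X.b k • y k := by rw [hxp]; module
      rw [hp]
      refine ⟨hxS, ?_⟩
      rw [mem_closedBall_iff_norm] at hx ⊢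
      rw [add_sub_add_right_eq_sub, ← smul_sub, norm_smul, Real.norm_of_nonneg hak.le]
      gcongr
    · rintro ⟨hpS, hp⟩
      refine ⟨(X.a k)⁻¹ • (p - X.b k • y k), ⟨?_, ?_⟩, ?_⟩
      · rw [mem_closedBall_iff_norm] at hp ⊢
        have e2 : (X.a k)⁻¹ • (p - X.b k • y k) - c0 =
            (X.a k)⁻¹ • (p - (X.a k • c0 + X.b k • y k)) := by
          rw [← sub_sub, sub_right_comm, smul_sub _ _ (X.a k • c0), inv_smul_smul₀ hak.ne']
        rw [e2, norm_smul, norm_inv, Real.norm_of_nonneg hak.le, inv_mul_le_iff₀ hak]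
        exact hp
      · rw [smul_inv_smul₀ hak.ne', sub_add_cancel]; exact hpS
      · rw [smul_inv_smul₀ hak.ne']; module
  have hTlim : Tendsto (fun k => m (T k)) X.U (nhds (α * m (Metric.closedBall c0 ρ))) := by
    have hcen : Tendsto (fun k => X.a k • c0 + X.b k • y k) X.U
        (nhds (X.a0 • c0 + X.b0 • y0)) := (X.hat.smul_const c0).add (X.hbt.smul hylim)
    have h := tendsto_measure_inter_closedBall X.hσ hαt (x := X.a0 • c0 + X.b0 • y0)
      (r := X.a0 * ρ) (r1 := 2 * ρ) (by positivity) (by nlinarith [X.a0_lt_one]) ?_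
      hcen (X.hat.mul_const ρ)
    · simp only [← hTS] at h
      have hf : Tendsto (fun k => (ENNReal.ofReal (X.a k ^ Module.finrank ℝ E))⁻¹) X.U
          (nhds (ENNReal.ofReal (X.a0 ^ Module.finrank ℝ E))⁻¹) :=
        (ENNReal.tendsto_ofReal (X.hat.pow _)).inv
      have hpos : ∀ a : ℝ, 0 < a → ENNReal.ofReal (a ^ Module.finrank ℝ E) ≠ 0 := fun a ha => by
        rw [Ne, ENNReal.ofReal_eq_zero, not_le]; positivity
      have hfin := ENNReal.Tendsto.mul hf (Or.inr (ENNReal.mul_ne_top hαt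
        measure_closedBall_lt_top.ne)) h (Or.inr (by simpa using hpos _ ha0))
      rw [Measure.addHaar_closedBall_mul m _ ha0.le hρ.le, mul_left_comm α, ← mul_assoc,
        ENNReal.inv_mul_cancel (hpos _ ha0) (by simp), one_mul] at hfin
      rw [Measure.addHaar_closedBall_center m]
      refine hfin.congr fun k => ?_
      rw [← mul_assoc, ENNReal.inv_mul_cancel (hpos _ (X.ha k)) (by simp), one_mul]
    · intro s hs
      rw [σ_closedBall, hμball _ _ ?_ hs, Measure.addHaar_closedBall_center m,
        ← Measure.addHaar_closedBall_center m (X.a0 • c0 + X.b0 • y0)]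
      have e : X.a0 • c0 + X.b0 • y0 + X.b0 • X.v - c0 = X.b0 • (y0 - (c0 - X.v)) := by
        have e : X.a0 = 1 - X.b0 := by linarith
        rw [e]; module
      rw [dist_eq_norm, e, norm_smul, Real.norm_of_nonneg hb0.le]
      nlinarith [norm_nonneg (y0 - (c0 - X.v))]
  have hsub := ENNReal.Tendsto.sub hTlim hGlim (Or.inl (ENNReal.mul_ne_top hαt
        measure_closedBall_lt_top.ne))
  rw [tsub_self] at hsub
  refine tendsto_of_tendsto_of_tendsto_of_le_of_le' tendsto_const_nhds hsub (by simp) ?_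
  filter_upwards [hy, hy', hτ] with k hyk hyk' hτk
  have hGm : MeasurableSet (G k) :=
    Metric.isClosed_closedBall.measurableSet.inter ((measurable_add_const (τ k)) (X.hA k))
  have hdisj : Disjoint {x | x ∈ X.A k ∧ x ∈ Metric.closedBall c0 ρ ∧ x + τ k ∉ X.A k} (G k) := by
    rw [Set.disjoint_left]
    rintro x ⟨-, -, h1⟩ ⟨-, h2⟩
    exact h1 h2
  refine ENNReal.le_sub_of_add_le_right ?_ ?_
  · refine ne_top_of_le_ne_top measure_closedBall_lt_top.ne (measure_mono
      (t := Metric.closedBall c0 ρ) fun x hx => hx.1)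
  · rw [← measure_union hdisj hGm]
    refine measure_mono ?_
    rintro x (⟨hxA, hx, -⟩ | ⟨hx, hxA⟩)
    · exact ⟨hx, X.hABS k x hxA _ hyk.1⟩
    · refine ⟨hx, ?_⟩
      have := X.hABS k _ hxA _ hyk'
      rwa [smul_add, hτk, add_assoc, ← smul_add, sub_add_cancel] at this

end ExtremalSeq

end

section

set_option linter.unusedSectionVars false

variable {E : Type*} [NormedAddCommGroup E] [NormedSpace ℝ E]
    [FiniteDimensional ℝ E] [MeasurableSpace E] [BorelSpace E]
    (m : Measure E) [m.IsAddHaarMeasure]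

lemma measure_shift_nsmul_le (A : Set E) (c τ : E) {ρ ρ' : ℝ} (p : ℕ) (hp : p * ‖τ‖ + ρ' ≤ ρ) :
    m {x | x ∈ A ∧ x ∈ Metric.closedBall c ρ' ∧ x + p • τ ∉ A} ≤
      p * m {x | x ∈ A ∧ x ∈ Metric.closedBall c ρ ∧ x + τ ∉ A} := by
  set bad := {x | x ∈ A ∧ x ∈ Metric.closedBall c ρ ∧ x + τ ∉ A} with hbad
  have hsub : {x | x ∈ A ∧ x ∈ Metric.closedBall c ρ' ∧ x + p • τ ∉ A} ⊆
      ⋃ i ∈ Finset.range p, (· + i • τ) ⁻¹' bad := by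
    rintro x ⟨hxA, hx, hxp⟩
    have hex : ∃ i, x + (i : ℕ) • τ ∉ A := ⟨p, hxp⟩
    classical
    set i := Nat.find hex with hi
    have h1 : x + i • τ ∉ A := Nat.find_spec hex
    have hip : i ≤ p := Nat.find_min' hex hxp
    have hi0 : i ≠ 0 := fun h0 => by rw [h0] at h1; simp [hxA] at h1
    obtain ⟨j, hj⟩ := Nat.exists_eq_succ_of_ne_zero hi0
    have h2 : x + j • τ ∈ A := by
      by_contra hcon
      exact Nat.find_min hex (m := j) (by omega) hcon
    simp only [mem_iUnion, Finset.mem_range, mem_preimage]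
    refine ⟨j, by omega, h2, ?_, ?_⟩
    · rw [mem_closedBall_iff_norm] at hx ⊢
      have e : x + j • τ - c = (x - c) + j • τ := by abel
      rw [e]
      have hjp : (j : ℝ) ≤ p := by exact_mod_cast (by omega : j ≤ p)
      have := norm_nsmul_le (n := j) (a := τ)
      have := mul_le_mul_of_nonneg_right hjp (norm_nonneg τ)
      linarith [norm_add_le (x - c) (j • τ)]
    · rw [hj, succ_nsmul, ← add_assoc] at h1
      exact h1
  refine (measure_mono hsub).trans ((measure_biUnion_finset_le _ _).trans ?_)
  simp [measure_preimage_add_right]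

lemma exists_shift_and_ball {A : Set E} (hA : MeasurableSet A) (c : E) {ρ κ : ℝ} (hκ : 0 < κ)
    (hpos : m (A ∩ Metric.closedBall c ρ) ≠ 0) :
    ∃ u : E, ‖u‖ ≤ κ ∧ ∃ x ∈ Metric.closedBall c ρ,
      (m (A ∩ Metric.closedBall c ρ) -
        m {x | x ∈ A ∧ x ∈ Metric.closedBall c ρ ∧ x + u ∉ A}) * m (Metric.closedBall 0 κ) ≤
      m (A ∩ Metric.closedBall c ρ) * m (A ∩ Metric.closedBall x κ) := by
  set E1 := A ∩ Metric.closedBall c ρ with hE1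
  have hE1m : MeasurableSet E1 := hA.inter Metric.isClosed_closedBall.measurableSet
  have hE1t : m E1 ≠ ⊤ := ne_top_of_le_ne_top measure_closedBall_lt_top.ne
    (measure_mono inter_subset_right)
  set W : Set (E × E) := (Metric.closedBall 0 κ ×ˢ E1) ∩ (fun p => p.2 + p.1) ⁻¹' A with hW
  have hWm : MeasurableSet W :=
    (Metric.isClosed_closedBall.measurableSet.prod hE1m).inter (by
      exact (measurable_snd.add measurable_fst) hA)
  have hbm : MeasurableSet (Metric.closedBall (0 : E) κ) :=
    Metric.isClosed_closedBall.measurableSet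
  have hb0 : m (Metric.closedBall (0 : E) κ) ≠ 0 := (Metric.measure_closedBall_pos m 0 hκ).ne'
  have hbt : m (Metric.closedBall (0 : E) κ) ≠ ⊤ := measure_closedBall_lt_top.ne
  obtain ⟨u, hu, hu2⟩ := exists_le_setLAverage (f := fun u => m (Prod.mk u ⁻¹' W)) hb0 hbt
    (measurable_measure_prodMk_left hWm).aemeasurable
  have hI1 : m (Prod.mk u ⁻¹' W) * m (Metric.closedBall 0 κ) ≤ (m.prod m) W := by
    rw [setLAverage_eq] at hu2
    refine (ENNReal.mul_le_of_le_div hu2).trans ?_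
    rw [Measure.prod_apply hWm]
    exact setLIntegral_le_lintegral _ _
  have hI2 : (m.prod m) W = ∫⁻ x in E1, m ((fun u => (u, x)) ⁻¹' W) ∂m := by
    rw [Measure.prod_apply_symm hWm]
    refine (setLIntegral_eq_of_support_subset fun x hx => ?_).symm
    obtain ⟨u, hu⟩ := nonempty_of_measure_ne_zero hx
    exact hu.1.2
  have hslice : ∀ x, m ((fun u => (u, x)) ⁻¹' W) ≤ m (A ∩ Metric.closedBall x κ) := by
    intro x
    rw [← measure_preimage_add_right m x (A ∩ _)]
    refine measure_mono ?_
    rintro u ⟨⟨hu, -⟩, huA⟩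
    simp only [mem_closedBall_iff_norm, sub_zero] at hu
    exact ⟨by simpa [add_comm] using huA, by simpa [mem_closedBall_iff_norm] using hu⟩
  obtain ⟨x, hx, hx2⟩ := exists_setLAverage_le (μ := m) (s := E1)
    (f := fun x => m ((fun u => (u, x)) ⁻¹' W)) hpos hE1m.nullMeasurableSet
    (by
      refine ne_top_of_le_ne_top (ENNReal.mul_ne_top hbt hE1t) ?_
      rw [← setLIntegral_const]
      refine lintegral_mono fun x => (measure_mono ?_)
      rintro u ⟨⟨hu, -⟩, -⟩
      exact hu)
  rw [setLAverage_eq, ← hI2] at hx2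
  refine ⟨u, by simpa using hu, x, hx.2, ?_⟩
  calc _ ≤ m (Prod.mk u ⁻¹' W) * m (Metric.closedBall 0 κ) := by
        gcongr
        rw [tsub_le_iff_right]
        refine (measure_mono ?_).trans (measure_union_le _ _)
        intro z hz
        by_cases hzu : z + u ∈ A
        · exact Or.inl ⟨⟨hu, hz⟩, hzu⟩
        · exact Or.inr ⟨hz.1, hz.2, hzu⟩
    _ ≤ (m.prod m) W := hI1
    _ ≤ m E1 * m ((fun u => (u, x)) ⁻¹' W) := by
        rw [mul_comm]
        exact (ENNReal.div_le_iff_le_mul (Or.inl hpos) (Or.inl hE1t)).1 hx2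
    _ ≤ _ := mul_le_mul_right (hslice x) _

/-- Many small translates of a set inside a ball have to overlap. -/
lemma exists_pair_of_translates {B : Set E} (hB : MeasurableSet B) {c w : E} {ρ : ℝ} {n : ℕ}
    (hw : n * ‖w‖ ≤ ρ / 2)
    (hn : m (Metric.closedBall c ρ) < n * m (B ∩ Metric.closedBall c (ρ / 2))) :
    ∃ l ∈ Icc 1 n, ∃ y ∈ B ∩ Metric.closedBall c (ρ / 2), ∃ y' ∈ B, y - y' = l • w := by
  set D := B ∩ Metric.closedBall c (ρ / 2) with hD
  have hDm : MeasurableSet D := hB.inter Metric.isClosed_closedBall.measurableSet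
  have hpre : ∀ i : ℕ, MeasurableSet ((· + (-(i • w))) ⁻¹' D) :=
    fun i => (measurable_add_const _) hDm
  have hsub : ∀ i ∈ Finset.range n, (· + (-(i • w))) ⁻¹' D ⊆ Metric.closedBall c ρ := by
    intro i hi x hx
    have h := hx.2
    rw [mem_closedBall_iff_norm] at h ⊢
    have e : x - c = (x + (-(i • w)) - c) + i • w := by abel
    rw [e]
    have hin : (i : ℝ) ≤ n := by exact_mod_cast (Finset.mem_range.1 hi).le
    have := norm_nsmul_le (n := i) (a := w)
    have := mul_le_mul_of_nonneg_right hin (norm_nonneg w)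
    linarith [norm_add_le (x + (-(i • w)) - c) (i • w)]
  have key : ∀ i j : ℕ, i < j → j < n → ∀ z, z + (-(i • w)) ∈ D → z + (-(j • w)) ∈ D →
      ∃ l ∈ Icc 1 n, ∃ y ∈ D, ∃ y' ∈ B, y - y' = l • w := by
    intro i j hij hjn z hi hj
    refine ⟨j - i, ⟨by omega, by omega⟩, _, hi, _, hj.1, ?_⟩
    obtain ⟨k, rfl⟩ := Nat.exists_eq_add_of_lt hij
    have : i + k + 1 - i = k + 1 := by omega
    rw [this]
    simp only [add_nsmul]
    abel
  obtain ⟨i, hi, j, hj, hij, z, hzi, hzj⟩ := exists_nonempty_inter_of_measure_univ_lt_sum_measure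
    (m.restrict (Metric.closedBall c ρ)) (s := Finset.range n)
    (t := fun i => (· + (-(i • w))) ⁻¹' D) (fun i _ => (hpre i).nullMeasurableSet) (by
      rw [Measure.restrict_apply_univ]
      refine hn.trans_le (le_of_eq ?_)
      have : ∀ i ∈ Finset.range n, m.restrict (Metric.closedBall c ρ) ((· + (-(i • w))) ⁻¹' D) =
          m D := fun i hi => by
        rw [Measure.restrict_apply (hpre i), inter_eq_left.2 (hsub i hi),
          measure_preimage_add_right]
      rw [Finset.sum_congr rfl this]
      simp)
  rw [Finset.mem_range] at hi hj
  rcases lt_or_gt_of_ne hij with h | h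
  · exact key i j h hj z hzi hzj
  · exact key j i h hi z hzj hzi

namespace ExtremalSeq

variable {m} (X : ExtremalSeq m)

lemma exists_tendsto_shift {α : ℝ≥0∞} (hα1 : α ≤ 1) (hα0 : 0 < α)
    (hα : ∀ I, MeasurableSet I → X.μ I = α * m (I ∩ X.K)) {c0 : E} {ρ : ℝ} (hρ : 0 < ρ)
    (hc : Metric.closedBall c0 (4 * ρ) ⊆ X.K) :
    ∃ κ > 0, κ ≤ ρ / 2 ∧ ∀ u : ℕ → E, (∀ k, ‖u k‖ ≤ κ) →
      Tendsto (fun k => m {x | x ∈ X.A k ∧ x ∈ Metric.closedBall c0 (ρ / 2) ∧ x + u k ∉ X.A k}) X.U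
      (nhds 0) := by
  have ha0 := X.ha0
  have hb0 := X.hb0
  set y0 := c0 - X.v with hy0
  have hν : X.ν (Metric.closedBall y0 (ρ / 2)) = α * m (Metric.closedBall c0 (ρ / 2)) := by
    rw [ν_closedBall, hy0, sub_add_cancel, hα _ Metric.isClosed_closedBall.measurableSet,
      inter_eq_left.2]
    exact (Metric.closedBall_subset_closedBall (by linarith)).trans hc
  have hν0 : X.ν (Metric.closedBall y0 (ρ / 2)) ≠ 0 := by
    rw [hν]
    exact mul_ne_zero hα0.ne' (Metric.measure_closedBall_pos m c0 (by positivity)).ne'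
  obtain ⟨n, hn⟩ := ENNReal.exists_nat_mul_gt hν0
    (measure_closedBall_lt_top (μ := m) (x := y0) (r := ρ)).ne
  have hn1 : 1 ≤ n := by
    by_contra! h0
    have : n = 0 := by omega
    simp [this] at hn
  have hn1' : (1 : ℝ) ≤ n := by exact_mod_cast hn1
  set Q := X.a0 / X.b0 + 1 with hQ
  have hQ1 : 1 ≤ Q := by rw [hQ]; linarith [div_pos ha0 hb0]
  have hκle : ρ / (2 * n * Q) ≤ ρ / 2 := by
    refine div_le_div_of_nonneg_left hρ.le (by norm_num) ?_
    nlinarith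
  refine ⟨ρ / (2 * n * Q), by positivity, hκle, fun u hu => ?_⟩
  have hfac : (1 : ℝ) ≤ (n.factorial : ℝ) := by exact_mod_cast n.factorial_pos
  set w : ℕ → E := fun k => ((n.factorial : ℝ)⁻¹) • u k with hw
  have hwu : ∀ k, ‖w k‖ ≤ ‖u k‖ := fun k => by
    rw [hw, norm_smul, norm_inv, Real.norm_of_nonneg (by positivity)]
    exact mul_le_of_le_one_left (norm_nonneg _) (inv_le_one_of_one_le₀ hfac)
  have hquot : Tendsto (fun k => X.a k / X.b k) X.U (nhds (X.a0 / X.b0)) :=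
    X.hat.div X.hbt hb0.ne'
  have hBlim := ENNReal.Tendsto.const_mul (a := (n : ℝ≥0∞))
    (X.hν (Metric.closedBall y0 (ρ / 2)) Metric.isClosed_closedBall.measurableSet)
    (Or.inr (by simp))
  have hev : ∀ᶠ k in X.U, ∃ l ∈ Icc 1 n, ∃ p : E × E, (p.1 ∈ X.B k ∧ ‖p.1 - y0‖ ≤ ρ) ∧
      p.2 ∈ X.B k ∧ p.1 - p.2 = l • ((X.a k / X.b k) • w k) := by
    filter_upwards [hBlim.eventually (lt_mem_nhds hn), hquot.eventually
      (gt_mem_nhds (show X.a0 / X.b0 < Q by rw [hQ]; linarith))] with k hk1 hk2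
    have hak := X.ha k
    have hbk := X.hb k
    obtain ⟨l, hl, y, hy, y', hy', h⟩ := exists_pair_of_translates m (X.hB k) (c := y0) (ρ := ρ)
      (n := n) (w := (X.a k / X.b k) • w k) (by
        rw [norm_smul, Real.norm_of_nonneg (by positivity)]
        have h1 : ‖w k‖ ≤ ρ / (2 * n * Q) := (hwu k).trans (hu k)
        calc (n : ℝ) * (X.a k / X.b k * ‖w k‖) ≤ n * (Q * (ρ / (2 * n * Q))) := by gcongr
          _ = ρ / 2 := by field_simp) hk1
    refine ⟨l, hl, (y, y'), ⟨hy.1, ?_⟩, hy', h⟩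
    have := mem_closedBall_iff_norm.1 hy.2
    simp only
    linarith
  obtain ⟨l, ⟨hl1, hln⟩, hlev⟩ :=
    (Ultrafilter.eventually_exists_mem_iff (finite_Icc 1 n)).1 hev
  obtain ⟨p, hp⟩ := hlev.choice
  obtain ⟨q, hq⟩ := Nat.dvd_factorial hl1 hln
  have hq0 : q ≠ 0 := fun h0 => Nat.factorial_ne_zero n (by rw [hq, h0, mul_zero])
  have hqw : ∀ k, q • (l • w k) = u k := fun k => by
    rw [smul_smul, mul_comm, ← hq, hw, ← Nat.cast_smul_eq_nsmul ℝ, smul_inv_smul₀ (by positivity)]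
  have hnorm : ∀ k, q * ‖l • w k‖ = ‖u k‖ := fun k => by
    have e : u k = (q : ℝ) • (l • w k) := by rw [Nat.cast_smul_eq_nsmul, hqw]
    rw [e, norm_smul (q : ℝ), RCLike.norm_natCast]
  have hq1 : (1 : ℝ) ≤ q := by exact_mod_cast Nat.one_le_iff_ne_zero.2 hq0
  have hgood := X.tendsto_measure_shift_of_mem hα1 hα hρ hc (y := fun k => (p k).1)
    (y' := fun k => (p k).2) (τ := fun k => l • w k) (hp.mono fun k hk => hk.1)
    (hp.mono fun k hk => hk.2.1) (hp.mono fun k hk => by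
      have hbk := X.hb k
      rw [hk.2.2, smul_comm (X.b k), smul_smul, mul_div_cancel₀ _ hbk.ne', smul_comm])
    (Eventually.of_forall fun k => by
      have := hnorm k
      have := hu k
      nlinarith [norm_nonneg (l • w k)])
  have hmul := ENNReal.Tendsto.const_mul (a := (q : ℝ≥0∞)) hgood (Or.inr (by simp))
  rw [mul_zero] at hmul
  refine tendsto_of_tendsto_of_tendsto_of_le_of_le tendsto_const_nhds hmul (fun _ => zero_le)
    fun k => ?_
  have := measure_shift_nsmul_le m (X.A k) c0 (l • w k) (ρ := ρ) (ρ' := ρ / 2) q (by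
    rw [hnorm]; linarith [hu k])
  simp only [hqw] at this
  exact this

/-- The limit is the Haar measure on a convex body. -/
lemma μ_eq_restrict {I : Set E} (hI : MeasurableSet I) : X.μ I = m (I ∩ X.K) := by
  obtain ⟨α, hα1, hα0, hα⟩ := X.exists_density
  suffices 1 ≤ α by rw [hα I hI, le_antisymm hα1 this, one_mul]
  have hαt : α ≠ ⊤ := ne_top_of_le_ne_top one_ne_top hα1
  obtain ⟨c0, hc0⟩ := X.interior_K_nonempty
  obtain ⟨r, hr, hrK⟩ := Metric.nhds_basis_closedBall.mem_iff.1 (mem_interior_iff_mem_nhds.1 hc0)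
  obtain ⟨ρ, hρ, hc⟩ : ∃ ρ > 0, Metric.closedBall c0 (4 * ρ) ⊆ X.K :=
    ⟨r / 4, by positivity, by rwa [mul_div_cancel₀ _ (by norm_num)]⟩
  obtain ⟨κ, hκ, hκρ, hshift⟩ := X.exists_tendsto_shift hα1 hα0 hα hρ hc
  have hball : ∀ x ∈ Metric.closedBall c0 (ρ / 2), ∀ s ≤ ρ,
      X.μ (Metric.closedBall x s) = α * m (Metric.closedBall x s) := by
    intro x hx s hs
    rw [hα _ Metric.isClosed_closedBall.measurableSet, inter_eq_left.2]
    rw [Metric.mem_closedBall] at hx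
    exact (Metric.closedBall_subset_closedBall' (by linarith)).trans hc
  have hE1 := X.hμ (Metric.closedBall c0 (ρ / 2)) Metric.isClosed_closedBall.measurableSet
  rw [hball c0 (Metric.mem_closedBall_self (by positivity)) _ (by linarith)] at hE1
  set M := m (Metric.closedBall c0 (ρ / 2)) with hM
  have hM0 : M ≠ 0 := (Metric.measure_closedBall_pos m c0 (by positivity)).ne'
  have hMt : M ≠ ⊤ := measure_closedBall_lt_top.ne
  have hαM : α * M ≠ ⊤ := ENNReal.mul_ne_top hαt hMt
  have hαM0 : α * M ≠ 0 := mul_ne_zero hα0.ne' hM0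
  have hex : ∀ k, ∃ p : E × E, ‖p.1‖ ≤ κ ∧ (m (X.A k ∩ Metric.closedBall c0 (ρ / 2)) ≠ 0 →
      p.2 ∈ Metric.closedBall c0 (ρ / 2) ∧ (m (X.A k ∩ Metric.closedBall c0 (ρ / 2)) -
        m {x | x ∈ X.A k ∧ x ∈ Metric.closedBall c0 (ρ / 2) ∧ x + p.1 ∉ X.A k}) *
          m (Metric.closedBall 0 κ) ≤ m (X.A k ∩ Metric.closedBall c0 (ρ / 2)) *
            m (X.A k ∩ Metric.closedBall p.2 κ)) := by
    intro k
    by_cases h0 : m (X.A k ∩ Metric.closedBall c0 (ρ / 2)) = 0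
    · exact ⟨0, by simpa using hκ.le, fun h => absurd h0 h⟩
    · obtain ⟨u, hu, x, hx, h⟩ := exists_shift_and_ball m (X.hA k) c0 (ρ := ρ / 2) hκ h0
      exact ⟨(u, x), hu, fun _ => ⟨hx, h⟩⟩
  choose p hp1 hp2 using hex
  have hne := hE1.eventually_ne hαM0
  obtain ⟨x0, hx0, hxlim⟩ := exists_tendsto_of_eventually_norm_le (y := fun k => (p k).2) (c := c0)
    (r := ρ / 2) (hne.mono fun k hk => mem_closedBall_iff_norm.1 (hp2 k hk).1)
  have hxball := tendsto_measure_inter_closedBall X.hμ hαt hκ (show κ < ρ by linarith)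
    (hball x0 (mem_closedBall_iff_norm.2 hx0)) hxlim (tendsto_const_nhds (x := κ))
  have hshiftlim := hshift (fun k => (p k).1) hp1
  have hl := ENNReal.Tendsto.mul_const (b := m (Metric.closedBall 0 κ))
    (ENNReal.Tendsto.sub hE1 hshiftlim (Or.inl hαM)) (Or.inr measure_closedBall_lt_top.ne)
  have hr := ENNReal.Tendsto.mul hE1 (Or.inr (ENNReal.mul_ne_top hαt
    measure_closedBall_lt_top.ne)) hxball (Or.inr hαM)
  have hle := le_of_tendsto_of_tendsto hl hr (hne.mono fun k hk => (hp2 k hk).2)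
  rw [tsub_zero, Measure.addHaar_closedBall_center m x0] at hle
  by_contra! hcon
  have hb0 : m (Metric.closedBall (0 : E) κ) ≠ 0 := (Metric.measure_closedBall_pos m 0 hκ).ne'
  have h1 := (ENNReal.mul_le_mul_iff_right hαM0 hαM).1 hle
  have h2 := ENNReal.mul_lt_mul_left hb0 measure_closedBall_lt_top.ne hcon
  rw [one_mul] at h2
  exact absurd h1 (not_le.2 h2)

end ExtremalSeq

end

section

set_option linter.unusedSectionVars false

variable {E : Type*} [NormedAddCommGroup E] [NormedSpace ℝ E]
    [FiniteDimensional ℝ E] [MeasurableSpace E] [BorelSpace E]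
    (m : Measure E) [m.IsAddHaarMeasure]

lemma tendsto_measure_diff {U : Filter ℕ} {D : ℕ → Set E} (hD : ∀ k, MeasurableSet (D k))
    {κ : Measure E} (hκ : ∀ I, MeasurableSet I → Tendsto (fun k => m (D k ∩ I)) U (nhds (κ I)))
    {K : Set E} (hK : MeasurableSet K) (hKt : m K ≠ ⊤) (h1 : κ K = m K) (h0 : κ Kᶜ = 0) :
    Tendsto (fun k => m (D k \ K)) U (nhds 0) ∧ Tendsto (fun k => m (K \ D k)) U (nhds 0) := by
  constructor
  · have := hκ _ hK.compl
    rwa [h0] at this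
  · have := ENNReal.Tendsto.sub (tendsto_const_nhds (x := m K)) (hκ _ hK) (Or.inl hKt)
    rw [h1, tsub_self] at this
    refine this.congr fun k => ?_
    rw [← measure_inter_add_sdiff K (hD k), inter_comm K, ENNReal.add_sub_cancel_left
      (ne_top_of_le_ne_top hKt (measure_mono inter_subset_right))]

namespace ExtremalSeq

variable {m} (X : ExtremalSeq m)

lemma m_K : m X.K = 1 := by
  have := X.μ_eq_restrict X.isClosed_K.measurableSet
  rw [inter_self] at this
  rw [← this, (prob_compl_eq_zero_iff X.isClosed_K.measurableSet).1 X.μ_compl_K]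

lemma tendsto_diff_A : Tendsto (fun k => m (X.A k \ X.K)) X.U (nhds 0) ∧
    Tendsto (fun k => m (X.K \ X.A k)) X.U (nhds 0) :=
  tendsto_measure_diff m X.hA X.hμ X.isClosed_K.measurableSet X.m_K_ne_top
    (by rw [X.μ_eq_restrict X.isClosed_K.measurableSet, inter_self]) X.μ_compl_K

lemma tendsto_diff_B : Tendsto (fun k => m (X.B k \ (· + X.v) ⁻¹' X.K)) X.U (nhds 0) ∧
    Tendsto (fun k => m ((· + X.v) ⁻¹' X.K \ X.B k)) X.U (nhds 0) := by
  have hK := X.isClosed_K.measurableSet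
  have hK' : MeasurableSet ((· + X.v) ⁻¹' X.K) := (measurable_add_const _) hK
  have hmK : m ((· + X.v) ⁻¹' X.K) = m X.K := measure_preimage_add_right _ _ _
  refine tendsto_measure_diff m X.hB X.hν hK' (hmK ▸ X.m_K_ne_top) ?_ ?_
  · rw [hmK, X.m_K, ← Measure.map_apply (measurable_add_const _) hK, ← X.μ_eq,
      X.μ_eq_restrict hK, inter_self, X.m_K]
  · rw [← preimage_compl, ← Measure.map_apply (measurable_add_const _) hK.compl, ← X.μ_eq,
      X.μ_compl_K]

end ExtremalSeq

/-- Stability of the Brunn-Minkowski inequality for uniformly bounded sets: almost extremal sets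
are close to translates of one convex set. -/
theorem exists_convex_of_almost_extremal {ε τ : ℝ} (hε : 0 < ε) (hτ : 0 < τ) (R : ℝ) :
    ∃ δ > 0, ∀ a b : ℝ, τ ≤ a → τ ≤ b → a + b = 1 → ∀ A B S : Set E, MeasurableSet A →
      MeasurableSet B → MeasurableSet S → A ⊆ Metric.closedBall 0 R → B ⊆ Metric.closedBall 0 R →
      (∀ x ∈ A, ∀ y ∈ B, a • x + b • y ∈ S) →
      ENNReal.ofReal (1 - δ) ≤ m A → m A ≤ ENNReal.ofReal (1 + δ) →
      ENNReal.ofReal (1 - δ) ≤ m B → m B ≤ ENNReal.ofReal (1 + δ) →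
      m S ≤ ENNReal.ofReal (1 + δ) →
      ∃ (K : Set E) (v : E), IsCompact K ∧ Convex ℝ K ∧ K ⊆ Metric.closedBall 0 R ∧ m K = 1 ∧
        m (A \ K) ≤ ENNReal.ofReal ε ∧ m (K \ A) ≤ ENNReal.ofReal ε ∧
        m (B \ (· + v) ⁻¹' K) ≤ ENNReal.ofReal ε ∧ m ((· + v) ⁻¹' K \ B) ≤ ENNReal.ofReal ε := by
  by_contra! hcon
  have hδ : ∀ k : ℕ, (0 : ℝ) < 1 / (k + 1) := fun k => by positivity
  choose a b ha hb hab A B S hA hB hS hAR hBR hABS hA1 hA2 hB1 hB2 hS2 hfail using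
    fun k : ℕ => hcon (1 / (k + 1)) (hδ k)
  set U : Ultrafilter ℕ := hyperfilter ℕ with hU
  have hUle : (U : Filter ℕ) ≤ atTop := Nat.hyperfilter_le_atTop
  have hb1 : ∀ {a b : ℝ}, τ ≤ a → τ ≤ b → a + b = 1 → ‖a - 0‖ ≤ 1 := fun ha hb hab => by
    rw [sub_zero, Real.norm_eq_abs, abs_le]; constructor <;> linarith
  obtain ⟨a0, -, hat⟩ := exists_tendsto_of_eventually_norm_le (U := U) (y := a) (c := 0) (r := 1)
    (Eventually.of_forall fun k => hb1 (ha k) (hb k) (hab k))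
  obtain ⟨b0, -, hbt⟩ := exists_tendsto_of_eventually_norm_le (U := U) (y := b) (c := 0) (r := 1)
    (Eventually.of_forall fun k => hb1 (hb k) (ha k) (by linarith [hab k]))
  have ha0 : 0 < a0 := hτ.trans_le (ge_of_tendsto' hat ha)
  have hb0 : 0 < b0 := hτ.trans_le (ge_of_tendsto' hbt hb)
  have hap : ∀ k, 0 < a k := fun k => hτ.trans_le (ha k)
  have hbp : ∀ k, 0 < b k := fun k => hτ.trans_le (hb k)
  set S' : ℕ → Set E := fun k => S k ∩ Metric.closedBall 0 R with hS'
  have hS'm : ∀ k, MeasurableSet (S' k) := fun k =>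
    (hS k).inter Metric.isClosed_closedBall.measurableSet
  have hABS' : ∀ k, ∀ x ∈ A k, ∀ y ∈ B k, a k • x + b k • y ∈ S' k := fun k x hx y hy =>
    ⟨hABS k x hx y hy, (convex_closedBall 0 R) (hAR k hx) (hBR k hy) (hap k).le (hbp k).le (hab k)⟩
  have : IsFiniteMeasure (m.restrict (Metric.closedBall (0 : E) R)) :=
    ⟨by simpa using measure_closedBall_lt_top⟩
  have hlimit : ∀ D : ℕ → Set E, (∀ k, D k ⊆ Metric.closedBall 0 R) → ∃ κ : Measure E,
      ∀ I, MeasurableSet I → Tendsto (fun k => m (D k ∩ I)) U (nhds (κ I)) := by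
    intro D hD
    obtain ⟨κ, -, hκ⟩ := exists_setwise_limit U (fun k => m.restrict (D k))
      (m.restrict (Metric.closedBall 0 R)) (fun k => Measure.restrict_mono (hD k) le_rfl)
    refine ⟨κ, fun I hI => (hκ I hI).congr fun k => ?_⟩
    rw [Measure.restrict_apply hI, inter_comm]
  have hone : ∀ {D : ℕ → Set E} {κ : Measure E},
      (∀ I, MeasurableSet I → Tendsto (fun k => m (D k ∩ I)) U (nhds (κ I))) →
      (∀ k : ℕ, ENNReal.ofReal (1 - 1 / (k + 1)) ≤ m (D k)) →
      (∀ k : ℕ, m (D k) ≤ ENNReal.ofReal (1 + 1 / (k + 1))) → κ univ = 1 := by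
    intro D κ hκ h1 h2
    have hd := tendsto_one_div_add_atTop_nhds_zero_nat (𝕜 := ℝ)
    have l1 := ENNReal.tendsto_ofReal (hd.const_sub 1)
    have l2 := ENNReal.tendsto_ofReal (hd.const_add 1)
    rw [sub_zero, ENNReal.ofReal_one] at l1
    rw [add_zero, ENNReal.ofReal_one] at l2
    have h := hκ univ MeasurableSet.univ
    simp only [inter_univ] at h
    exact tendsto_nhds_unique h (tendsto_of_tendsto_of_tendsto_of_le_of_le (l1.mono_left hUle)
      (l2.mono_left hUle) h1 h2)
  obtain ⟨μ, hμ⟩ := hlimit A hAR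
  obtain ⟨ν, hν⟩ := hlimit B hBR
  obtain ⟨σ, hσ⟩ := hlimit S' fun k => inter_subset_right
  let X : ExtremalSeq m :=
    { U := U, a := a, b := b, a0 := a0, b0 := b0, hab := hab, ha := hap, hb := hbp, ha0 := ha0
      hb0 := hb0, hat := hat, hbt := hbt, A := A, B := B, S := S', hA := hA, hB := hB, hS := hS'm
      hABS := hABS', R := R, hAR := hAR, hBR := hBR, hSR := fun k => inter_subset_right
      μ := μ, ν := ν, σ := σ, hμ1 := hone hμ hA1 hA2, hν1 := hone hν hB1 hB2
      hσ1 := hone hσ (fun k => (le_min (hA1 k) (hB1 k)).trans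
        (min_measure_le m (hap k) (hbp k) (hab k) (hA k) (hB k) (hABS' k)))
        (fun k => (measure_mono inter_subset_left).trans (hS2 k))
      hμ := hμ, hν := hν, hσ := hσ }
  have hεp : 0 < ENNReal.ofReal ε := ENNReal.ofReal_pos.2 hε
  obtain ⟨k, ⟨h1, h2⟩, h3, h4⟩ := (((X.tendsto_diff_A.1.eventually (gt_mem_nhds hεp)).and
    (X.tendsto_diff_A.2.eventually (gt_mem_nhds hεp))).and
    ((X.tendsto_diff_B.1.eventually (gt_mem_nhds hεp)).and
    (X.tendsto_diff_B.2.eventually (gt_mem_nhds hεp)))).exists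
  have := FiniteDimensional.proper_real E
  exact absurd (hfail k X.K X.v ((isCompact_closedBall 0 R).of_isClosed_subset X.isClosed_K
    X.K_subset) X.convex_K X.K_subset X.m_K h1.le h2.le h3.le) (not_lt.2 h4.le)

end

/-- The part in a cell decomposition of `[0, D)` into `p` intervals of length `r`. -/
def cells {p : ℕ} (r : ℝ) (i : ZMod p) : Set ℝ := Ico (i.val * r) ((i.val + 1) * r)

lemma pairwise_disjoint_cells {p : ℕ} [NeZero p] {r : ℝ} (hr : 0 < r) :
    Pairwise fun i j : ZMod p => Disjoint (cells r i) (cells r j) := by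
  intro i j hij
  rw [Set.disjoint_left]
  rintro x ⟨h1, h2⟩ ⟨h3, h4⟩
  have e1 : (i.val : ℝ) < j.val + 1 := by
    by_contra! h
    nlinarith
  have e2 : (j.val : ℝ) < i.val + 1 := by
    by_contra! h
    nlinarith
  have : i.val = j.val := by
    have e1' : i.val < j.val + 1 := by exact_mod_cast e1
    have e2' : j.val < i.val + 1 := by exact_mod_cast e2
    omega
  exact hij (ZMod.val_injective p this)

lemma volume_biUnion_cells {p : ℕ} [NeZero p] {r : ℝ} (hr : 0 < r) (s : Finset (ZMod p)) :
    volume (⋃ i ∈ s, cells r i) = s.card * ENNReal.ofReal r := by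
  rw [measure_biUnion_finset (fun i _ j _ hij => pairwise_disjoint_cells hr hij)
    fun i _ => measurableSet_Ico]
  have : ∀ i ∈ s, volume (cells r i) = ENNReal.ofReal r := fun i _ => by
    rw [cells, Real.volume_Ico]; congr 1; ring
  rw [Finset.sum_congr rfl this]; simp

lemma exists_mem_cell {p : ℕ} [NeZero p] {r x : ℝ} (hr : 0 < r) (hx : x ∈ Ico 0 (p * r)) :
    ∃ i : ZMod p, x ∈ cells r i := by
  have h0 : 0 ≤ x / r := div_nonneg hx.1 hr.le
  have h1 : ⌊x / r⌋₊ < p := by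
    rw [Nat.floor_lt h0, div_lt_iff₀ hr]; exact hx.2
  refine ⟨(⌊x / r⌋₊ : ZMod p), ?_⟩
  rw [cells, ZMod.val_natCast, Nat.mod_eq_of_lt h1]
  exact ⟨(le_div_iff₀ hr).1 (Nat.floor_le h0), (div_lt_iff₀ hr).1 (Nat.lt_floor_add_one _)⟩

lemma min_le_volume_cthickening {X Y : Set ℝ} {D : ℝ} (hD : 0 < D) (hX : X ⊆ Icc 0 D)
    (hY : Y ⊆ Icc 0 D) (hX0 : volume X ≠ 0) (hY0 : volume Y ≠ 0) {p : ℕ} (hp : p.Prime) :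
    min (ENNReal.ofReal D) (volume X + volume Y) ≤
      volume.restrict (Icc 0 D) (Metric.cthickening (2 * (D / p))
        ((X + Y) ∪ (· + D) ⁻¹' (X + Y))) + ENNReal.ofReal (D / p) := by
  have : NeZero p := ⟨hp.ne_zero⟩
  have hp0 : (0 : ℝ) < p := by exact_mod_cast hp.pos
  set r := D / p with hr
  have hr0 : 0 < r := by positivity
  have hpr : p * r = D := by rw [hr]; field_simp
  classical
  set F : Set ℝ → Finset (ZMod p) := fun X =>
    Finset.univ.filter fun i => (X ∩ Ico 0 D ∩ cells r i).Nonempty with hF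
  have hcov : ∀ X : Set ℝ, X ⊆ Icc 0 D → volume X ≤ (F X).card * ENNReal.ofReal r := by
    intro X hX
    rw [← volume_biUnion_cells hr0]
    have hsub : X ⊆ (⋃ i ∈ F X, cells r i) ∪ {D} := by
      intro x hx
      rcases eq_or_lt_of_le (hX hx).2 with h | h
      · exact Or.inr h
      · left
        have hxI : x ∈ Ico 0 D := ⟨(hX hx).1, h⟩
        obtain ⟨i, hi⟩ := exists_mem_cell (p := p) hr0 (hpr.symm ▸ hxI)
        exact mem_biUnion (x := i) (by simpa [hF] using ⟨x, ⟨hx, hxI⟩, hi⟩) hi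
    refine (measure_mono hsub).trans ((measure_union_le _ _).trans ?_)
    simp
  have hne : ∀ X : Set ℝ, X ⊆ Icc 0 D → volume X ≠ 0 → (F X).Nonempty := by
    intro X hX h0
    by_contra! hcon
    have := hcov X hX
    rw [hcon] at this
    simp at this
    exact h0 this
  have hcd := ZMod.cauchy_davenport hp (hne X hX hX0) (hne Y hY hY0)
  have hcells : ∀ i : ZMod p, cells r i ⊆ Icc 0 D := by
    rintro i x ⟨h1, h2⟩
    have hi : ((i.val : ℝ) + 1) ≤ p := by exact_mod_cast ZMod.val_lt i
    refine ⟨le_trans (by positivity) h1, h2.le.trans ?_⟩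
    rw [← hpr]; gcongr
  have hthick : (⋃ i ∈ F X + F Y, cells r i) ⊆
      Metric.cthickening (2 * r) ((X + Y) ∪ (· + D) ⁻¹' (X + Y)) ∩ Icc 0 D := by
    refine iUnion₂_subset fun i hi => subset_inter ?_ (hcells i)
    obtain ⟨j, hj, k, hk, rfl⟩ := Finset.mem_add.1 hi
    obtain ⟨x, ⟨hxX, hxD⟩, hxj⟩ := (Finset.mem_filter.1 hj).2
    obtain ⟨y, ⟨hyY, hyD⟩, hyk⟩ := (Finset.mem_filter.1 hk).2
    rintro w ⟨hw1, hw2⟩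
    have hxy : x + y ∈ X + Y := add_mem_add hxX hyY
    have hj1 := ZMod.val_lt j
    have hk1 := ZMod.val_lt k
    have hv := ZMod.val_add j k
    obtain ⟨hx1, hx2⟩ := hxj
    obtain ⟨hy1, hy2⟩ := hyk
    by_cases hjk : j.val + k.val < p
    · rw [Nat.mod_eq_of_lt hjk] at hv
      rw [hv] at hw1 hw2
      push_cast at hw1 hw2
      refine Metric.mem_cthickening_of_dist_le w (x + y) _ _ (Or.inl hxy) ?_
      rw [Real.dist_eq, abs_le]
      constructor <;> linarith
    · rw [Nat.mod_eq_sub_mod (by omega), Nat.mod_eq_of_lt (by omega)] at hv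
      have hv' : ((j + k).val : ℝ) + p = j.val + k.val := by
        rw [hv]; push_cast [Nat.cast_sub (not_lt.1 hjk)]; ring
      refine Metric.mem_cthickening_of_dist_le w (x + y - D) _ _ (Or.inr (by simpa using hxy)) ?_
      have e1 : ((j + k).val : ℝ) * r = j.val * r + k.val * r - D := by
        rw [← hpr]; linear_combination r * hv'
      rw [Real.dist_eq, abs_le]
      constructor <;> linarith
  have hvol : ((F X + F Y).card : ℝ≥0∞) * ENNReal.ofReal r ≤
      volume.restrict (Icc 0 D) (Metric.cthickening (2 * r)
        ((X + Y) ∪ (· + D) ⁻¹' (X + Y))) := by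
    rw [← volume_biUnion_cells hr0, Measure.restrict_apply' measurableSet_Icc]
    exact measure_mono hthick
  rcases min_le_iff.1 hcd with h | h
  · refine (min_le_left _ _).trans (le_trans ?_ le_self_add)
    refine le_trans ?_ hvol
    rw [← hpr, ENNReal.ofReal_mul hp0.le, ENNReal.ofReal_natCast]
    gcongr
  · refine (min_le_right _ _).trans ?_
    calc volume X + volume Y ≤ (F X).card * ENNReal.ofReal r + (F Y).card * ENNReal.ofReal r :=
          add_le_add (hcov X hX) (hcov Y hY)
      _ = ((F X).card + (F Y).card : ℕ) * ENNReal.ofReal r := by push_cast; ring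
      _ ≤ ((F X + F Y).card + 1 : ℕ) * ENNReal.ofReal r := by
          have h' : (F X).card + (F Y).card ≤ (F X + F Y).card + 1 := by
            have := tsub_le_iff_right.1 h
            convert this
          gcongr
      _ ≤ _ := by
          push_cast
          rw [add_mul, one_mul]
          gcongr

/-- Raikov's inequality on the circle `ℝ / D ℤ`. -/
lemma min_le_volume_union {X Y : Set ℝ} (hXc : IsCompact X) (hYc : IsCompact Y) {D : ℝ}
    (hD : 0 < D) (hX : X ⊆ Icc 0 D)
    (hY : Y ⊆ Icc 0 D) (hX0 : volume X ≠ 0) (hY0 : volume Y ≠ 0) :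
    min (ENNReal.ofReal D) (volume X + volume Y) ≤
      volume (((X + Y) ∪ (· + D) ⁻¹' (X + Y)) ∩ Icc 0 D) := by
  choose p hpk hp using Nat.exists_infinite_primes
  have hpt : Tendsto (fun k => (p k : ℝ)) atTop atTop :=
    tendsto_natCast_atTop_atTop.comp (tendsto_atTop_mono hpk tendsto_id)
  have hDp : Tendsto (fun k => D / p k) atTop (nhds 0) := hpt.const_div_atTop D
  have hcl : IsClosed ((X + Y) ∪ (· + D) ⁻¹' (X + Y)) :=
    (hXc.add hYc).isClosed.union ((hXc.add hYc).isClosed.preimage (continuous_add_const D))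
  have h1 := (tendsto_measure_cthickening_of_isClosed (μ := volume.restrict (Icc 0 D))
    ⟨1, one_pos, measure_ne_top _ _⟩ hcl).comp (by simpa using hDp.const_mul 2)
  have h2 := ENNReal.tendsto_ofReal hDp
  have h3 := h1.add h2
  rw [ENNReal.ofReal_zero, add_zero, Measure.restrict_apply' measurableSet_Icc] at h3
  exact ge_of_tendsto' h3 fun k => min_le_volume_cthickening hD hX hY hX0 hY0 (hp k)

lemma volume_add_ge_of_endpoints_mem {X Y : Set ℝ} (hXc : IsCompact X) (hYc : IsCompact Y) {D : ℝ}
    (hD : 0 < D) (hX : X ⊆ Icc 0 D) (hY : Y ⊆ Icc 0 D) (hX0 : volume X ≠ 0) (hY0 : volume Y ≠ 0)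
    (h0 : 0 ∈ X) (hDX : D ∈ X) :
    min (ENNReal.ofReal D) (volume X + volume Y) + volume Y ≤ volume (X + Y) := by
  set Z := X + Y with hZ
  have hZm : MeasurableSet Z := (hXc.add hYc).isClosed.measurableSet
  have hZm' : MeasurableSet ((· + D) ⁻¹' Z) := measurable_add_const D hZm
  set P := Z ∩ Icc 0 D with hP
  set Q := (· + D) ⁻¹' Z ∩ Icc 0 D with hQ
  have hQm : MeasurableSet Q := hZm'.inter measurableSet_Icc
  have h1 : min (ENNReal.ofReal D) (volume X + volume Y) ≤ volume (P ∪ Q) := by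
    rw [hP, hQ, ← union_inter_distrib_right]
    exact min_le_volume_union hXc hYc hD hX hY hX0 hY0
  have h2 : volume Y ≤ volume (P ∩ Q) := by
    refine measure_mono fun y hy => ⟨⟨?_, hY hy⟩, ?_, hY hy⟩
    · have := add_mem_add h0 hy
      rwa [zero_add] at this
    · show y + D ∈ Z
      rw [add_comm]
      exact add_mem_add hDX hy
  have h3 : volume P + volume Q ≤ volume Z := by
    have e : volume Q = volume (Z ∩ Icc D (2 * D)) := by
      rw [← measure_preimage_add_right volume D (Z ∩ Icc D (2 * D))]
      congr 1
      ext x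
      simp only [hQ, mem_inter_iff, mem_preimage, mem_Icc]
      constructor
      · rintro ⟨h, h1, h2⟩; exact ⟨h, by linarith, by linarith⟩
      · rintro ⟨h, h1, h2⟩; exact ⟨h, by linarith, by linarith⟩
    have e2 : volume (Z ∩ Icc D (2 * D)) ≤ volume (Z \ Icc 0 D) := by
      calc _ ≤ volume ((Z \ Icc 0 D) ∪ {D}) := by
            refine measure_mono fun x hx => ?_
            by_cases h : x = D
            · exact Or.inr h
            · exact Or.inl ⟨hx.1, fun hP => h (le_antisymm hP.2 hx.2.1)⟩
        _ ≤ volume (Z \ Icc 0 D) + volume {D} := measure_union_le _ _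
        _ = _ := by simp
    calc volume P + volume Q ≤ volume (Z ∩ Icc 0 D) + volume (Z \ Icc 0 D) := by
          rw [e]
          exact add_le_add_right e2 _
      _ = volume Z := measure_inter_add_sdiff Z measurableSet_Icc
  calc _ ≤ volume (P ∪ Q) + volume (P ∩ Q) := add_le_add h1 h2
    _ = volume P + volume Q := measure_union_add_inter _ hQm
    _ ≤ _ := h3


lemma volume_add_ge_of_diam {X Y : Set ℝ} (hXc : IsCompact X) (hYc : IsCompact Y)
    (hX0 : volume X ≠ 0) (hY0 : volume Y ≠ 0) {D x₀ y₀ : ℝ} (hD : 0 < D) (hx : x₀ ∈ X)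
    (hxD : x₀ + D ∈ X) (hX : X ⊆ Icc x₀ (x₀ + D)) (hY : Y ⊆ Icc y₀ (y₀ + D)) :
    min (ENNReal.ofReal D) (volume X + volume Y) + volume Y ≤ volume (X + Y) := by
  have tr : ∀ (Z : Set ℝ) c, volume ((· + c) ⁻¹' Z) = volume Z :=
    fun Z c => measure_preimage_add_right volume c Z
  have hc : ∀ {Z : Set ℝ} c, IsCompact Z → IsCompact ((· + c) ⁻¹' Z) := fun c h =>
    (Homeomorph.addRight c).isClosedEmbedding.isCompact_preimage h
  have := volume_add_ge_of_endpoints_mem (hc x₀ hXc) (hc y₀ hYc) hD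
    (fun z hz => ⟨by have := (hX hz).1; linarith, by have := (hX hz).2; linarith⟩)
    (fun z hz => ⟨by have := (hY hz).1; linarith, by have := (hY hz).2; linarith⟩)
    (by rwa [tr]) (by rwa [tr]) (by simpa using hx) (by simpa [add_comm] using hxD)
  rw [tr, tr] at this
  refine this.trans ?_
  rw [← tr (X + Y) (x₀ + y₀)]
  refine measure_mono ?_
  rintro _ ⟨x, hx, y, hy, rfl⟩
  refine ⟨x + x₀, hx, y + y₀, hy, ?_⟩
  simp only
  ring

lemma dist_le_of_volume_add_lt_of_isCompact {X Y : Set ℝ} (hXc : IsCompact X) (hYc : IsCompact Y)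
    (hX0 : volume X ≠ 0) (hY0 : volume Y ≠ 0)
    (h : volume (X + Y) < volume X + volume Y + min (volume X) (volume Y)) {p q : ℝ}
    (hp : p ∈ X) (hq : q ∈ X) : ENNReal.ofReal |p - q| ≤ volume X + volume Y := by
  have hXn := nonempty_of_measure_ne_zero hX0
  have hYn := nonempty_of_measure_ne_zero hY0
  obtain ⟨x₀, hx₀, hx₀'⟩ := hXc.exists_isLeast hXn
  obtain ⟨x₁, hx₁, hx₁'⟩ := hXc.exists_isGreatest hXn
  obtain ⟨y₀, hy₀, hy₀'⟩ := hYc.exists_isLeast hYn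
  obtain ⟨y₁, hy₁, hy₁'⟩ := hYc.exists_isGreatest hYn
  have hXI : X ⊆ Icc x₀ x₁ := fun z hz => ⟨hx₀' hz, hx₁' hz⟩
  have hYI : Y ⊆ Icc y₀ y₁ := fun z hz => ⟨hy₀' hz, hy₁' hz⟩
  have pos : ∀ {Z : Set ℝ} {u v}, volume Z ≠ 0 → Z ⊆ Icc u v → 0 < v - u := by
    intro Z u v h0 hZ
    by_contra! hle
    refine h0 (le_antisymm ((measure_mono hZ).trans ?_) zero_le)
    rw [Real.volume_Icc, ENNReal.ofReal_of_nonpos hle]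
  have hpq : |p - q| ≤ x₁ - x₀ := by
    have := hXI hp; have := hXI hq
    rw [abs_le]
    constructor <;> linarith [(hXI hp).1, (hXI hp).2, (hXI hq).1, (hXI hq).2]
  refine (ENNReal.ofReal_le_ofReal hpq).trans ?_
  have fin : volume X ≠ ∞ ∧ volume Y ≠ ∞ := ⟨hXc.measure_lt_top.ne, hYc.measure_lt_top.ne⟩
  rcases le_total (y₁ - y₀) (x₁ - x₀) with hle | hle
  · have := volume_add_ge_of_diam hXc hYc hX0 hY0 (pos hX0 hXI) hx₀ (by simpa using hx₁)
      (by simpa using hXI) (y₀ := y₀) (hYI.trans (Icc_subset_Icc_right (by linarith)))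
    by_contra! hlt
    rw [min_eq_right hlt.le] at this
    exact absurd (this.trans_lt h) (not_lt.2 (add_le_add_right (min_le_right _ _) _))
  · have := volume_add_ge_of_diam hYc hXc hY0 hX0 (pos hY0 hYI) hy₀ (by simpa using hy₁)
      (by simpa using hYI) (y₀ := x₀) (hXI.trans (Icc_subset_Icc_right (by linarith)))
    by_contra! hlt
    rw [min_eq_right (by rw [add_comm]; exact hlt.le.trans (ENNReal.ofReal_le_ofReal hle)),
      add_comm Y, add_comm (volume Y)] at this
    exact absurd (this.trans_lt h) (not_lt.2 (add_le_add_right (min_le_left _ _) _))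

/-- Freiman's `3k - 4` theorem on the line, in terms of the diameter. -/
lemma dist_le_of_volume_lt {X Y S : Set ℝ} (hX : MeasurableSet X) (hY : MeasurableSet Y)
    (hX0 : volume X ≠ 0) (hY0 : volume Y ≠ 0)
    (hS : ∀ x ∈ X, ∀ y ∈ Y, x + y ∈ S)
    (h : volume S < volume X + volume Y + min (volume X) (volume Y)) {p q : ℝ}
    (hp : p ∈ X) (hq : q ∈ X) : ENNReal.ofReal |p - q| ≤ volume X + volume Y := by
  have key : ∀ r < volume X, ∀ s < volume Y, volume S < r + s + min r s →
      ENNReal.ofReal |p - q| ≤ volume X + volume Y := by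
    intro r hr s hs hrs
    obtain ⟨K, hKX, hK, hrK⟩ := hX.exists_lt_isCompact hr
    obtain ⟨L, hLY, hL, hsL⟩ := hY.exists_lt_isCompact hs
    have hKs : insert p (insert q K) ⊆ X := insert_subset hp (insert_subset hq hKX)
    have hKm : volume K ≤ volume (insert p (insert q K)) :=
      measure_mono ((subset_insert _ _).trans (subset_insert _ _))
    refine (dist_le_of_volume_add_lt_of_isCompact ((hK.insert q).insert p) hL
      (zero_le.trans_lt (hrK.trans_le hKm)).ne' (zero_le.trans_lt hsL).ne' ?_
      (mem_insert _ _) (mem_insert_of_mem _ (mem_insert _ _))).trans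
      (add_le_add (measure_mono hKs) (measure_mono hLY))
    refine lt_of_le_of_lt (measure_mono ?_) (hrs.trans_le ?_)
    · rintro _ ⟨x, hx, y, hy, rfl⟩
      exact hS x (hKs hx) y (hLY hy)
    · have := hrK.le.trans hKm
      gcongr
  have cont : Tendsto (fun r : ℝ≥0∞ × ℝ≥0∞ => r.1 + r.2 + min r.1 r.2)
      (nhds (volume X, volume Y)) (nhds (volume X + volume Y + min (volume X) (volume Y))) := by
    have : Continuous fun r : ℝ≥0∞ × ℝ≥0∞ => r.1 + r.2 + min r.1 r.2 := by fun_prop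
    exact this.tendsto (volume X, volume Y)
  have hev := (cont.mono_left (nhdsWithin_le_nhds
    (s := Iio (volume X) ×ˢ Iio (volume Y)))).eventually
    (lt_mem_nhds h)
  rw [nhdsWithin_prod_eq] at hev
  have : (nhdsWithin (volume X) (Iio (volume X))).NeBot :=
    nhdsLT_neBot_of_exists_lt ⟨0, pos_iff_ne_zero.2 hX0⟩
  have : (nhdsWithin (volume Y) (Iio (volume Y))).NeBot :=
    nhdsLT_neBot_of_exists_lt ⟨0, pos_iff_ne_zero.2 hY0⟩
  obtain ⟨⟨r, s⟩, h1, h2⟩ := (hev.and (prod_mem_prod self_mem_nhdsWithin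
    self_mem_nhdsWithin)).exists
  exact key r h2.1 s h2.2 h1

section

set_option linter.unusedSectionVars false

variable {E : Type*} [NormedAddCommGroup E] [NormedSpace ℝ E]
    [FiniteDimensional ℝ E] [MeasurableSpace E] [BorelSpace E]
    {F : Type*} [NormedAddCommGroup F] [NormedSpace ℝ F]
    [FiniteDimensional ℝ F] [MeasurableSpace F] [BorelSpace F]

/-- The triple `A`, `B`, `S ⊇ aA + bB` is almost extremal in the Brunn-Minkowski inequality. -/
structure NearExtremal (m : Measure E) (τ δ a b : ℝ) (A B S : Set E) : Prop where
  τ_pos : 0 < τ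
  le_a : τ ≤ a
  le_b : τ ≤ b
  add_eq : a + b = 1
  meas_A : MeasurableSet A
  meas_B : MeasurableSet B
  meas_S : MeasurableSet S
  combo : ∀ x ∈ A, ∀ y ∈ B, a • x + b • y ∈ S
  le_A : ENNReal.ofReal (1 - δ) ≤ m A
  A_le : m A ≤ ENNReal.ofReal (1 + δ)
  le_B : ENNReal.ofReal (1 - δ) ≤ m B
  B_le : m B ≤ ENNReal.ofReal (1 + δ)
  S_le : m S ≤ ENNReal.ofReal (1 + δ)

namespace NearExtremal

variable {m : Measure E} {τ δ a b : ℝ} {A B S : Set E}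

lemma a_pos (h : NearExtremal m τ δ a b A B S) : 0 < a := h.τ_pos.trans_le h.le_a

lemma b_pos (h : NearExtremal m τ δ a b A B S) : 0 < b := h.τ_pos.trans_le h.le_b

lemma a_le_one (h : NearExtremal m τ δ a b A B S) : a ≤ 1 := by linarith [h.b_pos, h.add_eq]

lemma b_le_one (h : NearExtremal m τ δ a b A B S) : b ≤ 1 := by linarith [h.a_pos, h.add_eq]

lemma swap (h : NearExtremal m τ δ a b A B S) : NearExtremal m τ δ b a B A S :=
  ⟨h.τ_pos, h.le_b, h.le_a, by linarith [h.add_eq], h.meas_B, h.meas_A, h.meas_S,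
    fun x hx y hy => by rw [add_comm]; exact h.combo y hy x hx, h.le_B, h.B_le, h.le_A, h.A_le,
    h.S_le⟩

lemma mono (h : NearExtremal m τ δ a b A B S) {δ' : ℝ} (hδ : δ ≤ δ') :
    NearExtremal m τ δ' a b A B S where
  __ := h
  le_A := (ENNReal.ofReal_le_ofReal (by linarith)).trans h.le_A
  A_le := h.A_le.trans (ENNReal.ofReal_le_ofReal (by linarith))
  le_B := (ENNReal.ofReal_le_ofReal (by linarith)).trans h.le_B
  B_le := h.B_le.trans (ENNReal.ofReal_le_ofReal (by linarith))
  S_le := h.S_le.trans (ENNReal.ofReal_le_ofReal (by linarith))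

end NearExtremal

lemma measurableEmbedding_affine (e : E ≃L[ℝ] F) (p : F) :
    MeasurableEmbedding fun x => e x + p :=
  ((Homeomorph.addRight p).measurableEmbedding).comp e.toHomeomorph.measurableEmbedding

lemma measure_image_affine {m : Measure E} {m' : Measure F} [m'.IsAddHaarMeasure] {e : E ≃L[ℝ] F}
    (he : MeasurePreserving e m m') (p : F) (X : Set E) :
    m' ((fun x => e x + p) '' X) = m X := by
  have h : MeasurePreserving (fun x => e x + p) m m' :=
    (measurePreserving_add_right m' p).comp he
  rw [← h.measure_preimage_emb (measurableEmbedding_affine e p),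
    preimage_image_eq _ (measurableEmbedding_affine e p).injective]

lemma NearExtremal.image {m : Measure E} {m' : Measure F} [m'.IsAddHaarMeasure] {τ δ a b : ℝ}
    {A B S : Set E} (h : NearExtremal m τ δ a b A B S) {e : E ≃L[ℝ] F}
    (he : MeasurePreserving e m m') (p q : F) :
    NearExtremal m' τ δ a b ((fun x => e x + p) '' A) ((fun x => e x + q) '' B)
      ((fun x => e x + (a • p + b • q)) '' S) where
  τ_pos := h.τ_pos
  le_a := h.le_a
  le_b := h.le_b
  add_eq := h.add_eq
  meas_A := (measurableEmbedding_affine e p).measurableSet_image.2 h.meas_A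
  meas_B := (measurableEmbedding_affine e q).measurableSet_image.2 h.meas_B
  meas_S := (measurableEmbedding_affine e _).measurableSet_image.2 h.meas_S
  combo := by
    rintro _ ⟨x, hx, rfl⟩ _ ⟨y, hy, rfl⟩
    refine ⟨a • x + b • y, h.combo x hx y hy, ?_⟩
    simp only [map_add, map_smul, smul_add]
    abel
  le_A := by rw [measure_image_affine he]; exact h.le_A
  A_le := by rw [measure_image_affine he]; exact h.A_le
  le_B := by rw [measure_image_affine he]; exact h.le_B
  B_le := by rw [measure_image_affine he]; exact h.B_le
  S_le := by rw [measure_image_affine he]; exact h.S_le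

/-- If most of `A` and of `B` projects into a ball, then all of `A` projects into a larger ball,
provided `A, B, S` is almost extremal. -/
lemma NearExtremal.norm_le_of_subset {m : Measure E} [m.IsAddHaarMeasure] {τ δ a b : ℝ}
    {A B S : Set E} (h : NearExtremal m τ δ a b A B S) (P : E →L[ℝ] F) {r ε : ℝ} {A₀ B₀ : Set E}
    (hA₀ : A₀ ⊆ A) (hB₀ : B₀ ⊆ B) (hA₀m : MeasurableSet A₀) (hB₀m : MeasurableSet B₀)
    (hA₀r : ∀ x ∈ A₀, ‖P x‖ ≤ r) (hB₀r : ∀ x ∈ B₀, ‖P x‖ ≤ r)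
    (hA₀ε : ENNReal.ofReal (1 - ε) ≤ m A₀) (hB₀ε : ENNReal.ofReal (1 - ε) ≤ m B₀) (hε : ε < 1)
    (hδ : 1 + δ < (1 - ε) * (1 + τ ^ Module.finrank ℝ E)) {x : E} (hx : x ∈ A) :
    ‖P x‖ ≤ 2 * r / τ := by
  by_contra! hlt
  set C := P ⁻¹' Metric.closedBall 0 r with hC
  have hCm : MeasurableSet C := P.continuous.measurable Metric.isClosed_closedBall.measurableSet
  have h1 : ENNReal.ofReal (1 - ε) ≤ m (S ∩ C) := by
    refine (le_min hA₀ε hB₀ε).trans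
      (min_measure_le m h.a_pos h.b_pos h.add_eq hA₀m hB₀m fun u hu v hv =>
        ⟨h.combo u (hA₀ hu) v (hB₀ hv), ?_⟩)
    rw [hC, mem_preimage, map_add, map_smul, map_smul]
    exact convex_closedBall 0 r (by simpa using hA₀r u hu) (by simpa using hB₀r v hv)
      h.a_pos.le h.b_pos.le h.add_eq
  have h2 : ENNReal.ofReal (τ ^ Module.finrank ℝ E * (1 - ε)) ≤ m (S \ C) := by
    have e : m ((fun y => a • x + y) '' (b • B₀)) =
        ENNReal.ofReal (b ^ Module.finrank ℝ E) * m B₀ := by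
      rw [image_add_left, measure_preimage_add, Measure.addHaar_smul,
        abs_of_nonneg (pow_nonneg h.b_pos.le _)]
    have hτ := h.τ_pos.le
    rw [ENNReal.ofReal_mul (by positivity)]
    calc _ ≤ ENNReal.ofReal (b ^ Module.finrank ℝ E) * m B₀ := by
          gcongr
          exact h.le_b
      _ = _ := e.symm
      _ ≤ _ := measure_mono ?_
    rintro _ ⟨_, ⟨y, hy, rfl⟩, rfl⟩
    refine ⟨h.combo x hx y (hB₀ hy), fun hmem => ?_⟩
    simp only [hC, mem_preimage, map_add, map_smul, mem_closedBall_zero_iff] at hmem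
    have hy' := hB₀r y hy
    have t1 : ‖a • P x‖ ≤ ‖a • P x + b • P y‖ + ‖b • P y‖ := by
      simpa using norm_sub_le (a • P x + b • P y) (b • P y)
    rw [norm_smul, norm_smul, Real.norm_of_nonneg h.a_pos.le, Real.norm_of_nonneg h.b_pos.le] at t1
    have t2 : τ * (2 * r / τ) = 2 * r := mul_div_cancel₀ _ h.τ_pos.ne'
    have t3 : τ * (2 * r / τ) < a * ‖P x‖ := by
      have := norm_nonneg (P y)
      have hr : 0 ≤ 2 * r / τ := div_nonneg (by linarith) hτ
      calc τ * (2 * r / τ) ≤ a * (2 * r / τ) := by gcongr; exact h.le_a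
        _ < _ := mul_lt_mul_of_pos_left hlt h.a_pos
    have t4 : b * ‖P y‖ ≤ 1 * r := mul_le_mul h.b_le_one hy' (norm_nonneg _) zero_le_one
    linarith
  have h3 : ENNReal.ofReal ((1 - ε) * (1 + τ ^ Module.finrank ℝ E)) ≤ ENNReal.ofReal (1 + δ) := by
    have hτ := pow_nonneg h.τ_pos.le (Module.finrank ℝ E)
    calc _ = ENNReal.ofReal (1 - ε) + ENNReal.ofReal (τ ^ Module.finrank ℝ E * (1 - ε)) := by
          rw [← ENNReal.ofReal_add (by linarith) (mul_nonneg hτ (by linarith))]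
          congr 1; ring
      _ ≤ m (S ∩ C) + m (S \ C) := add_le_add h1 h2
      _ = m S := measure_inter_add_sdiff S hCm
      _ ≤ _ := h.S_le
  rcases ENNReal.ofReal_le_ofReal_iff'.1 h3 with h4 | h4
  · linarith
  · have := mul_pos (sub_pos.2 hε) (add_pos one_pos (pow_pos h.τ_pos (Module.finrank ℝ E)))
    linarith

/-- Bounded almost extremal sets are, up to affine measure preserving maps, contained in a fixed
ball. -/
def TightExtremal (m : Measure E) : Prop :=
  ∀ τ > 0, ∃ R δ : ℝ, 0 < δ ∧ ∀ (a b : ℝ) (A B S : Set E), NearExtremal m τ δ a b A B S →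
    Bornology.IsBounded A → Bornology.IsBounded B →
    ∃ (L : E ≃L[ℝ] E) (p q : E), MeasurePreserving L m m ∧
      (∀ x ∈ A, ‖L x + p‖ ≤ R) ∧ ∀ x ∈ B, ‖L x + q‖ ≤ R

lemma exists_measurePreserving_equiv [Nontrivial E] (m : Measure E) [m.IsAddHaarMeasure]
    (m' : Measure F) [m'.IsAddHaarMeasure] (e : E ≃L[ℝ] F) :
    ∃ e' : E ≃L[ℝ] F, MeasurePreserving e' m m' := by
  have := e.isAddHaarMeasure_map m
  have hc := Measure.isAddLeftInvariant_eq_smul (m.map e) m'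
  set c := (m.map e).addHaarScalarFactor m' with hcdef
  have hc0 : 0 < c := Measure.addHaarScalarFactor_pos_of_isAddHaarMeasure _ _
  have hc0' : (0 : ℝ) < c := hc0
  set N := Module.finrank ℝ E with hN
  have hN0 : N ≠ 0 := Module.finrank_pos.ne'
  set r : ℝ := (c : ℝ) ^ (1 / N : ℝ) with hr
  have hr0 : 0 < r := Real.rpow_pos_of_pos hc0 _
  have hrN : r ^ N = c := by
    rw [hr, ← Real.rpow_natCast, ← Real.rpow_mul (NNReal.coe_nonneg c),
    one_div_mul_cancel (by simpa), Real.rpow_one]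
  refine ⟨(LinearEquiv.smulOfNeZero ℝ E r hr0.ne').toContinuousLinearEquiv.trans e,
    by fun_prop, ?_⟩
  have e1 : ⇑((LinearEquiv.smulOfNeZero ℝ E r hr0.ne').toContinuousLinearEquiv.trans e) =
    e ∘ fun x => r • x := rfl
  rw [e1, ← Measure.map_map (by fun_prop) (by fun_prop), Measure.map_addHaar_smul m hr0.ne',
    Measure.map_smul, hc, hrN, abs_of_nonneg (by positivity), ENNReal.ofReal_inv_of_pos hc0',
    ENNReal.ofReal_coe_nnreal]
  ext s _
  rw [Measure.smul_apply, show (c • m') s = (c : ℝ≥0∞) * m' s from rfl, smul_eq_mul, ← mul_assoc,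
    ENNReal.inv_mul_cancel (by simpa using hc0.ne') (by simp), one_mul]

lemma TightExtremal.congr [Nontrivial E] {m : Measure E} [m.IsAddHaarMeasure] (h : TightExtremal m)
    (m' : Measure F) [m'.IsAddHaarMeasure] (e : E ≃L[ℝ] F) : TightExtremal m' := by
  obtain ⟨e, he⟩ := exists_measurePreserving_equiv m m' e
  have he' : MeasurePreserving e.symm m' m :=
    MeasurePreserving.symm e.toHomeomorph.toMeasurableEquiv he
  intro τ hτ
  obtain ⟨R, δ, hδ, H⟩ := h τ hτ
  refine ⟨‖(e : E →L[ℝ] F)‖ * R, δ, hδ, fun a b A B S hABS hA hB => ?_⟩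
  have hb : ∀ {X : Set F}, Bornology.IsBounded X →
      Bornology.IsBounded ((fun x => e.symm x + 0) '' X) := fun hX => by
    simpa using e.symm.lipschitz.isBounded_image hX
  obtain ⟨L, p, q, hL, h1, h2⟩ := H a b _ _ _ (hABS.image he' 0 0) (hb hA) (hb hB)
  refine ⟨(e.symm.trans L).trans e, e p, e q, (he.comp (hL.comp he')), ?_, ?_⟩
  · intro x hx
    have := h1 _ ⟨x, hx, rfl⟩
    calc ‖e (L (e.symm x)) + e p‖ = ‖(e : E →L[ℝ] F) (L (e.symm x + 0) + p)‖ := by simp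
      _ ≤ _ := ContinuousLinearMap.le_of_opNorm_le_of_le _ le_rfl this
  · intro x hx
    have := h2 _ ⟨x, hx, rfl⟩
    calc ‖e (L (e.symm x)) + e q‖ = ‖(e : E →L[ℝ] F) (L (e.symm x + 0) + q)‖ := by simp
      _ ≤ _ := ContinuousLinearMap.le_of_opNorm_le_of_le _ le_rfl this

end

lemma NearExtremal.dist_le {τ δ a b : ℝ} {A B S : Set ℝ}
    (h : NearExtremal (volume : Measure ℝ) τ δ a b A B S) (hδ : δ ≤ τ / 4) {p q : ℝ}
    (hp : p ∈ A) (hq : q ∈ A) : |p - q| ≤ 2 / τ := by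
  have hτ := h.τ_pos
  have ha := h.a_pos
  have hb := h.b_pos
  have hτ2 : 2 * τ ≤ 1 := by linarith [h.le_a, h.le_b, h.add_eq]
  have vol : ∀ {c : ℝ} {X : Set ℝ}, 0 < c → volume (c • X) = ENNReal.ofReal c * volume X := by
    intro c X hc
    rw [Measure.addHaar_smul, Module.finrank_self, pow_one, abs_of_pos hc]
  have lo : ∀ {c : ℝ} {X : Set ℝ}, 0 < c → ENNReal.ofReal (1 - δ) ≤ volume X →
      ENNReal.ofReal (c * (1 - δ)) ≤ volume (c • X) := by
    intro c X hc hX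
    rw [vol hc, ENNReal.ofReal_mul hc.le]
    gcongr
  have hi : ∀ {c : ℝ} {X : Set ℝ}, 0 < c → volume X ≤ ENNReal.ofReal (1 + δ) →
      volume (c • X) ≤ ENNReal.ofReal (c * (1 + δ)) := by
    intro c X hc hX
    rw [vol hc, ENNReal.ofReal_mul hc.le]
    gcongr
  have loA := lo ha h.le_A
  have loB := lo hb h.le_B
  have pos : ∀ c : ℝ, 0 < c → 0 < ENNReal.ofReal (c * (1 - δ)) := fun c hc =>
    ENNReal.ofReal_pos.2 (mul_pos hc (by linarith))
  have key := dist_le_of_volume_lt (h.meas_A.const_smul₀ a) (h.meas_B.const_smul₀ b)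
    ((pos a ha).trans_le loA).ne' ((pos b hb).trans_le loB).ne' (S := S)
    (by
      rintro _ ⟨x, hx, rfl⟩ _ ⟨y, hy, rfl⟩
      exact h.combo x hx y hy)
    (lt_of_lt_of_le (lt_of_le_of_lt h.S_le (show _ < ENNReal.ofReal ((1 - δ) * (1 + τ)) from ?_))
      ?_)
    (smul_mem_smul_set hp) (smul_mem_smul_set hq)
  · have := key.trans (add_le_add (hi ha h.A_le) (hi hb h.B_le))
    have hδ0 : 0 ≤ 1 + δ := by
      by_contra! h0
      have := h.le_A.trans h.A_le
      rw [ENNReal.ofReal_of_nonpos h0.le, nonpos_iff_eq_zero, ENNReal.ofReal_eq_zero] at this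
      linarith
    rw [← ENNReal.ofReal_add (by positivity) (by positivity),
      ENNReal.ofReal_le_ofReal_iff (by positivity), ← smul_sub, smul_eq_mul, abs_mul,
      abs_of_pos ha, ← add_mul, h.add_eq, one_mul] at this
    rw [le_div_iff₀ hτ, mul_comm]
    calc τ * |p - q| ≤ a * |p - q| := by gcongr; exact h.le_a
      _ ≤ 2 := by linarith
  · refine (ENNReal.ofReal_lt_ofReal_iff (by nlinarith)).2 ?_
    nlinarith
  · have hc : ENNReal.ofReal (τ * (1 - δ)) ≤ min (volume (a • A)) (volume (b • B)) :=
      le_min (le_trans (ENNReal.ofReal_le_ofReal (by gcongr; linarith; exact h.le_a)) loA)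
        (le_trans (ENNReal.ofReal_le_ofReal (by gcongr; linarith; exact h.le_b)) loB)
    refine le_trans (le_of_eq ?_) (add_le_add (add_le_add loA loB) hc)
    rw [← ENNReal.ofReal_add (by nlinarith) (by nlinarith),
      ← ENNReal.ofReal_add (by nlinarith) (by nlinarith)]
    congr 1
    linear_combination (-(1 - δ)) * h.add_eq

lemma tightExtremal_real : TightExtremal (volume : Measure ℝ) := by
  intro τ hτ
  refine ⟨2 / τ, min (τ / 4) (1 / 2), by positivity, fun a b A B S h hA hB => ?_⟩
  have ne : ∀ {X : Set ℝ}, ENNReal.ofReal (1 - min (τ / 4) (1 / 2)) ≤ volume X → X.Nonempty := by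
    intro X hX
    refine nonempty_of_measure_ne_zero (μ := volume) (lt_of_lt_of_le ?_ hX).ne'
    have := min_le_right (τ / 4) (1 / 2)
    exact ENNReal.ofReal_pos.2 (by linarith)
  obtain ⟨x₀, hx₀⟩ := ne h.le_A
  obtain ⟨y₀, hy₀⟩ := ne h.le_B
  refine ⟨.refl ℝ ℝ, -x₀, -y₀, .id _, fun x hx => ?_, fun y hy => ?_⟩
  · exact h.dist_le (min_le_left _ _) hx hx₀
  · exact h.swap.dist_le (min_le_left _ _) hy hy₀

section

variable {n : ℕ}

instance : (volume : Measure (Sp n)).IsAddHaarMeasure := by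
  rw [Measure.volume_eq_prod]
  infer_instance

/-- The length of the vertical slice of `A` over `x`. -/
def fib (A : Set (Sp n)) (x : Edim n) : ℝ≥0∞ := volume (vslice A x)

lemma measurableSet_vslice {A : Set (Sp n)} (hA : MeasurableSet A) (x : Edim n) :
    MeasurableSet (vslice A x) := measurable_prodMk_left hA

lemma measurable_fib {A : Set (Sp n)} (hA : MeasurableSet A) : Measurable (fib A) :=
  measurable_measure_prodMk_left hA

lemma lintegral_fib {A : Set (Sp n)} (hA : MeasurableSet A) : ∫⁻ x, fib A x = volume A := by
  rw [Measure.volume_eq_prod, Measure.prod_apply hA]; rfl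

lemma setLIntegral_fib {A : Set (Sp n)} (hA : MeasurableSet A) {D : Set (Edim n)}
    (hD : MeasurableSet D) : ∫⁻ x in D, fib A x = volume (A ∩ Prod.fst ⁻¹' D) := by
  rw [← lintegral_fib (hA.inter (measurable_fst hD)), ← lintegral_indicator hD]
  refine lintegral_congr fun x => ?_
  by_cases hx : x ∈ D
  · rw [indicator_of_mem hx, fib, fib]
    congr 1
    ext y
    simp [vslice, hx]
  · rw [indicator_of_notMem hx, fib]
    symm
    convert measure_empty (μ := (volume : Measure ℝ))
    ext y
    simp [vslice, hx]

lemma measurableSet_fib_ne_zero {A : Set (Sp n)} (hA : MeasurableSet A) :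
    MeasurableSet {x | fib A x ≠ 0} := (measurable_fib hA) (measurableSet_singleton 0).compl

lemma NearExtremal.fib_combo {τ δ a b : ℝ} {A B S : Set (Sp n)}
    (h : NearExtremal volume τ δ a b A B S) {x y : Edim n} (hx : fib A x ≠ 0) (hy : fib B y ≠ 0) :
    ENNReal.ofReal a * fib A x + ENNReal.ofReal b * fib B y ≤ fib S (a • x + b • y) := by
  refine volume_combo_ge (measurableSet_vslice h.meas_A x) (measurableSet_vslice h.meas_B y)
    (nonempty_of_measure_ne_zero hx) (nonempty_of_measure_ne_zero hy) h.a_pos.le h.b_pos.le ?_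
  intro u hu v hv
  have := h.combo (x, u) hu (y, v) hv
  change (a • x + b • y, a * u + b * v) ∈ S
  simpa using this

lemma NearExtremal.fib_mul_le {τ δ a b : ℝ} {A B S : Set (Sp n)}
    (h : NearExtremal volume τ δ a b A B S) (x : Edim n) :
    ENNReal.ofReal (τ ^ (n + 1)) * (fib A x * volume {y | fib B y ≠ 0}) ≤ volume S := by
  rcases eq_or_ne (fib A x) 0 with hx | hx
  · simp [hx]
  set G := {y | fib B y ≠ 0} with hG
  have hGm : MeasurableSet G := measurableSet_fib_ne_zero h.meas_B
  set T := (fun y => a • x + y) '' (b • G) with hT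
  have hTm : MeasurableSet T :=
    (measurableEmbedding_addLeft (a • x)).measurableSet_image.2 (hGm.const_smul₀ b)
  have hTv : volume T = ENNReal.ofReal (b ^ n) * volume G := by
    rw [hT, image_add_left, measure_preimage_add, Measure.addHaar_smul,
      abs_of_nonneg (pow_nonneg h.b_pos.le _), finrank_euclideanSpace_fin]
  have hτ := h.τ_pos.le
  calc ENNReal.ofReal (τ ^ (n + 1)) * (fib A x * volume G)
      = (ENNReal.ofReal τ * fib A x) * (ENNReal.ofReal (τ ^ n) * volume G) := by
        rw [pow_succ, ENNReal.ofReal_mul (by positivity)]; ring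
    _ ≤ (ENNReal.ofReal a * fib A x) * (ENNReal.ofReal (b ^ n) * volume G) := by
        gcongr
        · exact h.le_a
        · exact h.le_b
    _ = ∫⁻ z in T, ENNReal.ofReal a * fib A x := by rw [setLIntegral_const, hTv]
    _ ≤ ∫⁻ z in T, fib S z := by
        refine setLIntegral_mono' hTm ?_
        rintro _ ⟨_, ⟨y, hy, rfl⟩, rfl⟩
        exact le_self_add.trans (h.fib_combo hx hy)
    _ ≤ ∫⁻ z, fib S z := setLIntegral_le_lintegral _ _
    _ = volume S := lintegral_fib h.meas_S

/-- The linear map acting as `e` on the base and as multiplication by `c` on the fibres. -/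
def baseMap (e : Edim n ≃L[ℝ] Edim n) (c : ℝ) (hc : c ≠ 0) : Sp n ≃L[ℝ] Sp n :=
  e.prodCongr (ContinuousLinearEquiv.unitsEquivAut ℝ (Units.mk0 c hc))

lemma baseMap_apply (e : Edim n ≃L[ℝ] Edim n) {c : ℝ} (hc : c ≠ 0) (x : Sp n) :
    baseMap e c hc x = (e x.1, x.2 * c) := rfl

lemma measurePreserving_baseMap {e : Edim n ≃L[ℝ] Edim n} {c : ℝ} (hc : c ≠ 0)
    (he : (volume : Measure (Edim n)).map e = ENNReal.ofReal |c| • volume) :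
    MeasurePreserving (baseMap e c hc) := by
  refine ⟨(baseMap e c hc).continuous.measurable, ?_⟩
  have e1 : ⇑(baseMap e c hc) = Prod.map e (· * c) := rfl
  rw [e1, Measure.volume_eq_prod, ← Measure.map_prod_map _ _ (by fun_prop) (by fun_prop), he,
    Real.map_volume_mul_right hc, Measure.prod_smul_left, Measure.prod_smul_right, smul_smul,
    ← ENNReal.ofReal_mul (abs_nonneg c), ← abs_mul, mul_inv_cancel₀ hc, abs_one,
    ENNReal.ofReal_one, one_smul]

lemma fib_image_baseMap (e : Edim n ≃L[ℝ] Edim n) {c : ℝ} (hc : c ≠ 0) (p : Sp n)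
    (A : Set (Sp n)) (x : Edim n) :
    fib ((fun z => baseMap e c hc z + p) '' A) x =
      ENNReal.ofReal |c| * fib A (e.symm (x - p.1)) := by
  have : vslice ((fun z => baseMap e c hc z + p) '' A) x =
      (fun y => p.2 + y) '' (c • vslice A (e.symm (x - p.1))) := by
    ext y
    simp only [vslice, mem_ofPred_eq, mem_image, mem_smul_set, Prod.exists, baseMap_apply]
    constructor
    · rintro ⟨u, v, huv, h⟩
      obtain ⟨h1, h2⟩ := Prod.ext_iff.1 h
      refine ⟨c * v, ⟨v, ?_, rfl⟩, ?_⟩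
      · simp only at h1
        simpa [← h1] using huv
      · simp only [Prod.snd_add] at h2
        linarith
    · rintro ⟨_, ⟨v, hv, rfl⟩, rfl⟩
      exact ⟨_, v, hv, Prod.ext (by simp) (by simp; ring)⟩
  rw [fib, this, image_add_left, measure_preimage_add, Measure.addHaar_smul, Module.finrank_self,
    pow_one, fib]

/-- Almost extremal sets can be normalised to have bounded fibres. -/
lemma exists_normalized (hn : n ≠ 0) {τ : ℝ} (hτ : 0 < τ) : ∃ C : ℝ, 1 ≤ C ∧ ∀ a b A B S,
    NearExtremal (volume : Measure (Sp n)) τ (1 / 2) a b A B S → Bornology.IsBounded A →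
    ∃ L : Sp n ≃L[ℝ] Sp n, MeasurePreserving L ∧ (∀ x, fib (L '' A) x ≤ ENNReal.ofReal C) ∧
      (∀ x, fib (L '' B) x ≤ ENNReal.ofReal C) ∧
      volume {x | fib (L '' A) x ≠ 0} ≤ ENNReal.ofReal C ∧
      volume {x | fib (L '' B) x ≠ 0} ≤ ENNReal.ofReal C := by
  set κ := ENNReal.ofReal (τ ^ (n + 1)) with hκ
  have hκ0 : κ ≠ 0 := (ENNReal.ofReal_pos.2 (by positivity)).ne'
  have hκt : κ ≠ ⊤ := ENNReal.ofReal_ne_top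
  set K := κ⁻¹ with hK
  have hKt : K ≠ ⊤ := ENNReal.inv_ne_top.2 hκ0
  have hK0 : K ≠ 0 := ENNReal.inv_ne_zero.2 hκt
  have hCt : 1 + 4 * K + 32 * K * K ≠ ⊤ := by finiteness
  have hC : ENNReal.ofReal (1 + 4 * K + 32 * K * K).toReal = 1 + 4 * K + 32 * K * K :=
    ENNReal.ofReal_toReal hCt
  refine ⟨(1 + 4 * K + 32 * K * K).toReal, ?_, fun a b A B S h hA => ?_⟩
  · rw [← ENNReal.toReal_one]
    refine ENNReal.toReal_mono hCt ?_
    rw [add_assoc]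
    exact le_self_add
  rw [hC]
  set M := ⨆ x, fib A x with hM
  have half : ENNReal.ofReal (1 - 1 / 2) = 1 / 2 := by
    rw [show (1 : ℝ) - 1 / 2 = 2⁻¹ by norm_num, ENNReal.ofReal_inv_of_pos two_pos,
      ENNReal.ofReal_ofNat, one_div]
  have hM0 : M ≠ 0 := by
    intro h0
    have : volume A = 0 := by
      rw [← lintegral_fib h.meas_A]
      simp only [hM, ENNReal.iSup_eq_zero] at h0
      simp [h0]
    have h1 := h.le_A
    rw [this, half] at h1
    simp at h1
  have hMt : M ≠ ⊤ := by
    obtain ⟨r, hr⟩ := hA.subset_closedBall 0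
    refine ne_top_of_le_ne_top (measure_closedBall_lt_top (x := (0:ℝ)) (r := r)).ne
      (iSup_le fun x => measure_mono fun y hy => ?_)
    have := hr hy
    rw [mem_closedBall_zero_iff] at this ⊢
    exact (norm_snd_le (x, y)).trans this
  set c := M.toReal⁻¹ with hc
  have hM' : 0 < M.toReal := ENNReal.toReal_pos hM0 hMt
  have hc0 : 0 < c := inv_pos.2 hM'
  set r := M.toReal ^ (1 / n : ℝ) with hr
  have hr0 : 0 < r := Real.rpow_pos_of_pos hM' _
  have hrn : r ^ n = M.toReal := by
    rw [hr, ← Real.rpow_natCast, ← Real.rpow_mul hM'.le, one_div_mul_cancel (by simpa),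
      Real.rpow_one]
  set e := (LinearEquiv.smulOfNeZero ℝ (Edim n) r hr0.ne').toContinuousLinearEquiv with he
  have he' : (volume : Measure (Edim n)).map e = ENNReal.ofReal |c| • volume := by
    have : ⇑e = fun x => r • x := rfl
    rw [this, Measure.map_addHaar_smul _ hr0.ne', finrank_euclideanSpace_fin, hrn]
  set L := baseMap e c hc0.ne' with hL
  have hLm : MeasurePreserving L := measurePreserving_baseMap hc0.ne' he'
  have hLA : (fun z => L z + 0) '' A = L '' A := by simp
  have hLB : (fun z => L z + 0) '' B = L '' B := by simp
  have h' := h.image hLm 0 0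
  rw [hLA, hLB] at h'
  have hfA : ∀ x, fib (L '' A) x = M⁻¹ * fib A (e.symm x) := by
    intro x
    rw [← hLA, fib_image_baseMap, abs_of_pos hc0, hc, ENNReal.ofReal_inv_of_pos hM',
      ENNReal.ofReal_toReal hMt]
    simp
  refine ⟨L, hLm, ?_⟩
  generalize L '' A = A' at hLA hfA h' ⊢
  generalize L '' B = B' at hLB h' ⊢
  have hf1 : ∀ x, fib A' x ≤ 1 := by
    intro x
    rw [hfA, mul_comm, ← div_eq_mul_inv]
    exact ENNReal.div_le_of_le_mul (by rw [one_mul]; exact le_iSup (fib A) _)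
  have hS2 : volume ((fun x => L x + (a • (0 : Sp n) + b • 0)) '' S) ≤ 2 :=
    h'.S_le.trans (by
      rw [← ENNReal.ofReal_ofNat]; exact ENNReal.ofReal_le_ofReal (by norm_num))
  have key : ∀ {u : ℝ≥0∞}, κ * u ≤ volume ((fun x => L x + (a • (0 : Sp n) + b • 0)) '' S) →
      u ≤ 2 * K := by
    intro u hu
    rw [hK, ← div_eq_mul_inv, ENNReal.le_div_iff_mul_le (Or.inl hκ0) (Or.inl hκt), mul_comm]
    exact hu.trans hS2
  have k1 : ∀ x, fib A' x * volume {y | fib B' y ≠ 0} ≤ 2 * K := fun x => key (h'.fib_mul_le x)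
  have k2 : ∀ x, fib B' x * volume {y | fib A' y ≠ 0} ≤ 2 * K :=
    fun x => key (h'.swap.fib_mul_le x)
  obtain ⟨x0, hx0⟩ : ∃ x, 1 / 2 < fib A' x := by
    have : M / 2 < M := ENNReal.half_lt_self hM0 hMt
    obtain ⟨x, hx⟩ := lt_iSup_iff.1 this
    refine ⟨e x, ?_⟩
    rw [hfA, e.symm_apply_apply]
    calc (1 : ℝ≥0∞) / 2 = M⁻¹ * (M / 2) := by
          rw [← mul_div_assoc, ENNReal.inv_mul_cancel hM0 hMt]
      _ < _ := (ENNReal.mul_lt_mul_iff_right (by simpa) (by simpa)).2 hx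
  have b1 : volume {y | fib B' y ≠ 0} ≤ 4 * K := by
    calc volume {y | fib B' y ≠ 0} = 2 * (1 / 2 * volume {y | fib B' y ≠ 0}) := by
          rw [← mul_assoc, one_div, ENNReal.mul_inv_cancel (by simp) (by simp), one_mul]
      _ ≤ 2 * (fib A' x0 * volume {y | fib B' y ≠ 0}) := by gcongr
      _ ≤ 2 * (2 * K) := mul_le_mul_right (k1 x0) _
      _ = 4 * K := by ring
  have supp : ∀ {X : Set (Sp n)}, MeasurableSet X → ∀ {u : ℝ≥0∞}, (∀ x, fib X x ≤ u) →
      volume X ≤ u * volume {y | fib X y ≠ 0} := by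
    intro X hX u hu
    rw [← lintegral_fib hX, ← setLIntegral_const, ← lintegral_indicator
      (measurableSet_fib_ne_zero hX)]
    refine lintegral_mono fun x => ?_
    by_cases hx : fib X x = 0
    · simp [hx]
    · rw [indicator_of_mem (by exact hx)]
      exact hu x
  have loA := h'.le_A
  have loB := h'.le_B
  rw [half] at loA loB
  obtain ⟨y0, hy0⟩ : ∃ y, 1 < fib B' y * (16 * K) := by
    by_contra! hcon
    have h1 : ∀ y, fib B' y ≤ (16 * K)⁻¹ := fun y =>
      ENNReal.le_inv_iff_mul_le.2 (hcon y)
    have h2 := loB.trans ((supp h'.meas_B h1).trans (mul_le_mul_right b1 _))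
    have h3 : (16 * K)⁻¹ * (4 * K) = 4⁻¹ := by
      rw [show 16 * K = 4 * (4 * K) by ring, ENNReal.mul_inv (by simp) (by simp), mul_assoc,
        ENNReal.inv_mul_cancel (by simpa) (by finiteness), mul_one]
    rw [h3, one_div, ENNReal.inv_le_inv] at h2
    norm_num at h2
  have b2 : volume {y | fib A' y ≠ 0} ≤ 32 * K * K := by
    calc volume {y | fib A' y ≠ 0} ≤ (fib B' y0 * (16 * K)) * volume {y | fib A' y ≠ 0} :=
          le_mul_of_one_le_left zero_le hy0.le
      _ = 16 * K * (fib B' y0 * volume {y | fib A' y ≠ 0}) := by ring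
      _ ≤ 16 * K * (2 * K) := mul_le_mul_right (k2 y0) _
      _ = _ := by ring
  have b3 : ∀ y, fib B' y ≤ 4 * K := by
    intro y
    have hA1 : (1 : ℝ≥0∞) / 2 ≤ volume {y | fib A' y ≠ 0} := by
      simpa using loA.trans (supp h'.meas_A hf1)
    calc fib B' y = 2 * (fib B' y * (1 / 2)) := by
          rw [mul_comm (fib B' y), ← mul_assoc, one_div, ENNReal.mul_inv_cancel (by simp) (by simp),
            one_mul]
      _ ≤ 2 * (fib B' y * volume {y | fib A' y ≠ 0}) := by gcongr
      _ ≤ 2 * (2 * K) := mul_le_mul_right (k2 y) _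
      _ = 4 * K := by ring
  have c1 : 4 * K ≤ 1 + 4 * K + 32 * K * K := (le_add_self).trans le_self_add
  have c2 : 1 ≤ 1 + 4 * K + 32 * K * K := by rw [add_assoc]; exact le_self_add
  exact ⟨fun x => (hf1 x).trans c2, fun x => (b3 x).trans c1, b2.trans le_add_self,
    b1.trans c1⟩

end

section

variable {n : ℕ}

/-- The set of base points over which the slice of `A` is longer than `s`. -/
def lev (A : Set (Sp n)) (s : ℝ) : Set (Edim n) := {x | ENNReal.ofReal s < fib A x}

/-- The hypograph of the fibre length of `A`, above height `θ`. -/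
def hypo (θ : ℝ) (A : Set (Sp n)) : Set (Sp n) := {z | θ < z.2 ∧ ENNReal.ofReal z.2 < fib A z.1}

lemma measurableSet_lev {A : Set (Sp n)} (hA : MeasurableSet A) (s : ℝ) :
    MeasurableSet (lev A s) := measurableSet_lt measurable_const (measurable_fib hA)

lemma measurableSet_hypo {A : Set (Sp n)} (hA : MeasurableSet A) (θ : ℝ) :
    MeasurableSet (hypo θ A) :=
  (measurableSet_lt measurable_const measurable_snd).inter
    (measurableSet_lt (by fun_prop) ((measurable_fib hA).comp measurable_fst))

lemma lev_anti (A : Set (Sp n)) : Antitone (lev A) := fun _ _ h _ hx =>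
  (ENNReal.ofReal_le_ofReal h).trans_lt hx

lemma lev_subset (A : Set (Sp n)) (s : ℝ) : lev A s ⊆ {x | fib A x ≠ 0} :=
  fun _ hx => (lt_of_le_of_lt zero_le hx).ne'

lemma volume_setOf_ofReal_lt {θ : ℝ} (hθ : 0 ≤ θ) (f : ℝ≥0∞) :
    volume {s : ℝ | θ < s ∧ ENNReal.ofReal s < f} = f - ENNReal.ofReal θ := by
  rcases eq_or_ne f ⊤ with rfl | hf
  · have : {s : ℝ | θ < s ∧ ENNReal.ofReal s < ⊤} = Ioi θ := by ext; simp
    rw [this]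
    simp
  · have : {s : ℝ | θ < s ∧ ENNReal.ofReal s < f} = Ioo θ f.toReal := by
      ext s
      simp only [mem_ofPred_eq, mem_Ioo, and_congr_right_iff]
      exact fun hs => ENNReal.ofReal_lt_iff_lt_toReal (hθ.trans hs.le) hf
    rw [this, Real.volume_Ioo, ENNReal.ofReal_sub _ hθ, ENNReal.ofReal_toReal hf]

lemma volume_hypo {A : Set (Sp n)} (hA : MeasurableSet A) {θ : ℝ} (hθ : 0 ≤ θ) :
    volume (hypo θ A) = ∫⁻ x, (fib A x - ENNReal.ofReal θ) := by
  rw [← lintegral_fib (measurableSet_hypo hA θ)]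
  exact lintegral_congr fun x => volume_setOf_ofReal_lt hθ (fib A x)

lemma volume_hypo_le {A : Set (Sp n)} (hA : MeasurableSet A) {θ : ℝ} (hθ : 0 ≤ θ) :
    volume (hypo θ A) ≤ volume A := by
  rw [volume_hypo hA hθ, ← lintegral_fib hA]
  exact lintegral_mono fun x => tsub_le_self

lemma volume_le_hypo_add {A : Set (Sp n)} (hA : MeasurableSet A) {θ : ℝ} (hθ : 0 ≤ θ) :
    volume A ≤ volume (hypo θ A) + ENNReal.ofReal θ * volume {x | fib A x ≠ 0} := by
  rw [volume_hypo hA hθ, ← lintegral_fib hA, ← setLIntegral_const, ← lintegral_indicator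
    (measurableSet_fib_ne_zero hA), ← lintegral_add_left ((measurable_fib hA).sub_const _)]
  refine lintegral_mono fun x => ?_
  by_cases hx : fib A x = 0
  · simp [hx]
  · rw [indicator_of_mem (by exact hx)]
    exact le_tsub_add

lemma volume_hypo_add_le {A : Set (Sp n)} (hA : MeasurableSet A) {θ : ℝ} (hθ : 0 ≤ θ) :
    volume (hypo θ A) + ENNReal.ofReal θ * volume (lev A θ) ≤ volume A := by
  rw [volume_hypo hA hθ, ← lintegral_fib hA, ← setLIntegral_const, ← lintegral_indicator
    (measurableSet_lev hA θ), ← lintegral_add_left ((measurable_fib hA).sub_const _)]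
  refine lintegral_mono fun x => ?_
  by_cases hx : x ∈ lev A θ
  · rw [indicator_of_mem hx, tsub_add_cancel_of_le hx.le]
  · rw [indicator_of_notMem hx, add_zero]
    exact tsub_le_self

lemma NearExtremal.hypo_combo {τ δ a b : ℝ} {A B S : Set (Sp n)}
    (h : NearExtremal volume τ δ a b A B S) {θ : ℝ} (hθ : 0 ≤ θ) :
    ∀ x ∈ hypo θ A, ∀ y ∈ hypo θ B, a • x + b • y ∈ hypo θ S := by
  rintro ⟨x, s⟩ ⟨hs, hx⟩ ⟨y, t⟩ ⟨ht, hy⟩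
  simp only at hs hx ht hy
  have ha := h.a_pos
  have hb := h.b_pos
  refine ⟨?_, ?_⟩
  · change θ < a * s + b * t
    have := h.add_eq
    nlinarith
  · change ENNReal.ofReal (a * s + b * t) < fib S (a • x + b • y)
    refine lt_of_lt_of_le ?_ (h.fib_combo (lt_of_le_of_lt zero_le hx).ne'
      (lt_of_le_of_lt zero_le hy).ne')
    rw [ENNReal.ofReal_add (mul_nonneg ha.le (hθ.trans hs.le)) (mul_nonneg hb.le (hθ.trans ht.le)),
      ENNReal.ofReal_mul ha.le, ENNReal.ofReal_mul hb.le]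
    refine ENNReal.add_lt_add ((ENNReal.mul_lt_mul_iff_right ?_ (by simp)).2 hx)
      ((ENNReal.mul_lt_mul_iff_right ?_ (by simp)).2 hy) <;> simpa

lemma NearExtremal.lev_combo {τ δ a b : ℝ} {A B S : Set (Sp n)}
    (h : NearExtremal volume τ δ a b A B S) (s : ℝ) :
    ∀ x ∈ lev A s, ∀ y ∈ lev B s, a • x + b • y ∈ lev S s := by
  intro x hx y hy
  refine lt_of_lt_of_le ?_ (h.fib_combo (lev_subset A s hx) (lev_subset B s hy))
  have ha := h.a_pos
  have hb := h.b_pos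
  calc ENNReal.ofReal s = ENNReal.ofReal a * ENNReal.ofReal s +
        ENNReal.ofReal b * ENNReal.ofReal s := by
        rw [← add_mul, ← ENNReal.ofReal_add ha.le hb.le, h.add_eq, ENNReal.ofReal_one, one_mul]
    _ < _ := by
        refine ENNReal.add_lt_add ((ENNReal.mul_lt_mul_iff_right ?_ (by simp)).2 hx)
          ((ENNReal.mul_lt_mul_iff_right ?_ (by simp)).2 hy) <;> simpa

lemma volume_inter_snd {D : Set (Sp n)} (hD : MeasurableSet D) {I : Set ℝ} (hI : MeasurableSet I) :
    volume (D ∩ Prod.snd ⁻¹' I) = ∫⁻ s in I, volume (hslice D s) := by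
  rw [Measure.volume_eq_prod, Measure.prod_apply_symm (hD.inter (measurable_snd hI)),
    ← lintegral_indicator hI]
  refine lintegral_congr fun s => ?_
  by_cases hs : s ∈ I
  · rw [indicator_of_mem hs]
    congr 1
    ext y
    simp [hslice, hs]
  · rw [indicator_of_notMem hs]
    convert measure_empty (μ := (volume : Measure (Edim n)))
    ext y
    simp [hs]

lemma map_snd_le {D : Set (Sp n)} (hD : MeasurableSet D) {J : Set ℝ} (hJ : MeasurableSet J)
    (hDJ : ∀ z ∈ D, z.2 ∈ J) {c : ℝ≥0∞} (h : ∀ s, volume (hslice D s) ≤ c) :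
    (volume.restrict D).map Prod.snd ≤ c • volume.restrict J := by
  refine Measure.le_iff.2 fun I hI => ?_
  rw [Measure.map_apply measurable_snd hI, Measure.restrict_apply (measurable_snd hI), inter_comm,
    Measure.smul_apply, Measure.restrict_apply hI, smul_eq_mul]
  have : D ∩ Prod.snd ⁻¹' I = D ∩ Prod.snd ⁻¹' (I ∩ J) := by
    ext z
    constructor
    · exact fun hz => ⟨hz.1, hz.2, hDJ z hz.1⟩
    · exact fun hz => ⟨hz.1, hz.2.1⟩
  rw [this, volume_inter_snd hD (hI.inter hJ), ← setLIntegral_const]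
  exact lintegral_mono h

end

section

variable {n : ℕ}

lemma volume_hypo_inter_le {A : Set (Sp n)} (hA : MeasurableSet A) (θ : ℝ) {t : ℝ} {I : Set ℝ}
    (hI : MeasurableSet I) (hIt : I ⊆ Ici t) :
    volume (hypo θ A ∩ Prod.snd ⁻¹' I) ≤ volume (lev A t) * volume I := by
  rw [volume_inter_snd (measurableSet_hypo hA θ) hI, ← setLIntegral_const]
  exact setLIntegral_mono' hI fun s hs =>
    measure_mono fun x hx => lev_anti A (hIt hs) (show x ∈ lev A s from hx.2)

lemma le_volume_hypo_inter {A : Set (Sp n)} (hA : MeasurableSet A) {θ t : ℝ} {I : Set ℝ}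
    (hI : MeasurableSet I) (hIt : I ⊆ Ioc θ t) :
    volume (lev A t) * volume I ≤ volume (hypo θ A ∩ Prod.snd ⁻¹' I) := by
  rw [volume_inter_snd (measurableSet_hypo hA θ) hI, ← setLIntegral_const]
  exact setLIntegral_mono' hI fun s hs =>
    measure_mono fun x hx => ⟨(hIt hs).1, lev_anti A (hIt hs).2 hx⟩

/-- Limits of level-set volumes are comparable as soon as the hypographs have the same limiting
marginal. -/
lemma level_limit_le {U : Filter ℕ} [U.NeBot] {X Y : ℕ → Set (Sp n)}
    (hX : ∀ k, MeasurableSet (X k)) (hY : ∀ k, MeasurableSet (Y k)) {θ : ℕ → ℝ}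
    (hθ : Tendsto θ U (nhds 0)) {C : ℝ} {μ' : Measure ℝ}
    (hX' : ∀ I, MeasurableSet I → I ⊆ Iic C →
      Tendsto (fun k => volume (hypo (θ k) (X k) ∩ Prod.snd ⁻¹' I)) U (nhds (μ' I)))
    (hY' : ∀ I, MeasurableSet I → I ⊆ Iic C →
      Tendsto (fun k => volume (hypo (θ k) (Y k) ∩ Prod.snd ⁻¹' I)) U (nhds (μ' I)))
    {s t : ℝ} (hs : 0 < s) (hst : s < t) (htC : t ≤ C) {x y : ℝ≥0∞}
    (hx : Tendsto (fun k => volume (lev (X k) s)) U (nhds x))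
    (hy : Tendsto (fun k => volume (lev (Y k) t)) U (nhds y)) : y ≤ x := by
  have hI : Ioc s t ⊆ Iic C := fun z hz => hz.2.trans htC
  have hv : volume (Ioc s t) ≠ 0 := by
    rw [Real.volume_Ioc]
    simpa using hst
  have hv' : volume (Ioc s t) ≠ ⊤ := by
    rw [Real.volume_Ioc]
    exact ENNReal.ofReal_ne_top
  have h1 : y * volume (Ioc s t) ≤ μ' (Ioc s t) := by
    refine le_of_tendsto_of_tendsto (ENNReal.Tendsto.mul_const hy (Or.inr hv'))
      (hY' _ measurableSet_Ioc hI) ?_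
    filter_upwards [hθ.eventually (gt_mem_nhds hs)] with k hk
    exact le_volume_hypo_inter (hY k) measurableSet_Ioc (Ioc_subset_Ioc_left (le_of_lt hk))
  have h2 : μ' (Ioc s t) ≤ x * volume (Ioc s t) :=
    le_of_tendsto_of_tendsto (hX' _ measurableSet_Ioc hI)
      (ENNReal.Tendsto.mul_const hx (Or.inr hv')) (Eventually.of_forall fun k =>
        volume_hypo_inter_le (hX k) _ measurableSet_Ioc fun z hz => hz.1.le)
  exact (ENNReal.mul_le_mul_iff_left hv hv').1 (h1.trans h2)

/-- The limiting marginal of hypographs of functions bounded by `C` charges every neighbourhood of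
zero. -/
lemma limit_Iic_ne_zero {U : Filter ℕ} [U.NeBot] {X : ℕ → Set (Sp n)}
    (hX : ∀ k, MeasurableSet (X k)) {C : ℝ} (hXC : ∀ k x, fib (X k) x ≤ ENNReal.ofReal C)
    {θ : ℕ → ℝ} (hθ : Tendsto θ U (nhds 0)) {μ' : Measure ℝ} [IsProbabilityMeasure μ']
    (hX' : ∀ I, MeasurableSet I →
      Tendsto (fun k => volume (hypo (θ k) (X k) ∩ Prod.snd ⁻¹' I)) U (nhds (μ' I)))
    {t : ℝ} (ht : 0 < t) : μ' (Iic t) ≠ 0 := by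
  intro h0
  have key : ENNReal.ofReal t * μ' (Ioi t) ≤ ENNReal.ofReal C * μ' (Iic t) := by
    have l1 : Tendsto (fun k => ENNReal.ofReal (t - θ k) *
        volume (hypo (θ k) (X k) ∩ Prod.snd ⁻¹' Ioi t)) U
        (nhds (ENNReal.ofReal t * μ' (Ioi t))) := by
      refine ENNReal.Tendsto.mul ?_ (Or.inr (measure_ne_top _ _)) (hX' _ measurableSet_Ioi)
        (Or.inr ENNReal.ofReal_ne_top)
      simpa using ENNReal.tendsto_ofReal (hθ.const_sub t)
    refine le_of_tendsto_of_tendsto' l1 (ENNReal.Tendsto.const_mul (hX' _ measurableSet_Iic)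
      (Or.inr ENNReal.ofReal_ne_top)) fun k => ?_
    have e1 : hypo (θ k) (X k) ∩ Prod.snd ⁻¹' Ioi t = hypo (θ k) (X k) ∩ Prod.snd ⁻¹' Ioc t C := by
      ext z
      simp only [mem_inter_iff, mem_preimage, mem_Ioi, mem_Ioc, and_congr_right_iff]
      refine fun hz => ⟨fun hzt => ⟨hzt, ?_⟩, fun h => h.1⟩
      exact ((ENNReal.ofReal_lt_ofReal_iff_of_nonneg (ht.trans hzt).le).1
        (hz.2.trans_le (hXC k z.1))).le
    have h1 := volume_hypo_inter_le (hX k) (θ k) (measurableSet_Ioc (a := t) (b := C))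
      (fun z hz => hz.1.le : Ioc t C ⊆ Ici t)
    have h2 := le_volume_hypo_inter (hX k) (measurableSet_Ioc (a := θ k) (b := t)) subset_rfl
    rw [Real.volume_Ioc] at h1 h2
    calc ENNReal.ofReal (t - θ k) * volume (hypo (θ k) (X k) ∩ Prod.snd ⁻¹' Ioi t)
        ≤ ENNReal.ofReal (t - θ k) * (volume (lev (X k) t) * ENNReal.ofReal (C - t)) := by
          rw [e1]; gcongr
      _ = ENNReal.ofReal (C - t) * (volume (lev (X k) t) * ENNReal.ofReal (t - θ k)) := by ring
      _ ≤ ENNReal.ofReal C * volume (hypo (θ k) (X k) ∩ Prod.snd ⁻¹' Iic t) := by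
          gcongr ENNReal.ofReal ?_ * ?_
          · linarith
          · exact h2.trans (measure_mono (inter_subset_inter_right _
              (preimage_mono fun z hz => hz.2)))
  rw [h0, mul_zero, nonpos_iff_eq_zero, mul_eq_zero] at key
  have h1 : μ' (Ioi t) = 0 := key.resolve_left (by simpa using ht)
  have h2 : μ' univ = 0 := by
    rw [← Iic_union_Ioi (a := t)]
    exact measure_union_null h0 h1
  simp at h2

end

section

variable {n : ℕ}

lemma translate_eq_zero {μ' ν' : Measure ℝ} {v : ℝ} (h : μ' = ν'.map (· + v))
    (hμ0 : μ' (Iic 0) = 0) (hν0 : ν' (Iic 0) = 0) (hμ : ∀ t > 0, μ' (Iic t) ≠ 0)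
    (hν : ∀ t > 0, ν' (Iic t) ≠ 0) : v = 0 := by
  have e : ∀ t, μ' (Iic t) = ν' (Iic (t - v)) := by
    intro t
    rw [h, Measure.map_apply (measurable_add_const _) measurableSet_Iic]
    congr 1
    ext x
    simp [le_sub_iff_add_le]
  rcases lt_trichotomy v 0 with hv | hv | hv
  · exact absurd ((e 0).symm.trans hμ0) (hν _ (by linarith))
  · exact hv
  · exact absurd ((e v).trans (by rw [sub_self, hν0])) (hμ v hv)

/-- Near the extremal case, the fibre lengths of `S` have the expected level-set volumes at
levels that are not too small. -/
lemma NearExtremal.volume_lev_le {τ δ a b : ℝ} {A B S : Set (Sp n)}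
    (h : NearExtremal volume τ δ a b A B S) (hδ : 0 < δ) (hδ' : δ ≤ 1) {C : ℝ} (hC : 0 ≤ C)
    (hA : volume {x | fib A x ≠ 0} ≤ ENNReal.ofReal C)
    (hB : volume {x | fib B x ≠ 0} ≤ ENNReal.ofReal C) :
    volume (lev S (2 * δ)) ≤ ENNReal.ofReal (C + 1) ∧
      ENNReal.ofReal (1 - δ - 2 * δ * C) ≤ volume (hypo (2 * δ) A) ∧
      ENNReal.ofReal (1 - δ - 2 * δ * C) ≤ volume (hypo (2 * δ) B) := by
  have hθ : 0 ≤ 2 * δ := by positivity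
  have lo : ∀ {X : Set (Sp n)}, MeasurableSet X → ENNReal.ofReal (1 - δ) ≤ volume X →
      volume {x | fib X x ≠ 0} ≤ ENNReal.ofReal C →
      ENNReal.ofReal (1 - δ) ≤ volume (hypo (2 * δ) X) + ENNReal.ofReal (2 * δ * C) := by
    intro X hX h1 h2
    refine h1.trans ((volume_le_hypo_add hX hθ).trans ?_)
    rw [ENNReal.ofReal_mul hθ]
    gcongr
  have lo' : ∀ {X : Set (Sp n)},
      ENNReal.ofReal (1 - δ) ≤ volume (hypo (2 * δ) X) + ENNReal.ofReal (2 * δ * C) →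
      ENNReal.ofReal (1 - δ - 2 * δ * C) ≤ volume (hypo (2 * δ) X) := by
    intro X hX
    rw [ENNReal.ofReal_sub _ (by positivity)]
    exact tsub_le_iff_right.2 hX
  have hA' := lo h.meas_A h.le_A hA
  have hB' := lo h.meas_B h.le_B hB
  refine ⟨?_, lo' hA', lo' hB'⟩
  have hS : ENNReal.ofReal (1 - δ) ≤
      volume (hypo (2 * δ) S) + ENNReal.ofReal (2 * δ * C) := by
    refine le_trans ?_ (add_le_add_left (min_measure_le volume h.a_pos h.b_pos h.add_eq
      (measurableSet_hypo h.meas_A _) (measurableSet_hypo h.meas_B _) (h.hypo_combo hθ)) _)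
    rw [← min_add_add_right]
    exact le_min hA' hB'
  have h1 : ENNReal.ofReal (2 * δ) * volume (lev S (2 * δ)) + ENNReal.ofReal (1 - δ) ≤
      ENNReal.ofReal (2 * δ) * ENNReal.ofReal (C + 1) + ENNReal.ofReal (1 - δ) := by
    calc ENNReal.ofReal (2 * δ) * volume (lev S (2 * δ)) + ENNReal.ofReal (1 - δ)
        ≤ ENNReal.ofReal (2 * δ) * volume (lev S (2 * δ)) +
          (volume (hypo (2 * δ) S) + ENNReal.ofReal (2 * δ * C)) := by gcongr
      _ = volume (hypo (2 * δ) S) + ENNReal.ofReal (2 * δ) * volume (lev S (2 * δ)) +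
          ENNReal.ofReal (2 * δ * C) := by ring
      _ ≤ ENNReal.ofReal (1 + δ) + ENNReal.ofReal (2 * δ * C) := by
          gcongr
          exact (volume_hypo_add_le h.meas_S hθ).trans h.S_le
      _ = _ := by
          rw [← ENNReal.ofReal_mul hθ, ← ENNReal.ofReal_add (by positivity) (by positivity),
            ← ENNReal.ofReal_add (by positivity) (by linarith)]
          congr 1
          ring
  rw [ENNReal.add_le_add_iff_right ENNReal.ofReal_ne_top] at h1
  exact (ENNReal.mul_le_mul_iff_right (by simpa using hδ) ENNReal.ofReal_ne_top).1 h1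

/-- Along almost extremal sequences with normalised fibres, there are arbitrarily small levels at
which the level sets of the fibre lengths have asymptotically the same volume. -/
theorem exists_level {τ C : ℝ} (hC : 1 ≤ C) {a b : ℕ → ℝ} {A B S : ℕ → Set (Sp n)}
    (h : ∀ k : ℕ, NearExtremal volume τ (1 / (k + 1)) (a k) (b k) (A k) (B k) (S k))
    (hAC : ∀ k x, fib (A k) x ≤ ENNReal.ofReal C) (hBC : ∀ k x, fib (B k) x ≤ ENNReal.ofReal C)
    (hAs : ∀ k, volume {x | fib (A k) x ≠ 0} ≤ ENNReal.ofReal C)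
    (hBs : ∀ k, volume {x | fib (B k) x ≠ 0} ≤ ENNReal.ofReal C) {s0 : ℝ} (hs0 : 0 < s0) :
    ∃ s, 0 < s ∧ s < s0 ∧ ∃ V : ℝ≥0∞,
      Tendsto (fun k => volume (lev (A k) s)) (hyperfilter ℕ : Filter ℕ) (nhds V) ∧
      Tendsto (fun k => volume (lev (B k) s)) (hyperfilter ℕ : Filter ℕ) (nhds V) ∧
      Tendsto (fun k => volume (lev (S k) s)) (hyperfilter ℕ : Filter ℕ) (nhds V) := by
  set U : Ultrafilter ℕ := hyperfilter ℕ with hU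
  have hUle : (U : Filter ℕ) ≤ atTop := Nat.hyperfilter_le_atTop
  have hτ := (h 0).τ_pos
  have hδ : ∀ k : ℕ, (0 : ℝ) < 1 / (k + 1) := fun k => by positivity
  have hδ1 : ∀ k : ℕ, (1 : ℝ) / (k + 1) ≤ 1 := fun k => by
    rw [div_le_one (by positivity)]
    linarith [Nat.cast_nonneg (α := ℝ) k]
  have hd : Tendsto (fun k : ℕ => (1 : ℝ) / (k + 1)) U (nhds 0) :=
    tendsto_one_div_add_atTop_nhds_zero_nat.mono_left hUle
  set θ : ℕ → ℝ := fun k => 2 * (1 / (k + 1)) with hθdef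
  have hθ : Tendsto θ U (nhds 0) := by
    have := hd.const_mul 2
    rwa [mul_zero] at this
  have hθ0 : ∀ k, 0 < θ k := fun k => by positivity
  have hC0 : 0 ≤ C := by linarith
  have hv := fun k => (h k).volume_lev_le (hδ k) (hδ1 k) hC0 (hAs k) (hBs k)
  have hb1 : ∀ {a b : ℝ}, τ ≤ a → τ ≤ b → a + b = 1 → ‖a - 0‖ ≤ 1 := fun ha hb hab => by
    rw [sub_zero, Real.norm_eq_abs, abs_le]; constructor <;> linarith
  obtain ⟨a0, -, hat⟩ := exists_tendsto_of_eventually_norm_le (U := U) (y := a) (c := 0) (r := 1)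
    (Eventually.of_forall fun k => hb1 (h k).le_a (h k).le_b (h k).add_eq)
  obtain ⟨b0, -, hbt⟩ := exists_tendsto_of_eventually_norm_le (U := U) (y := b) (c := 0) (r := 1)
    (Eventually.of_forall fun k => hb1 (h k).le_b (h k).le_a (by linarith [(h k).add_eq]))
  have ha0 : 0 < a0 := hτ.trans_le (ge_of_tendsto' hat fun k => (h k).le_a)
  have hb0 : 0 < b0 := hτ.trans_le (ge_of_tendsto' hbt fun k => (h k).le_b)
  set A' : ℕ → Set (Sp n) := fun k => hypo (θ k) (A k) with hA'
  set B' : ℕ → Set (Sp n) := fun k => hypo (θ k) (B k) with hB'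
  set S' : ℕ → Set (Sp n) := fun k => hypo (θ k) (S k) ∩ Prod.snd ⁻¹' Iic C with hS'
  have hA'm : ∀ k, MeasurableSet (A' k) := fun k => measurableSet_hypo (h k).meas_A _
  have hB'm : ∀ k, MeasurableSet (B' k) := fun k => measurableSet_hypo (h k).meas_B _
  have hS'm : ∀ k, MeasurableSet (S' k) := fun k =>
    (measurableSet_hypo (h k).meas_S _).inter (measurable_snd measurableSet_Iic)
  have rng : ∀ {X : ℕ → Set (Sp n)}, (∀ k x, fib (X k) x ≤ ENNReal.ofReal C) →
      ∀ k, ∀ z ∈ hypo (θ k) (X k), z.2 ∈ Icc 0 C := by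
    intro X hX k z hz
    have h0 : 0 ≤ z.2 := (hθ0 k).le.trans hz.1.le
    exact ⟨h0, ((ENNReal.ofReal_lt_ofReal_iff_of_nonneg h0).1 (hz.2.trans_le (hX k z.1))).le⟩
  have rngA := rng hAC
  have rngB := rng hBC
  have rngS : ∀ k, ∀ z ∈ S' k, z.2 ∈ Icc 0 C := fun k z hz =>
    ⟨(hθ0 k).le.trans hz.1.1.le, hz.2⟩
  have hcombo : ∀ k, ∀ x ∈ A' k, ∀ y ∈ B' k, a k • x + b k • y ∈ S' k := by
    intro k x hx y hy
    exact ⟨(h k).hypo_combo (hθ0 k).le x hx y hy, ((convex_Icc (0 : ℝ) C) (rngA k x hx)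
      (rngB k y hy) (h k).a_pos.le (h k).b_pos.le (h k).add_eq).2⟩
  have hle1 : ENNReal.ofReal C ≤ ENNReal.ofReal (C + 1) := ENNReal.ofReal_le_ofReal (by linarith)
  set M : Measure ℝ := ENNReal.ofReal (C + 1) • volume.restrict (Icc 0 C) with hM
  have hMf : IsFiniteMeasure M := Measure.smul_finite _ ENNReal.ofReal_ne_top
  set ℓ : Sp n →L[ℝ] ℝ := ContinuousLinearMap.snd ℝ (Edim n) ℝ with hℓ
  have hℓ' : ⇑ℓ = Prod.snd := rfl
  have hAM : ∀ k, (volume.restrict (A' k)).map ℓ ≤ M := fun k =>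
    map_snd_le (hA'm k) measurableSet_Icc (rngA k) fun s =>
      (measure_mono fun x hx => (lt_of_le_of_lt zero_le hx.2).ne').trans ((hAs k).trans hle1)
  have hBM : ∀ k, (volume.restrict (B' k)).map ℓ ≤ M := fun k =>
    map_snd_le (hB'm k) measurableSet_Icc (rngB k) fun s =>
      (measure_mono fun x hx => (lt_of_le_of_lt zero_le hx.2).ne').trans ((hBs k).trans hle1)
  have hSM : ∀ k, (volume.restrict (S' k)).map ℓ ≤ M := fun k =>
    map_snd_le (hS'm k) measurableSet_Icc (rngS k) fun s =>
      (measure_mono fun x (hx : (x, s) ∈ S' k) => lev_anti (S k) hx.1.1.le hx.1.2).trans (hv k).1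
  obtain ⟨μ', -, hμ'⟩ := exists_setwise_limit U _ M hAM
  obtain ⟨ν', -, hν'⟩ := exists_setwise_limit U _ M hBM
  obtain ⟨σ', -, hσ'⟩ := exists_setwise_limit U _ M hSM
  have conv : ∀ {D : ℕ → Set (Sp n)} {κ : Measure ℝ}, (∀ I, MeasurableSet I →
      Tendsto (fun k => (volume.restrict (D k)).map ℓ I) U (nhds (κ I))) →
      ∀ I, MeasurableSet I → Tendsto (fun k => volume (D k ∩ Prod.snd ⁻¹' I)) U (nhds (κ I)) := by
    intro D κ hD I hI
    refine (hD I hI).congr fun k => ?_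
    rw [hℓ', Measure.map_apply measurable_snd hI, Measure.restrict_apply (measurable_snd hI),
      inter_comm]
  have hμ2 := conv hμ'
  have hν2 := conv hν'
  have hσ2 := conv hσ'
  have hone : ∀ {D : ℕ → Set (Sp n)} {κ : Measure ℝ}, (∀ I, MeasurableSet I →
      Tendsto (fun k => volume (D k ∩ Prod.snd ⁻¹' I)) U (nhds (κ I))) →
      (∀ k : ℕ, ENNReal.ofReal (1 - 1 / (k + 1) - 2 * (1 / (k + 1)) * C) ≤ volume (D k)) →
      (∀ k : ℕ, volume (D k) ≤ ENNReal.ofReal (1 + 1 / (k + 1))) → IsProbabilityMeasure κ := by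
    intro D κ hκ h1 h2
    have l1 := ENNReal.tendsto_ofReal ((hd.const_sub 1).sub (hθ.mul_const C))
    have l2 := ENNReal.tendsto_ofReal (hd.const_add 1)
    rw [sub_zero, zero_mul, sub_zero, ENNReal.ofReal_one] at l1
    rw [add_zero, ENNReal.ofReal_one] at l2
    have h := hκ univ MeasurableSet.univ
    simp only [preimage_univ, inter_univ] at h
    exact ⟨tendsto_nhds_unique h (tendsto_of_tendsto_of_tendsto_of_le_of_le l1 l2 h1 h2)⟩
  have pμ : IsProbabilityMeasure μ' := hone hμ2 (fun k => (hv k).2.1) fun k =>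
    (volume_hypo_le (h k).meas_A (hθ0 k).le).trans (h k).A_le
  have pν : IsProbabilityMeasure ν' := hone hν2 (fun k => (hv k).2.2) fun k =>
    (volume_hypo_le (h k).meas_B (hθ0 k).le).trans (h k).B_le
  have pσ : IsProbabilityMeasure σ' := hone hσ2
    (fun k => (le_min (hv k).2.1 (hv k).2.2).trans (min_measure_le volume (h k).a_pos (h k).b_pos
      (h k).add_eq (hA'm k) (hB'm k) (hcombo k)))
    fun k => (measure_mono inter_subset_left).trans
      ((volume_hypo_le (h k).meas_S (hθ0 k).le).trans (h k).S_le)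
  have habs : ∀ {x : ℝ}, x ∈ Icc 0 C → |x| ≤ C := fun hx => abs_le.2 ⟨by linarith [hx.1], hx.2⟩
  obtain ⟨v, hv1, hv2⟩ := limit_eq_translate volume U (fun k => (h k).add_eq)
    (fun k => (h k).a_pos) (fun k => (h k).b_pos) ha0 hb0 hat hbt hA'm hB'm hS'm hcombo ℓ (R := C)
    (fun k x hx => habs (rngA k x hx)) (fun k x hx => habs (rngB k x hx))
    (fun k x hx => habs (rngS k x hx)) M hAM hBM hSM hμ' hν' hσ'
  have zero : ∀ {X : ℕ → Set (Sp n)} {κ : Measure ℝ}, (∀ I, MeasurableSet I →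
      Tendsto (fun k => volume (hypo (θ k) (X k) ∩ Prod.snd ⁻¹' I)) U (nhds (κ I))) →
      κ (Iic 0) = 0 := by
    intro X κ hκ
    refine tendsto_nhds_unique (hκ _ measurableSet_Iic) ?_
    convert tendsto_const_nhds (x := (0 : ℝ≥0∞)) using 2 with k
    convert measure_empty (μ := (volume : Measure (Sp n)))
    ext z
    simp only [mem_inter_iff, mem_preimage, mem_Iic, mem_empty_iff_false, iff_false, not_and,
      not_le]
    exact fun hz => (hθ0 k).trans hz.1
  have v0 : v = 0 := translate_eq_zero hv1 (zero hμ2) (zero hν2)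
    (fun t ht => limit_Iic_ne_zero (fun k => (h k).meas_A) hAC hθ hμ2 ht)
    (fun t ht => limit_Iic_ne_zero (fun k => (h k).meas_B) hBC hθ hν2 ht)
  rw [v0] at hv1 hv2
  simp only [add_zero, mul_zero, Measure.map_id'] at hv1 hv2
  rw [← hv1] at hν2 hv2
  rw [hv2] at hσ2
  have hσ3 : ∀ I, MeasurableSet I → I ⊆ Iic C →
      Tendsto (fun k => volume (hypo (θ k) (S k) ∩ Prod.snd ⁻¹' I)) U (nhds (μ' I)) := by
    intro I hI hIC
    refine (hσ2 I hI).congr fun k => ?_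
    rw [hS', inter_assoc, ← preimage_inter, inter_eq_right.2 hIC]
  have hμ3 : ∀ I, MeasurableSet I → I ⊆ Iic C →
      Tendsto (fun k => volume (hypo (θ k) (A k) ∩ Prod.snd ⁻¹' I)) U (nhds (μ' I)) :=
    fun I hI _ => hμ2 I hI
  have hν3 : ∀ I, MeasurableSet I → I ⊆ Iic C →
      Tendsto (fun k => volume (hypo (θ k) (B k) ∩ Prod.snd ⁻¹' I)) U (nhds (μ' I)) :=
    fun I hI _ => hν2 I hI
  have hmA := fun k => (h k).meas_A
  choose F hF using fun s : ℝ => U.exists_tendsto (fun k => volume (lev (A k) s))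
  have hFanti : Antitone F := fun s t hst =>
    le_of_tendsto_of_tendsto' (hF t) (hF s) fun k => measure_mono (lev_anti _ hst)
  set s1 := min s0 C with hs1
  have hs1p : 0 < s1 := lt_min hs0 (by linarith)
  obtain ⟨s, hs, hsF⟩ : ∃ s ∈ Ioo 0 s1, ContinuousAt F s := by
    by_contra! hcon
    have : (Ioo 0 s1).Countable := hFanti.countable_not_continuousAt.mono fun s hs => hcon s hs
    exact absurd (Cardinal.mk_le_aleph0_iff.2 this.to_subtype) (by
      rw [Cardinal.mk_Ioo_real hs1p, not_le]
      exact Cardinal.aleph0_lt_continuum)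
  have main : ∀ {Y : ℕ → Set (Sp n)}, (∀ k, MeasurableSet (Y k)) → (∀ I, MeasurableSet I →
      I ⊆ Iic C → Tendsto (fun k => volume (hypo (θ k) (Y k) ∩ Prod.snd ⁻¹' I)) U
        (nhds (μ' I))) → Tendsto (fun k => volume (lev (Y k) s)) U (nhds (F s)) := by
    intro Y hY hY'
    obtain ⟨y, hy⟩ := U.exists_tendsto (fun k => volume (lev (Y k) s))
    have hsC : s < C := hs.2.trans_le (min_le_right _ _)
    have h1 : y ≤ F s := by
      refine ge_of_tendsto (hsF.tendsto.mono_left (nhdsWithin_le_nhds (s := Iio s))) ?_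
      filter_upwards [Ioo_mem_nhdsLT hs.1] with t ht
      exact level_limit_le hmA hY hθ hμ3 hY' ht.1 ht.2 hsC.le (hF t) hy
    have h2 : F s ≤ y := by
      refine le_of_tendsto (hsF.tendsto.mono_left (nhdsWithin_le_nhds (s := Ioi s))) ?_
      filter_upwards [Ioo_mem_nhdsGT hsC] with t ht
      exact level_limit_le hY hmA hθ hY' hμ3 hs.1 ht.1 ht.2.le hy (hF t)
    rwa [le_antisymm h1 h2] at hy
  exact ⟨s, hs.1, hs.2.trans_le (min_le_left _ _), F s, hF s, main (fun k => (h k).meas_B) hν3,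
    main (fun k => (h k).meas_S) hσ3⟩

end

section

variable {n : ℕ}

lemma volume_le_inter_lev_add {A : Set (Sp n)} (hA : MeasurableSet A) (s : ℝ) :
    volume A ≤ volume (A ∩ Prod.fst ⁻¹' lev A s) +
      ENNReal.ofReal s * volume {x | fib A x ≠ 0} := by
  rw [← setLIntegral_fib hA (measurableSet_lev hA s), ← lintegral_fib hA, ← setLIntegral_const,
    ← lintegral_indicator (measurableSet_lev hA s), ← lintegral_indicator
    (measurableSet_fib_ne_zero hA), ← lintegral_add_left
    ((measurable_fib hA).indicator (measurableSet_lev hA s))]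
  refine lintegral_mono fun x => ?_
  by_cases hx : x ∈ lev A s
  · rw [indicator_of_mem hx]
    exact le_self_add
  by_cases hx' : fib A x = 0
  · simp [hx']
  · rw [indicator_of_notMem hx, indicator_of_mem (by exact hx'), zero_add]
    exact not_lt.1 hx

lemma volume_inter_lev_le {A : Set (Sp n)} (hA : MeasurableSet A) (s : ℝ) {C : ℝ≥0∞}
    (hC : ∀ x, fib A x ≤ C) : volume (A ∩ Prod.fst ⁻¹' lev A s) ≤ C * volume (lev A s) := by
  rw [← setLIntegral_fib hA (measurableSet_lev hA s), ← setLIntegral_const]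
  exact lintegral_mono hC

lemma lev_subset_image_fst (A : Set (Sp n)) (s : ℝ) : lev A s ⊆ Prod.fst '' A := by
  intro x hx
  obtain ⟨y, hy⟩ := nonempty_of_measure_ne_zero (lev_subset A s hx)
  exact ⟨(x, y), hy, rfl⟩

lemma exists_norm_fst_le {τ ε δ a b s R : ℝ} {A B S : Set (Sp n)}
    (h : NearExtremal volume τ δ a b A B S) {e : Edim n ≃L[ℝ] Edim n} (he : MeasurePreserving e)
    (hε : ε < 1) (hδ : 1 + δ < (1 - ε) * (1 + τ ^ (n + 1))) {p q : Edim n}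
    (hA : ∀ x ∈ lev A s, ‖e x + p‖ ≤ R) (hB : ∀ x ∈ lev B s, ‖e x + q‖ ≤ R)
    (hAε : ENNReal.ofReal (1 - ε) ≤ volume (A ∩ Prod.fst ⁻¹' lev A s))
    (hBε : ENNReal.ofReal (1 - ε) ≤ volume (B ∩ Prod.fst ⁻¹' lev B s)) :
    ∀ x ∈ A, ‖e x.1 + p‖ ≤ 2 * R / τ := by
  have hL : MeasurePreserving (baseMap e 1 one_ne_zero) :=
    measurePreserving_baseMap one_ne_zero (by simpa using he.map_eq)
  set L := baseMap e 1 one_ne_zero with hLdef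
  have h' := h.image hL (p, 0) (q, 0)
  have hms : ∀ {X : Set (Sp n)} (r : Edim n), MeasurableSet X →
      MeasurableSet ((fun x => L x + (r, (0 : ℝ))) '' (X ∩ Prod.fst ⁻¹' lev X s)) :=
    fun {X} r hX => (measurableEmbedding_affine L _).measurableSet_image.2
      (hX.inter (measurable_fst (measurableSet_lev hX s)))
  intro x hx
  have hfin : Module.finrank ℝ (Sp n) = n + 1 := by simp
  have := h'.norm_le_of_subset (ContinuousLinearMap.fst ℝ (Edim n) ℝ) (r := R) (ε := ε)
    (image_mono inter_subset_left) (image_mono inter_subset_left) (hms p h.meas_A)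
    (hms q h.meas_B) ?_ ?_ (by rwa [measure_image_affine hL]) (by rwa [measure_image_affine hL])
    hε (by rwa [hfin]) (mem_image_of_mem _ hx)
  · exact this
  · rintro _ ⟨y, hy, rfl⟩
    exact hA _ hy.2
  · rintro _ ⟨y, hy, rfl⟩
    exact hB _ hy.2

/-- Almost extremal sets with normalised fibres can be moved by a volume preserving linear map of
the base and translations into a fixed cylinder. -/
theorem exists_base_bound
    (hT : ∀ (m : Measure (Edim n)) [m.IsAddHaarMeasure], TightExtremal m)
    {τ C : ℝ} (hτ : 0 < τ) (hC : 1 ≤ C) : ∃ R δ : ℝ, 0 < δ ∧ ∀ (a b : ℝ) (A B S : Set (Sp n)),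
      NearExtremal volume τ δ a b A B S → Bornology.IsBounded A → Bornology.IsBounded B →
      (∀ x, fib A x ≤ ENNReal.ofReal C) → (∀ x, fib B x ≤ ENNReal.ofReal C) →
      volume {x | fib A x ≠ 0} ≤ ENNReal.ofReal C → volume {x | fib B x ≠ 0} ≤ ENNReal.ofReal C →
      ∃ (e : Edim n ≃L[ℝ] Edim n) (p q : Edim n), MeasurePreserving e ∧
        (∀ x ∈ A, ‖e x.1 + p‖ ≤ R) ∧ ∀ x ∈ B, ‖e x.1 + q‖ ≤ R := by
  by_contra! hcon
  have hδ : ∀ k : ℕ, (0 : ℝ) < 1 / (k + 1) := fun k => by positivity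
  choose a b A B S h hA hB hAC hBC hAs hBs hfail using fun k : ℕ => hcon k (1 / (k + 1)) (hδ k)
  set T := τ ^ (n + 1) with hTdef
  have hT0 : 0 < T := by positivity
  set ε := T / (2 * (1 + T)) with hε
  have hε0 : 0 < ε := by positivity
  have hε1 : ε < 1 := by
    rw [hε, div_lt_one (by positivity)]
    linarith
  have hεT : (1 - ε) * (1 + T) = 1 + T / 2 := by
    rw [hε]
    field_simp
    ring
  have hC0 : 0 < C := by linarith
  obtain ⟨s, hs, hs0, V, hVA, hVB, hVS⟩ := exists_level hC h hAC hBC hAs hBs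
    (s0 := ε / (2 * C)) (by positivity)
  set U : Ultrafilter ℕ := hyperfilter ℕ with hU
  have hUle : (U : Filter ℕ) ≤ atTop := Nat.hyperfilter_le_atTop
  have hd : Tendsto (fun k : ℕ => (1 : ℝ) / (k + 1)) U (nhds 0) :=
    tendsto_one_div_add_atTop_nhds_zero_nat.mono_left hUle
  have hsC : s * C < ε / 2 := by
    calc s * C < ε / (2 * C) * C := by gcongr
      _ = ε / 2 := by field_simp
  have loss : ∀ {X : Set (Sp n)}, MeasurableSet X → volume {x | fib X x ≠ 0} ≤ ENNReal.ofReal C →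
      volume X ≤ volume (X ∩ Prod.fst ⁻¹' lev X s) + ENNReal.ofReal (s * C) := by
    intro X hX hXs
    rw [ENNReal.ofReal_mul hs.le]
    exact (volume_le_inter_lev_add hX s).trans (by gcongr)
  have hVt : V ≠ ⊤ := ne_top_of_le_ne_top ENNReal.ofReal_ne_top
    (le_of_tendsto' hVA fun k => (measure_mono (lev_subset _ _)).trans (hAs k))
  have hV0 : V ≠ 0 := by
    rintro rfl
    have l1 := ENNReal.tendsto_ofReal (hd.const_sub 1)
    have l2 := (ENNReal.Tendsto.const_mul hVA (Or.inr (ENNReal.ofReal_ne_top (r := C)))).add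
      (tendsto_const_nhds (x := ENNReal.ofReal (s * C)))
    have := le_of_tendsto_of_tendsto' l1 l2 fun k => (h k).le_A.trans
      ((loss (h k).meas_A (hAs k)).trans
        (by gcongr; exact volume_inter_lev_le (h k).meas_A s (hAC k)))
    rw [mul_zero, zero_add, sub_zero, ENNReal.ofReal_le_ofReal_iff (by positivity)] at this
    linarith
  set m' : Measure (Edim n) := V⁻¹ • volume with hm'
  have hm'H : m'.IsAddHaarMeasure :=
    Measure.IsAddHaarMeasure.smul _ (ENNReal.inv_ne_zero.2 hVt) (ENNReal.inv_ne_top.2 hV0)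
  obtain ⟨R, δ', hδ', H⟩ := hT m' τ hτ
  have one : ∀ {X : ℕ → Set (Edim n)}, Tendsto (fun k => volume (X k)) U (nhds V) →
      Tendsto (fun k => m' (X k)) U (nhds 1) := by
    intro X hX
    rw [← ENNReal.inv_mul_cancel hV0 hVt]
    exact ENNReal.Tendsto.const_mul hX (Or.inr (ENNReal.inv_ne_top.2 hV0))
  have lt1 : ENNReal.ofReal (1 - δ') < 1 := by
    rw [← ENNReal.ofReal_one]
    exact (ENNReal.ofReal_lt_ofReal_iff one_pos).2 (by linarith)
  have gt1 : 1 < ENNReal.ofReal (1 + δ') := by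
    rw [← ENNReal.ofReal_one]
    exact (ENNReal.ofReal_lt_ofReal_iff (by linarith)).2 (by linarith)
  have hlarge : ∀ᶠ k : ℕ in U, 2 * R / τ ≤ k :=
    hUle (tendsto_natCast_atTop_atTop.eventually_ge_atTop _)
  obtain ⟨k, ⟨⟨⟨⟨⟨⟨⟨hk1, hk2⟩, hk3⟩, hk4⟩, hk5⟩, hk6⟩, hk7⟩, hk8⟩⟩ :=
    ((((((((one hVA).eventually (lt_mem_nhds lt1)).and ((one hVA).eventually
    (gt_mem_nhds gt1))).and ((one hVB).eventually (lt_mem_nhds lt1))).and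
    ((one hVB).eventually (gt_mem_nhds gt1))).and ((one hVS).eventually (gt_mem_nhds gt1))).and
    (hd.eventually (gt_mem_nhds (half_pos hε0)))).and
    (hd.eventually (gt_mem_nhds (half_pos hT0)))).and hlarge |>.exists
  have hk := h k
  obtain ⟨L, p, q, hL, hLA, hLB⟩ := H (a k) (b k) (lev (A k) s) (lev (B k) s) (lev (S k) s)
    ⟨hk.τ_pos, hk.le_a, hk.le_b, hk.add_eq, measurableSet_lev hk.meas_A s,
      measurableSet_lev hk.meas_B s, measurableSet_lev hk.meas_S s, hk.lev_combo s, hk1.le, hk2.le,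
      hk3.le, hk4.le, hk5.le⟩
    ((hA k).image_fst.subset (lev_subset_image_fst _ _))
    ((hB k).image_fst.subset (lev_subset_image_fst _ _))
  have hL' : MeasurePreserving L (volume : Measure (Edim n)) volume := by
    refine ⟨hL.measurable, ?_⟩
    have h1 := hL.map_eq
    rw [hm', Measure.map_smul] at h1
    have h2 := congrArg (fun μ => V • μ) h1
    simpa only [smul_smul, ENNReal.mul_inv_cancel hV0 hVt, one_smul] using h2
  have mass : ∀ {X : Set (Sp n)}, MeasurableSet X → ENNReal.ofReal (1 - 1 / (k + 1)) ≤ volume X →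
      volume {x | fib X x ≠ 0} ≤ ENNReal.ofReal C →
      ENNReal.ofReal (1 - ε) ≤ volume (X ∩ Prod.fst ⁻¹' lev X s) := by
    intro X hX h1 h2
    refine le_trans (ENNReal.ofReal_le_ofReal
      (by linarith : 1 - ε ≤ 1 - 1 / (k + 1) - s * C)) ?_
    rw [ENNReal.ofReal_sub _ (by positivity), tsub_le_iff_right]
    exact h1.trans (loss hX h2)
  have mA := mass hk.meas_A hk.le_A (hAs k)
  have mB := mass hk.meas_B hk.le_B (hBs k)
  have hδk : 1 + (1 : ℝ) / (k + 1) < (1 - ε) * (1 + τ ^ (n + 1)) := by rw [hεT]; linarith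
  have rA := exists_norm_fst_le hk hL' hε1 hδk hLA hLB mA mB
  have rB := exists_norm_fst_le hk.swap hL' hε1 hδk hLB hLA mB mA
  obtain ⟨x, hx, hx'⟩ := hfail k L p q hL' fun x hx => (rA x hx).trans hk8
  exact absurd ((rB x hx).trans hk8) (not_le.2 hx')

/-- Almost extremal sets can be moved into a fixed cylinder, with bounded fibres. -/
theorem exists_cylinder_bound (hn : n ≠ 0)
    (hT : ∀ (m : Measure (Edim n)) [m.IsAddHaarMeasure], TightExtremal m) {τ : ℝ} (hτ : 0 < τ) :
    ∃ R δ : ℝ, 0 < δ ∧ ∀ (a b : ℝ) (A B S : Set (Sp n)),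
      NearExtremal volume τ δ a b A B S → Bornology.IsBounded A → Bornology.IsBounded B →
      ∃ (L : Sp n ≃L[ℝ] Sp n) (p q : Sp n), MeasurePreserving L ∧
        (∀ x ∈ A, ‖(L x + p).1‖ ≤ R) ∧ (∀ x ∈ B, ‖(L x + q).1‖ ≤ R) ∧
        (∀ x, fib ((fun z => L z + p) '' A) x ≤ ENNReal.ofReal R) ∧
        ∀ x, fib ((fun z => L z + q) '' B) x ≤ ENNReal.ofReal R := by
  obtain ⟨C, hC, HC⟩ := exists_normalized hn hτ
  obtain ⟨R, δ, hδ, H⟩ := exists_base_bound hT hτ hC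
  refine ⟨max R C, min δ (1 / 2), by positivity, fun a b A B S h hA hB => ?_⟩
  obtain ⟨L, hL, h1, h2, h3, h4⟩ := HC a b A B S (h.mono (min_le_right _ _)) hA
  have h' := (h.image hL 0 0).mono (min_le_left δ (1 / 2))
  simp only [add_zero] at h'
  have hbd : ∀ {X : Set (Sp n)}, Bornology.IsBounded X → Bornology.IsBounded (L '' X) :=
    fun hX => (L : Sp n →L[ℝ] Sp n).lipschitz.isBounded_image hX
  obtain ⟨e, p, q, he, hpA, hqB⟩ := H a b _ _ _ h' (hbd hA) (hbd hB) h1 h2 h3 h4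
  have hL' : MeasurePreserving (baseMap e 1 one_ne_zero) :=
    measurePreserving_baseMap one_ne_zero (by simpa using he.map_eq)
  have him : ∀ (X : Set (Sp n)) (r : Edim n),
      (fun z => (L.trans (baseMap e 1 one_ne_zero)) z + (r, 0)) '' X =
        (fun z => baseMap e 1 one_ne_zero z + (r, 0)) '' (L '' X) := fun X r => by
    rw [image_image]; rfl
  have hle : ENNReal.ofReal C ≤ ENNReal.ofReal (max R C) :=
    ENNReal.ofReal_le_ofReal (le_max_right _ _)
  refine ⟨L.trans (baseMap e 1 one_ne_zero), (p, 0), (q, 0), hL'.comp hL,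
    fun x hx => (hpA _ (mem_image_of_mem _ hx)).trans (le_max_left _ _),
    fun x hx => (hqB _ (mem_image_of_mem _ hx)).trans (le_max_left _ _), fun x => ?_, fun x => ?_⟩
  · rw [him, fib_image_baseMap, abs_one, ENNReal.ofReal_one, one_mul]
    exact (h1 _).trans hle
  · rw [him, fib_image_baseMap, abs_one, ENNReal.ofReal_one, one_mul]
    exact (h2 _).trans hle

end

section

variable {n : ℕ}

lemma fib_eq_zero_of_notMem {K : Set (Sp n)} {x : Edim n} (hx : x ∉ Prod.fst '' K) :
    fib K x = 0 := by
  rw [fib]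
  convert measure_empty (μ := (volume : Measure ℝ))
  ext y
  simp only [vslice, mem_ofPred_eq, mem_empty_iff_false, iff_false]
  exact fun hy => hx ⟨(x, y), hy, rfl⟩

lemma fib_le_of_subset_closedBall {K : Set (Sp n)} {R : ℝ} (hK : K ⊆ Metric.closedBall 0 R)
    (x : Edim n) : fib K x ≤ ENNReal.ofReal (2 * R) := by
  calc fib K x ≤ volume (Icc (-R) R) := by
        refine measure_mono fun y hy => ?_
        have h1 := hK (show (x, y) ∈ K from hy)
        rw [mem_closedBall_zero_iff] at h1
        have h2 : |y| ≤ R := (norm_snd_le (x, y)).trans h1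
        exact abs_le.1 h2
    _ = _ := by rw [Real.volume_Icc]; congr 1; ring

lemma image_fst_subset_closedBall {K : Set (Sp n)} {R : ℝ} (hK : K ⊆ Metric.closedBall 0 R) :
    Prod.fst '' K ⊆ Metric.closedBall 0 R := by
  rintro _ ⟨x, hx, rfl⟩
  have h1 := hK hx
  rw [mem_closedBall_zero_iff] at h1 ⊢
  exact (norm_fst_le x).trans h1

lemma volume_le_image_fst {K : Set (Sp n)} (hK : IsCompact K) {u : ℝ≥0∞} (hu : ∀ x, fib K x ≤ u) :
    volume K ≤ u * volume (Prod.fst '' K) := by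
  have hC : MeasurableSet (Prod.fst '' K) := (hK.image continuous_fst).measurableSet
  rw [← lintegral_fib hK.measurableSet, ← setLIntegral_const, ← lintegral_indicator hC]
  refine lintegral_mono fun x => ?_
  by_cases hx : x ∈ Prod.fst '' K
  · rw [indicator_of_mem hx]
    exact hu x
  · simp [fib_eq_zero_of_notMem hx]

/-- The base points over which a convex set has short fibres form a thin set. -/
lemma volume_fib_le_le {K : Set (Sp n)} (hK : IsCompact K) (hKc : Convex ℝ K) (hK1 : volume K = 1)
    {ω η : ℝ} (hω : 0 < ω) (hKω : volume (Prod.fst '' K) ≤ ENNReal.ofReal ω) (hη : 0 < η)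
    (hηω : 4 * η * ω ≤ 1) :
    volume {x | x ∈ Prod.fst '' K ∧ fib K x ≤ ENNReal.ofReal (2 * η)} ≤
      ENNReal.ofReal (4 * n * ω ^ 2 * η) := by
  set C := Prod.fst '' K with hC
  have hCc : IsCompact C := hK.image continuous_fst
  have hCt : volume C ≠ ⊤ := hCc.measure_lt_top.ne
  obtain ⟨x0, hx0⟩ : ∃ x0, ENNReal.ofReal (1 / (2 * ω)) < fib K x0 := by
    by_contra! hcon
    have h1 := (volume_le_image_fst hK hcon).trans (mul_le_mul_right hKω _)
    rw [hK1, ← ENNReal.ofReal_mul (by positivity), ← ENNReal.ofReal_one,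
      ENNReal.ofReal_le_ofReal_iff (by positivity)] at h1
    have : 1 / (2 * ω) * ω = 1 / 2 := by field_simp
    linarith
  have hx0C : x0 ∈ C := by
    by_contra h
    rw [fib_eq_zero_of_notMem h] at hx0
    exact ENNReal.not_lt_zero hx0
  set s := 4 * η * ω with hs
  have hs0 : 0 < s := by positivity
  set T := (fun x => s • x0 + x) '' ((1 - s) • C) with hT
  have hTm : MeasurableSet T := by
    refine (measurableEmbedding_addLeft _).measurableSet_image.2 ?_
    exact (hCc.smul _).measurableSet
  have hTv : volume T = ENNReal.ofReal ((1 - s) ^ n) * volume C := by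
    rw [hT, image_add_left, measure_preimage_add, Measure.addHaar_smul,
      abs_of_nonneg (pow_nonneg (by linarith) _), finrank_euclideanSpace_fin]
  have hTC : T ⊆ C := by
    rintro _ ⟨_, ⟨x, hx, rfl⟩, rfl⟩
    exact (hKc.is_linear_image (f := Prod.fst) ⟨fun _ _ => rfl, fun _ _ => rfl⟩) hx0C hx hs0.le
      (by linarith) (by ring)
  have hsub : {x | x ∈ C ∧ fib K x ≤ ENNReal.ofReal (2 * η)} ⊆ C \ T := by
    rintro x ⟨hx, hxη⟩
    refine ⟨hx, ?_⟩
    rintro ⟨_, ⟨y, hy, rfl⟩, rfl⟩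
    refine absurd hxη (not_le.2 ?_)
    obtain ⟨⟨y, r⟩, hyr, rfl⟩ := hy
    calc ENNReal.ofReal (2 * η) = ENNReal.ofReal s * ENNReal.ofReal (1 / (2 * ω)) := by
          rw [← ENNReal.ofReal_mul hs0.le, hs]
          congr 1
          field_simp
          ring
      _ < ENNReal.ofReal s * fib K x0 :=
          (ENNReal.mul_lt_mul_iff_right (by simpa using hs0) (by simp)).2 hx0
      _ = ENNReal.ofReal s * fib K x0 + ENNReal.ofReal (1 - s) * volume ({r} : Set ℝ) := by simp
      _ ≤ _ := by
          refine volume_combo_ge (measurableSet_vslice hK.measurableSet x0)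
            (measurableSet_singleton r)
            (nonempty_of_measure_ne_zero (lt_of_le_of_lt zero_le hx0).ne') (singleton_nonempty r)
            hs0.le (by linarith) ?_
          rintro u hu _ rfl
          exact hKc (show (x0, u) ∈ K from hu) hyr hs0.le (by linarith) (by ring)
  refine (measure_mono hsub).trans ?_
  rw [measure_sdiff hTC hTm.nullMeasurableSet (ne_top_of_le_ne_top hCt (measure_mono hTC)), hTv]
  have hb : 1 - n * s ≤ (1 - s) ^ n := by
    have := one_add_mul_le_pow (a := -s) (by linarith) n
    rw [← sub_eq_add_neg] at this
    linarith
  have hcC : volume C = ENNReal.ofReal (volume C).toReal := (ENNReal.ofReal_toReal hCt).symm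
  have hcω : (volume C).toReal ≤ ω := ENNReal.toReal_le_of_le_ofReal hω.le hKω
  set c := (volume C).toReal with hc
  have hc0 : 0 ≤ c := ENNReal.toReal_nonneg
  have hp : 0 ≤ (1 - s) ^ n := pow_nonneg (by linarith) _
  rw [hcC, ← ENNReal.ofReal_mul hp, ← ENNReal.ofReal_sub _ (mul_nonneg hp hc0)]
  refine ENNReal.ofReal_le_ofReal ?_
  calc c - (1 - s) ^ n * c ≤ n * s * c := by nlinarith
    _ ≤ n * s * ω := by gcongr
    _ = _ := by rw [hs]; ring

end

section

variable {n : ℕ}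

lemma fib_hypo_zero (A : Set (Sp n)) (x : Edim n) : fib (hypo 0 A) x = fib A x := by
  have := volume_setOf_ofReal_lt le_rfl (fib A x)
  rw [ENNReal.ofReal_zero, tsub_zero] at this
  exact this

lemma volume_hypo_zero {A : Set (Sp n)} (hA : MeasurableSet A) :
    volume (hypo 0 A) = volume A := by
  rw [volume_hypo hA le_rfl, ENNReal.ofReal_zero]
  simp_rw [tsub_zero]
  exact lintegral_fib hA

lemma hypo_zero_subset_closedBall {A : Set (Sp n)} {R : ℝ} (hA : ∀ x ∈ A, ‖x.1‖ ≤ R)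
    (hAR : ∀ x, fib A x ≤ ENNReal.ofReal R) : hypo 0 A ⊆ Metric.closedBall 0 R := by
  rintro ⟨x, s⟩ ⟨hs, hx⟩
  simp only at hs hx
  rw [mem_closedBall_zero_iff, norm_prod_le_iff]
  obtain ⟨y, hy⟩ := nonempty_of_measure_ne_zero (lt_of_le_of_lt zero_le hx).ne'
  refine ⟨hA (x, y) hy, ?_⟩
  rw [Real.norm_eq_abs, abs_of_pos hs]
  exact ((ENNReal.ofReal_lt_ofReal_iff_of_nonneg hs.le).1 (hx.trans_le (hAR x))).le

lemma fib_le_add_sdiff (X Y : Set (Sp n)) (x : Edim n) : fib X x ≤ fib Y x + fib (X \ Y) x :=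
  (measure_mono fun y hy => by
    by_cases h : (x, y) ∈ Y
    exacts [Or.inl h, Or.inr ⟨hy, h⟩]).trans (measure_union_le _ _)

lemma fib_preimage_add (K : Set (Sp n)) (v : Sp n) (x : Edim n) :
    fib ((· + v) ⁻¹' K) x = fib K (x + v.1) :=
  measure_preimage_add_right volume v.2 (vslice K (x + v.1))

lemma lintegral_fib_sub {A : Set (Sp n)} (hA : MeasurableSet A) (u : Edim n) :
    ∫⁻ x, fib A (x - u) = volume A := by
  rw [lintegral_sub_right_eq_self (fun x => fib A x) u, lintegral_fib hA]

lemma measurable_fib_sub {A : Set (Sp n)} (hA : MeasurableSet A) (u : Edim n) :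
    Measurable fun x => fib A (x - u) := (measurable_fib hA).comp (measurable_sub_const u)

lemma volume_lt_le_div {f : Edim n → ℝ≥0∞} (hf : Measurable f) {r s : ℝ} (hr : 0 < r)
    (h : ∫⁻ x, f x ≤ ENNReal.ofReal s) :
    volume {x | ENNReal.ofReal r < f x} ≤ ENNReal.ofReal (s / r) := by
  have h1 : volume {x | ENNReal.ofReal r < f x} ≤ volume {x | ENNReal.ofReal r ≤ f x} :=
    measure_mono fun x (hx : ENNReal.ofReal r < f x) => hx.le
  refine h1.trans
    ((meas_ge_le_lintegral_div hf.aemeasurable (by simpa using hr) ENNReal.ofReal_ne_top).trans ?_)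
  rw [ENNReal.ofReal_div_of_pos hr]
  gcongr

/-- Vertical structure of almost extremal sets contained in a fixed cylinder. -/
theorem exists_structure {τ R : ℝ} (hτ : 0 < τ) (hR : 0 < R) :
    ∃ c C' η0 : ℝ, 0 < c ∧ 0 < C' ∧ 0 < η0 ∧ ∀ η, 0 < η → η < η0 → ∃ δ > 0,
      ∀ (a b : ℝ) (A B S : Set (Sp n)), NearExtremal volume τ δ a b A B S →
      (∀ x ∈ A, ‖x.1‖ ≤ R) → (∀ x ∈ B, ‖x.1‖ ≤ R) →
      (∀ x, fib A x ≤ ENNReal.ofReal R) → (∀ x, fib B x ≤ ENNReal.ofReal R) →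
      ∃ (u : Edim n) (C D : Set (Edim n)), Convex ℝ C ∧ C ⊆ Metric.closedBall 0 R ∧ D ⊆ C ∧
        MeasurableSet C ∧ MeasurableSet D ∧
        ENNReal.ofReal c ≤ volume C ∧ volume C ≤ ENNReal.ofReal c⁻¹ ∧
        volume (C \ D) ≤ ENNReal.ofReal (C' * η) ∧
        ∫⁻ x in Dᶜ, fib A x ≤ ENNReal.ofReal (C' * η) ∧
        ∫⁻ x in Dᶜ, fib B (x - u) ≤ ENNReal.ofReal (C' * η) ∧
        ∀ x ∈ D, ENNReal.ofReal η ≤ fib A x ∧ ENNReal.ofReal η ≤ fib B (x - u) ∧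
          fib S (x - b • u) ≤ ENNReal.ofReal a * fib A x + ENNReal.ofReal b * fib B (x - u) +
            ENNReal.ofReal (η ^ 2) := by
  set ω := (volume (Metric.closedBall (0 : Edim n) R)).toReal with hω
  have hωt : volume (Metric.closedBall (0 : Edim n) R) ≠ ⊤ := measure_closedBall_lt_top.ne
  have hω0 : 0 < ω := ENNReal.toReal_pos (Metric.measure_closedBall_pos _ _ hR).ne' hωt
  have hωe : volume (Metric.closedBall (0 : Edim n) R) = ENNReal.ofReal ω :=
    (ENNReal.ofReal_toReal hωt).symm
  set c1 := 4 * n * ω ^ 2 + 14 with hc1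
  have hc10 : 0 < c1 := by positivity
  refine ⟨min (1 / (2 * R)) (1 / ω), c1 + R * c1 + 4, min 1 (1 / (4 * ω)), by positivity,
    by positivity, by positivity, fun η hη hη0 => ?_⟩
  have hη1 : η < 1 := hη0.trans_le (min_le_left _ _)
  have hηω : 4 * η * ω ≤ 1 := by
    have := hη0.trans_le (min_le_right _ _)
    rw [lt_div_iff₀ (by positivity)] at this
    linarith
  set ε := η ^ 4 with hε
  have hε0 : 0 < ε := by positivity
  obtain ⟨δ, hδ, H⟩ := exists_convex_of_almost_extremal (volume : Measure (Sp n)) hε0 hτ R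
  refine ⟨min δ ε, by positivity, fun a b A B S h hAr hBr hAR hBR => ?_⟩
  have h' := h.mono (min_le_left δ ε)
  have hε' := h.mono (min_le_right δ ε)
  have mA := measurableSet_hypo h.meas_A 0
  have mB := measurableSet_hypo h.meas_B 0
  obtain ⟨K, v, hK, hKc, hKR, hK1, hE1, hE2, hE3, hE4⟩ := H a b h.le_a h.le_b h.add_eq
    (hypo 0 A) (hypo 0 B) (hypo 0 S) mA mB (measurableSet_hypo h.meas_S 0)
    (hypo_zero_subset_closedBall hAr hAR) (hypo_zero_subset_closedBall hBr hBR)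
    (h.hypo_combo le_rfl) (volume_hypo_zero h.meas_A ▸ h'.le_A)
    (volume_hypo_zero h.meas_A ▸ h'.A_le)
    (volume_hypo_zero h.meas_B ▸ h'.le_B) (volume_hypo_zero h.meas_B ▸ h'.B_le)
    (volume_hypo_zero h.meas_S ▸ h'.S_le)
  have mK := hK.measurableSet
  set K' := (· + v) ⁻¹' K with hK'
  have mK' : MeasurableSet K' := measurable_add_const v mK
  set u := v.1 with hu
  set e : Edim n → ℝ≥0∞ := fun x => fib (hypo 0 A \ K) x + fib (K \ hypo 0 A) x +
    (fib (hypo 0 B \ K') (x - u) + fib (K' \ hypo 0 B) (x - u)) with he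
  have me : Measurable e := ((measurable_fib (mA.diff mK)).add (measurable_fib (mK.diff mA))).add
    ((measurable_fib_sub (mB.diff mK') u).add (measurable_fib_sub (mK'.diff mB) u))
  have hAK : ∀ x, fib A x ≤ fib K x + e x := fun x => by
    rw [← fib_hypo_zero A]
    refine (fib_le_add_sdiff _ K x).trans ?_
    gcongr
    simp only [he, add_assoc]
    exact le_self_add
  have hKA : ∀ x, fib K x ≤ fib A x + e x := fun x => by
    rw [← fib_hypo_zero A]
    refine (fib_le_add_sdiff _ (hypo 0 A) x).trans ?_
    gcongr
    exact le_add_self.trans le_self_add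
  have hK'u : ∀ x, fib K' (x - u) = fib K x := fun x => by
    rw [hK', fib_preimage_add, sub_add_cancel]
  have hBK : ∀ x, fib B (x - u) ≤ fib K x + e x := fun x => by
    rw [← fib_hypo_zero B, ← hK'u]
    refine (fib_le_add_sdiff _ K' _).trans ?_
    gcongr
    exact le_self_add.trans le_add_self
  have hKB : ∀ x, fib K x ≤ fib B (x - u) + e x := fun x => by
    rw [← fib_hypo_zero B, ← hK'u]
    refine (fib_le_add_sdiff _ (hypo 0 B) _).trans ?_
    gcongr
    exact le_add_self.trans le_add_self
  have he4 : ∫⁻ x, e x ≤ ENNReal.ofReal (4 * ε) := by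
    have : ∫⁻ x, e x = volume (hypo 0 A \ K) + volume (K \ hypo 0 A) +
        (volume (hypo 0 B \ K') + volume (K' \ hypo 0 B)) := by
      simp only [he]
      rw [lintegral_add_left, lintegral_add_left, lintegral_add_left, lintegral_fib, lintegral_fib,
        lintegral_fib_sub, lintegral_fib_sub]
      all_goals first
        | exact mA.diff mK
        | exact mK.diff mA
        | exact mB.diff mK'
        | exact mK'.diff mB
        | exact measurable_fib (mA.diff mK)
        | exact measurable_fib_sub (mB.diff mK') u
        | exact (measurable_fib (mA.diff mK)).add (measurable_fib (mK.diff mA))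
    rw [this]
    calc _ ≤ ENNReal.ofReal ε + ENNReal.ofReal ε + (ENNReal.ofReal ε + ENNReal.ofReal ε) := by
          gcongr
      _ = _ := by
          rw [← ENNReal.ofReal_add hε0.le hε0.le, ← ENNReal.ofReal_add (by positivity)
            (by positivity)]
          congr 1
          ring
  have ha := h.a_pos
  have hb := h.b_pos
  set l : Edim n → ℝ≥0∞ := fun x => ENNReal.ofReal a * fib A x + ENNReal.ofReal b * fib B (x - u)
    with hl
  have ml : Measurable l := ((measurable_fib h.meas_A).const_mul _).add
    ((measurable_fib_sub h.meas_B u).const_mul _)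
  have hab1 : ∀ y : ℝ≥0∞, ENNReal.ofReal a * y + ENNReal.ofReal b * y = y := fun y => by
    rw [← add_mul, ← ENNReal.ofReal_add ha.le hb.le, h.add_eq, ENNReal.ofReal_one, one_mul]
  have hle : ∀ x, l x ≤ fib S (x - b • u) + 2 * e x := by
    intro x
    by_cases h0 : fib A x = 0 ∨ fib B (x - u) = 0
    · have hKe : fib K x ≤ e x := by
        rcases h0 with h0 | h0
        · simpa [h0] using hKA x
        · simpa [h0] using hKB x
      have h2 : fib K x + e x ≤ 2 * e x := by
        rw [two_mul]
        gcongr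
      refine le_trans ?_ le_add_self
      calc l x ≤ ENNReal.ofReal a * (2 * e x) + ENNReal.ofReal b * (2 * e x) := by
            simp only [hl]
            gcongr
            · exact (hAK x).trans h2
            · exact (hBK x).trans h2
        _ = _ := hab1 _
    · push Not at h0
      have hx : x - b • u = a • x + b • (x - u) := by
        rw [smul_sub, ← add_sub_assoc, ← add_smul, h.add_eq, one_smul]
      rw [hx]
      exact (h.fib_combo h0.1 h0.2).trans le_self_add
  set w : Edim n → ℝ≥0∞ := fun x => fib S (x - b • u) + 2 * e x - l x with hw
  have mS : Measurable fun x => fib S (x - b • u) := measurable_fib_sub h.meas_S _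
  have mw : Measurable w := (mS.add (me.const_mul _)).sub ml
  have hlint : ∫⁻ x, l x = ENNReal.ofReal a * volume A + ENNReal.ofReal b * volume B := by
    simp only [hl]
    rw [lintegral_add_left ((measurable_fib h.meas_A).const_mul _),
      lintegral_const_mul _ (measurable_fib h.meas_A),
      lintegral_const_mul _ (measurable_fib_sub h.meas_B u), lintegral_fib h.meas_A,
      lintegral_fib_sub h.meas_B]
  have hlt : ∫⁻ x, l x ≠ ⊤ := by
    rw [hlint]
    have h1 := ne_top_of_le_ne_top ENNReal.ofReal_ne_top h.A_le
    have h2 := ne_top_of_le_ne_top ENNReal.ofReal_ne_top h.B_le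
    finiteness
  have hwint : ∫⁻ x, w x ≤ ENNReal.ofReal (10 * ε) := by
    simp only [hw]
    rw [lintegral_sub ml hlt (Eventually.of_forall hle), lintegral_add_left mS,
      lintegral_fib_sub h.meas_S, lintegral_const_mul _ me, tsub_le_iff_right]
    calc volume S + 2 * ∫⁻ x, e x ≤ ENNReal.ofReal (1 + ε) + 2 * ENNReal.ofReal (4 * ε) := by
          gcongr
          exact hε'.S_le
      _ ≤ ENNReal.ofReal (10 * ε) + ENNReal.ofReal (1 - ε) := by
          rw [← ENNReal.ofReal_ofNat 2, ← ENNReal.ofReal_mul two_pos.le,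
            ← ENNReal.ofReal_add (by positivity) (by positivity)]
          refine le_trans (ENNReal.ofReal_le_ofReal ?_) ENNReal.ofReal_add_le
          linarith
      _ ≤ ENNReal.ofReal (10 * ε) + ∫⁻ x, l x := by
          rw [hlint]
          gcongr
          rw [← hab1 (ENNReal.ofReal (1 - ε))]
          gcongr
          · exact hε'.le_A
          · exact hε'.le_B
  set C := Prod.fst '' K with hC
  have hCm : MeasurableSet C := (hK.image continuous_fst).measurableSet
  have hCR : C ⊆ Metric.closedBall 0 R := image_fst_subset_closedBall hKR
  have hCω : volume C ≤ ENNReal.ofReal ω := (measure_mono hCR).trans hωe.le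
  set D := C ∩ ({x | ENNReal.ofReal (2 * η) < fib K x} ∩ ({x | e x ≤ ENNReal.ofReal η} ∩
    {x | w x ≤ ENNReal.ofReal (η ^ 2)})) with hD
  have hDm : MeasurableSet D := hCm.inter ((measurableSet_lt measurable_const
    (measurable_fib mK)).inter ((measurableSet_le me measurable_const).inter
    (measurableSet_le mw measurable_const)))
  have hCD : volume (C \ D) ≤ ENNReal.ofReal (c1 * η) := by
    have hsub : C \ D ⊆ {x | x ∈ C ∧ fib K x ≤ ENNReal.ofReal (2 * η)} ∪
        ({x | ENNReal.ofReal η < e x} ∪ {x | ENNReal.ofReal (η ^ 2) < w x}) := by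
      rintro x ⟨hxC, hxD⟩
      by_contra hcon
      simp only [mem_union, mem_ofPred_eq, not_or, not_and, not_le, not_lt] at hcon
      exact hxD ⟨hxC, hcon.1 hxC, hcon.2.1, hcon.2.2⟩
    refine (measure_mono hsub).trans ((measure_union_le _ _).trans
      ((add_le_add_right (measure_union_le _ _) _).trans ?_))
    refine (add_le_add (volume_fib_le_le hK hKc hK1 hω0 hCω hη hηω) (add_le_add
      (volume_lt_le_div me hη he4) (volume_lt_le_div mw (pow_pos hη 2) hwint))).trans ?_
    rw [← ENNReal.ofReal_add (by positivity) (by positivity),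
      ← ENNReal.ofReal_add (by positivity) (by positivity)]
    refine ENNReal.ofReal_le_ofReal ?_
    have e1 : 4 * ε / η = 4 * (η ^ 2 * η) := by rw [hε]; field_simp
    have e2 : 10 * ε / η ^ 2 = 10 * (η * η) := by rw [hε]; field_simp
    rw [e1, e2, hc1]
    have : η ^ 2 ≤ 1 := pow_le_one₀ hη.le hη1.le
    nlinarith
  have mass : ∀ f : Edim n → ℝ≥0∞, (∀ x, f x ≤ ENNReal.ofReal R) → (∀ x, f x ≤ fib K x + e x) →
      ∫⁻ x in Dᶜ, f x ≤ ENNReal.ofReal ((c1 + R * c1 + 4) * η) := by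
    intro f hf1 hf2
    calc ∫⁻ x in Dᶜ, f x = ∫⁻ x, Dᶜ.indicator f x := (lintegral_indicator hDm.compl _).symm
      _ ≤ ∫⁻ x, ((C \ D).indicator (fun _ => ENNReal.ofReal R) x + e x) := by
          refine lintegral_mono fun x => ?_
          by_cases hxD : x ∈ D
          · simp [hxD]
          rw [indicator_of_mem hxD]
          by_cases hxC : x ∈ C
          · rw [indicator_of_mem (show x ∈ C \ D from ⟨hxC, hxD⟩)]
            exact (hf1 x).trans le_self_add
          · refine (hf2 x).trans ?_
            rw [fib_eq_zero_of_notMem hxC]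
            gcongr
            exact zero_le
      _ = ENNReal.ofReal R * volume (C \ D) + ∫⁻ x, e x := by
          rw [lintegral_add_right _ me, lintegral_indicator (hCm.diff hDm), setLIntegral_const]
      _ ≤ ENNReal.ofReal R * ENNReal.ofReal (c1 * η) + ENNReal.ofReal (4 * ε) := by gcongr
      _ ≤ _ := by
          rw [← ENNReal.ofReal_mul hR.le, ← ENNReal.ofReal_add (by positivity) (by positivity)]
          refine ENNReal.ofReal_le_ofReal ?_
          have : ε ≤ η := by
            rw [hε]
            exact pow_le_of_le_one hη.le hη1.le (by norm_num)
          have : 0 ≤ c1 * η := by positivity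
          nlinarith
  refine ⟨u, C, D, hKc.is_linear_image ⟨fun _ _ => rfl, fun _ _ => rfl⟩, hCR, inter_subset_left,
    hCm, hDm, ?_, ?_, hCD.trans (ENNReal.ofReal_le_ofReal ?_), mass _ hAR hAK,
    mass _ (fun x => hBR _) hBK, ?_⟩
  · have h1 := volume_le_image_fst hK (fib_le_of_subset_closedBall hKR)
    rw [hK1] at h1
    refine (ENNReal.ofReal_le_ofReal (min_le_left _ _)).trans ?_
    rw [ENNReal.ofReal_div_of_pos (by positivity), ENNReal.ofReal_one]
    exact ENNReal.div_le_of_le_mul' h1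
  · refine hCω.trans (ENNReal.ofReal_le_ofReal ?_)
    rw [le_inv_comm₀ hω0 (by positivity), ← one_div]
    exact min_le_right _ _
  · have : 0 ≤ R * c1 * η := by positivity
    nlinarith
  · rintro x ⟨hxC, hx1, hx2, hx3⟩
    have hx1 : ENNReal.ofReal (2 * η) < fib K x := hx1
    have hx2 : e x ≤ ENNReal.ofReal η := hx2
    have hx3 : w x ≤ ENNReal.ofReal (η ^ 2) := hx3
    rw [two_mul, ENNReal.ofReal_add hη.le hη.le] at hx1
    have lo : ∀ {y : ℝ≥0∞}, fib K x ≤ y + e x → ENNReal.ofReal η ≤ y := by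
      intro y hy
      have := hx1.le.trans (hy.trans (add_le_add_right hx2 y))
      rwa [ENNReal.add_le_add_iff_right ENNReal.ofReal_ne_top] at this
    refine ⟨lo (hKA x), lo (hKB x), ?_⟩
    exact le_self_add.trans (tsub_le_iff_left.1 hx3)

end

/-- A bounded, approximately additive function on `[-1, 1]` is close to a linear one. -/
lemma abs_sub_mul_le_of_approx_additive {F : ℝ → ℝ} {K P : ℝ}
    (hP : ∀ t, |t| ≤ 1 → |F t| ≤ P)
    (hF : ∀ s t, |s| ≤ 1 → |t| ≤ 1 → |s + t| ≤ 1 → |F (s + t) - F s - F t| ≤ K)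
    {t : ℝ} (ht : |t| ≤ 1) : |F t - t * F 1| ≤ 5 * K := by
  set f : ℝ → ℝ := fun t => F t - t * F 1 with hf
  have hadd : ∀ s t, |s| ≤ 1 → |t| ≤ 1 → |s + t| ≤ 1 → |f (s + t) - f s - f t| ≤ K := by
    intro s t hs ht hst
    have e : f (s + t) - f s - f t = F (s + t) - F s - F t := by simp only [hf]; ring
    rw [e]
    exact hF s t hs ht hst
  have hf1 : f 1 = 0 := by simp [hf]
  have hbdd : BddAbove ((fun t => |f t|) '' Icc 0 1) := by
    refine ⟨P + |F 1|, ?_⟩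
    rintro _ ⟨t, ht, rfl⟩
    have h1 : |t| ≤ 1 := by rw [abs_of_nonneg ht.1]; exact ht.2
    have h2 := abs_sub (F t) (t * F 1)
    rw [abs_mul] at h2
    have h3 := hP t h1
    have h4 : |t| * |F 1| ≤ 1 * |F 1| := by gcongr
    simp only [hf]
    linarith
  set M := sSup ((fun t => |f t|) '' Icc 0 1) with hM
  have hle : ∀ t ∈ Icc (0 : ℝ) 1, |f t| ≤ M := fun t ht => le_csSup hbdd ⟨t, ht, rfl⟩
  have habs : ∀ t ∈ Icc (0 : ℝ) 1, |t| ≤ 1 := fun t ht => by rw [abs_of_nonneg ht.1]; exact ht.2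
  have hhalf : ∀ t ∈ Icc (0 : ℝ) (1 / 2), |f t| ≤ M / 2 + K / 2 := by
    intro t ht
    have h1 : t ∈ Icc (0 : ℝ) 1 := ⟨ht.1, by linarith [ht.2]⟩
    have h2 : t + t ∈ Icc (0 : ℝ) 1 := ⟨by linarith [ht.1], by linarith [ht.2]⟩
    have h3 := abs_le.1 (hadd t t (habs t h1) (habs t h1) (habs _ h2))
    have h4 := abs_le.1 (hle _ h2)
    rw [abs_le]
    constructor <;> linarith [h3.1, h3.2, h4.1, h4.2]
  have hall : ∀ t ∈ Icc (0 : ℝ) 1, |f t| ≤ M / 2 + 3 * K / 2 := by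
    intro t ht
    have hK : 0 ≤ K := (abs_nonneg _).trans (hadd 0 0 (by simp) (by simp) (by simp))
    rcases le_total t (1 / 2) with h | h
    · have := hhalf t ⟨ht.1, h⟩
      linarith
    · have h1 : 1 - t ∈ Icc (0 : ℝ) (1 / 2) := ⟨by linarith [ht.2], by linarith⟩
      have h2 := abs_le.1 (hhalf _ h1)
      have h3 := hadd t (1 - t) (habs t ht) (habs _ ⟨h1.1, by linarith [h1.2]⟩) (by simp)
      rw [add_sub_cancel, hf1] at h3
      have h3 := abs_le.1 h3
      rw [abs_le]
      constructor <;> linarith [h3.1, h3.2, h2.1, h2.2]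
  have hM3 : M ≤ 3 * K := by
    have : M ≤ M / 2 + 3 * K / 2 := by
      refine csSup_le ⟨_, ⟨0, by simp, rfl⟩⟩ ?_
      rintro _ ⟨t, ht, rfl⟩
      exact hall t ht
    linarith
  have hK : 0 ≤ K := (abs_nonneg _).trans (hadd 0 0 (by simp) (by simp) (by simp))
  rcases le_total 0 t with h | h
  · have := hle t ⟨h, (le_abs_self t).trans ht⟩
    linarith
  · have h1 : -t ∈ Icc (0 : ℝ) 1 := ⟨by linarith, (neg_le_abs t).trans ht⟩
    have h2 := abs_le.1 (hle _ h1)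
    have h3 := abs_le.1 (hadd (-t) t (by simpa using ht) ht (by simp))
    have h4 := hadd 0 0 (by simp) (by simp) (by simp)
    rw [neg_add_cancel] at h3
    simp only [add_zero, sub_self, zero_sub, abs_neg] at h4
    have h4 := abs_le.1 h4
    change |f t| ≤ _
    rw [abs_le]
    constructor <;> linarith [h3.1, h3.2, h4.1, h4.2, h2.1, h2.2]

/-- A bounded, approximately additive function on the cube `[-1, 1]^n` is close to a linear one. -/
lemma abs_sub_sum_le_of_approx_additive {n : ℕ} {F : (Fin n → ℝ) → ℝ} {K P : ℝ}
    (hP : ∀ t, ‖t‖ ≤ 1 → |F t| ≤ P)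
    (hF : ∀ s t, ‖s‖ ≤ 1 → ‖t‖ ≤ 1 → ‖s + t‖ ≤ 1 → |F (s + t) - F s - F t| ≤ K)
    {t : Fin n → ℝ} (ht : ‖t‖ ≤ 1) :
    |F t - ∑ i, t i * F (Pi.single i 1)| ≤ (6 * n + 1) * K := by
  have hti : ∀ i, |t i| ≤ 1 := fun i => (norm_le_pi_norm t i).trans ht
  have hK : 0 ≤ K := (abs_nonneg _).trans (hF 0 0 (by simp) (by simp) (by simp))
  have key : ∀ s : Finset (Fin n),
      |F (fun i => if i ∈ s then t i else 0) - ∑ i ∈ s, t i * F (Pi.single i 1)| ≤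
        (6 * s.card + 1) * K := by
    intro s
    induction s using Finset.induction_on with
    | empty =>
      have h := hF 0 0 (by simp) (by simp) (by simp)
      simp only [add_zero, sub_self, zero_sub, abs_neg] at h
      simpa [← Pi.zero_def] using h
    | insert j s hj ih =>
      have hn : ∀ s : Finset (Fin n), ‖fun i => if i ∈ s then t i else 0‖ ≤ 1 := fun s =>
        (pi_norm_le_iff_of_nonneg zero_le_one).2 fun i => by
          by_cases hi : i ∈ s <;> simp [hi, hti i]
      have hs : ∀ c : ℝ, |c| ≤ 1 → ‖(Pi.single j c : Fin n → ℝ)‖ ≤ 1 := fun c hc => by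
        rw [Pi.norm_single]; exact hc
      have e : (fun i => if i ∈ insert j s then t i else 0) =
          (fun i => if i ∈ s then t i else 0) + Pi.single j (t j) := by
        ext i
        by_cases hi : i = j
        · subst hi; simp [hj]
        · simp [hi]
      have h1 := hF _ _ (hn s) (hs _ (hti j)) (e ▸ hn (insert j s))
      rw [← e] at h1
      have h2 := abs_sub_mul_le_of_approx_additive (F := fun c => F (Pi.single j c))
        (fun c hc => hP _ (hs c hc)) (K := K) (fun c d hc hd hcd => by
          rw [Pi.single_add]
          exact hF _ _ (hs c hc) (hs d hd) (by rw [← Pi.single_add]; exact hs _ hcd)) (hti j)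
      rw [Finset.sum_insert hj, Finset.card_insert_of_notMem hj]
      push_cast
      have h1 := abs_le.1 h1
      have h2 := abs_le.1 h2
      have ih := abs_le.1 ih
      rw [abs_le]
      constructor <;> linarith [h1.1, h1.2, h2.1, h2.2, ih.1, ih.2]
  simpa using key Finset.univ

section

variable {E : Type*} [NormedAddCommGroup E] [NormedSpace ℝ E] [FiniteDimensional ℝ E]

/-- An approximate Auerbach basis: a bounded spanning set `W` contains a basis in which
the coordinates of points of `W` are at most `2`. -/
lemma exists_basis_repr_le {W : Set E} (hW : Bornology.IsBounded W)
    (hspan : Submodule.span ℝ W = ⊤) :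
    ∃ e : Module.Basis (Fin (Module.finrank ℝ E)) ℝ E, (∀ i, e i ∈ W) ∧
      ∀ w ∈ W, ∀ i, |e.repr w i| ≤ 2 := by
  obtain ⟨b₀⟩ : Nonempty (Module.Basis (Fin (Module.finrank ℝ E)) ℝ E) := ⟨Module.finBasis ℝ E⟩
  set T := {r : ℝ | ∃ v : Fin (Module.finrank ℝ E) → E, (∀ i, v i ∈ W) ∧ r = |b₀.det v|} with hT
  have hTb : BddAbove T := by
    obtain ⟨R, hR⟩ := hW.exists_norm_le
    obtain ⟨M, hM⟩ : ∃ M, ∀ v : Fin (Module.finrank ℝ E) → E, (∀ i, ‖v i‖ ≤ R) →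
        |b₀.det v| ≤ M := by
      have hc : IsCompact (Set.pi univ fun _ : Fin (Module.finrank ℝ E) =>
          Metric.closedBall (0 : E) R) :=
        isCompact_univ_pi fun _ => isCompact_closedBall _ _
      have hcont : Continuous fun v : Fin (Module.finrank ℝ E) → E => b₀.det v := by
        simp_rw [Module.Basis.det_apply]
        refine Continuous.matrix_det (continuous_matrix fun i j => ?_)
        simp only [Module.Basis.toMatrix_apply]
        exact (LinearMap.continuous_of_finiteDimensional (b₀.coord i)).comp (continuous_apply j)
      obtain ⟨M, hM⟩ := hc.exists_bound_of_continuousOn hcont.continuousOn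
      exact ⟨M, fun v hv => hM v fun i _ => by simpa using hv i⟩
    refine ⟨M, ?_⟩
    rintro _ ⟨v, hv, rfl⟩
    exact hM v fun i => hR _ (hv i)
  obtain ⟨v₀, hv₀, hd₀⟩ : ∃ v : Fin (Module.finrank ℝ E) → E, (∀ i, v i ∈ W) ∧ b₀.det v ≠ 0 := by
    obtain ⟨e, he⟩ : ∃ e : Module.Basis (Fin (Module.finrank ℝ E)) ℝ E, ∀ i, e i ∈ W := by
      set b := Module.Basis.ofSpan hspan.ge
      refine ⟨b.reindex (b.indexEquiv b₀), fun i => ?_⟩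
      rw [Module.Basis.reindex_apply]
      exact Module.Basis.ofSpan_subset hspan.ge ⟨_, rfl⟩
    exact ⟨e, he, (Module.Basis.isUnit_det b₀ e).ne_zero⟩
  have hpos : 0 < sSup T := (abs_pos.2 hd₀).trans_le (le_csSup hTb ⟨v₀, hv₀, rfl⟩)
  obtain ⟨_, ⟨v, hv, rfl⟩, hlt⟩ := exists_lt_of_lt_csSup (s := T) ⟨_, v₀, hv₀, rfl⟩
    (half_lt_self hpos)
  have hd : b₀.det v ≠ 0 := fun h => by simp [h] at hlt; linarith
  have hli := (Module.Basis.is_basis_iff_det b₀).2 (isUnit_iff_ne_zero.2 hd)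
  refine ⟨Module.Basis.mk hli.1 hli.2.ge, fun i => by simpa using hv i, fun w hw i => ?_⟩
  set e := Module.Basis.mk hli.1 hli.2.ge with he
  have hev : ⇑e = v := by simp [he]
  have h1 : b₀.det (Function.update v i w) = e.repr w i * b₀.det v := by
    have : b₀.det.toMultilinearMap.toLinearMap v i = b₀.det v • e.coord i := by
      refine e.ext fun j => ?_
      rw [hev]
      by_cases hj : j = i
      · subst hj
        simp [← hev]
      · have := b₀.det.map_update_self v (i := i) (j := j) (Ne.symm hj)
        simp [← hev, Finsupp.single_eq_of_ne (Ne.symm hj)] at this ⊢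
        exact this
    have := congrArg (fun f => f w) this
    simpa [mul_comm] using this
  have h2 : |b₀.det (Function.update v i w)| ≤ sSup T := by
    refine le_csSup hTb ⟨_, fun j => ?_, rfl⟩
    by_cases hj : j = i
    · subst hj; simpa using hw
    · simpa [hj] using hv j
  rw [h1, abs_mul] at h2
  by_contra! h3
  have := abs_pos.2 hd
  nlinarith
end

section

set_option linter.unusedSectionVars false

variable {E : Type*} [NormedAddCommGroup E] [NormedSpace ℝ E] [FiniteDimensional ℝ E]
    [MeasurableSpace E] [BorelSpace E] {μ : Measure E} [μ.IsAddHaarMeasure] {C D : Set E} {N : ℕ}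

/-- If `D` is a large part of `C` then there is a point of `C` that is mapped into `D` by
each of a given small number of homotheties of `C` into `C`. -/
lemma exists_forall_homothety_mem
    (hμ : ((2 * N + 4 : ℕ) : ℝ≥0∞) * ((N ^ Module.finrank ℝ E : ℕ) * μ (C \ D)) < μ C) (hN : N ≠ 0)
    (s : Finset (ℝ × E)) (hs : s.card ≤ 2 * N + 4) (hc : ∀ r ∈ s, 1 / (N : ℝ) ≤ r.1)
    (hmaps : ∀ r ∈ s, ∀ y ∈ C, r.1 • y + r.2 ∈ C) : ∃ y ∈ C, ∀ r ∈ s, r.1 • y + r.2 ∈ D := by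
  by_contra! hcon
  have hN0 : (0 : ℝ) < N := by positivity
  have hsub : C ⊆ ⋃ r ∈ s, (fun y => r.1 • y + r.2) ⁻¹' (C \ D) := by
    intro y hy
    obtain ⟨r, hr, hrD⟩ := hcon y hy
    simp only [mem_iUnion]
    exact ⟨r, hr, hmaps r hr y hy, hrD⟩
  refine hμ.not_ge ((measure_mono hsub).trans ((measure_biUnion_finset_le _ _).trans ?_))
  have hle : ∀ r ∈ s, μ ((fun y => r.1 • y + r.2) ⁻¹' (C \ D)) ≤
      (N ^ Module.finrank ℝ E : ℕ) * μ (C \ D) := by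
    intro r hr
    have h0 : 0 < r.1 := (one_div_pos.2 hN0).trans_le (hc r hr)
    have e : (fun y => r.1 • y + r.2) ⁻¹' (C \ D) =
        (r.1 • ·) ⁻¹' ((· + r.2) ⁻¹' (C \ D)) := rfl
    rw [e, Measure.addHaar_preimage_smul μ h0.ne', measure_preimage_add_right]
    gcongr
    rw [← ENNReal.ofReal_natCast]
    refine ENNReal.ofReal_le_ofReal ?_
    rw [abs_of_pos (by positivity), ← inv_pow]
    push_cast
    gcongr
    rw [inv_le_comm₀ h0 hN0]
    simpa using hc r hr
  calc _ ≤ ∑ _r ∈ s, (N ^ Module.finrank ℝ E : ℕ) * μ (C \ D) := Finset.sum_le_sum hle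
    _ = s.card * ((N ^ Module.finrank ℝ E : ℕ) * μ (C \ D)) := by
      rw [Finset.sum_const, nsmul_eq_mul]
    _ ≤ _ := by
      gcongr

/-- A function with small increments on a large part of a convex set is almost constant. -/
lemma abs_sub_le_of_increment_le (hC : Convex ℝ C) (hDC : D ⊆ C)
    (hμ : ((2 * N + 4 : ℕ) : ℝ≥0∞) * ((N ^ Module.finrank ℝ E : ℕ) * μ (C \ D)) < μ C) (hN : N ≠ 0)
    {f : E → ℝ} {K : ℝ} (hf : ∀ x ∈ D, ∀ c₁ ∈ C, ∀ c₂ ∈ C, x + (1 / N : ℝ) • (c₁ - c₂) ∈ D →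
      |f (x + (1 / N : ℝ) • (c₁ - c₂)) - f x| ≤ K) {x x' : E} (hx : x ∈ D) (hx' : x' ∈ D) :
    |f x - f x'| ≤ 2 * N * K := by
  classical
  have hN0 : (0 : ℝ) < N := by positivity
  set g : E → ℕ → ℝ × E := fun z k => (((k + 1 : ℕ) : ℝ) / N, (1 - ((k + 1 : ℕ) : ℝ) / N) • z)
    with hg
  have hk : ∀ k ∈ Finset.range N, ((k + 1 : ℕ) : ℝ) / N ≤ 1 := fun k hk => by
    rw [div_le_one hN0]
    exact_mod_cast Finset.mem_range.1 hk
  obtain ⟨y, hyC, hy⟩ := exists_forall_homothety_mem hμ hN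
    ((Finset.range N).image (g x) ∪ (Finset.range N).image (g x')) (by
      refine (Finset.card_union_le _ _).trans ?_
      have h1 := Finset.card_image_le (s := Finset.range N) (f := g x)
      have h2 := Finset.card_image_le (s := Finset.range N) (f := g x')
      rw [Finset.card_range] at h1 h2
      omega) (by
      intro r hr
      have : ∀ k : ℕ, 1 / (N : ℝ) ≤ ((k + 1 : ℕ) : ℝ) / N := fun k => by
        gcongr
        push_cast
        linarith [(Nat.cast_nonneg k : (0 : ℝ) ≤ k)]
      rcases Finset.mem_union.1 hr with h | h <;> obtain ⟨k, -, rfl⟩ := Finset.mem_image.1 h <;>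
        exact this k) (by
      intro r hr y hy
      rcases Finset.mem_union.1 hr with h | h <;> obtain ⟨k, hkN, rfl⟩ := Finset.mem_image.1 h <;>
        simp only [hg]
      · exact hC hy (hDC hx) (by positivity) (sub_nonneg.2 (hk k hkN)) (by ring)
      · exact hC hy (hDC hx') (by positivity) (sub_nonneg.2 (hk k hkN)) (by ring))
  have key : ∀ z ∈ D, (∀ k ∈ Finset.range N, (g z k).1 • y + (g z k).2 ∈ D) →
      |f y - f z| ≤ N * K := by
    intro z hz hzk
    have hmem : ∀ k ≤ N, ((k : ℝ) / N) • y + (1 - (k : ℝ) / N) • z ∈ D := by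
      intro k hkN
      rcases k with _ | k
      · simpa using hz
      · exact hzk k (Finset.mem_range.2 hkN)
    have ind : ∀ k ≤ N, |f (((k : ℝ) / N) • y + (1 - (k : ℝ) / N) • z) - f z| ≤ k * K := by
      intro k
      induction k with
      | zero => intro _; simp
      | succ k ih =>
        intro hkN
        have e : (((k + 1 : ℕ) : ℝ) / N) • y + (1 - ((k + 1 : ℕ) : ℝ) / N) • z =
            (((k : ℝ) / N) • y + (1 - (k : ℝ) / N) • z) + (1 / N : ℝ) • (y - z) := by
          push_cast
          module
        have h1 := hf _ (hmem k (by omega)) y hyC z (hDC hz) (e ▸ hmem _ hkN)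
        rw [← e] at h1
        have h1 := abs_le.1 h1
        have h2 := abs_le.1 (ih (by omega))
        push_cast at h1 h2 ⊢
        rw [abs_le]
        constructor <;> linarith [h1.1, h1.2, h2.1, h2.2]
    have := ind N le_rfl
    rwa [div_self hN0.ne', one_smul, sub_self, zero_smul, add_zero] at this
  have h1 := abs_le.1 (key x hx fun k hk =>
    hy _ (Finset.mem_union_left _ (Finset.mem_image_of_mem _ hk)))
  have h2 := abs_le.1 (key x' hx' fun k hk =>
    hy _ (Finset.mem_union_right _ (Finset.mem_image_of_mem _ hk)))
  rw [abs_le]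
  constructor <;> linarith [h1.1, h1.2, h2.1, h2.2]

variable {τ a b K : ℝ} {p q : E → ℝ}

/-- Approximate increments of `p` do not depend on the base point. -/
lemma abs_increment_sub_increment_le (hC : Convex ℝ C) (hDC : D ⊆ C)
    (hμ : ((2 * N + 4 : ℕ) : ℝ≥0∞) * ((N ^ Module.finrank ℝ E : ℕ) * μ (C \ D)) < μ C)
    (hτ : 0 < τ) (hNτ : 2 / τ ≤ N) (ha : τ ≤ a) (hb : τ ≤ b) (hab : a + b = 1)
    (hpq : ∀ x ∈ D, ∀ y ∈ D, a • x + b • y ∈ D →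
      |a * p x + b * q y - (a * p (a • x + b • y) + b * q (a • x + b • y))| ≤ K)
    {σ : ℝ} (hσ : 0 ≤ σ) (hστ : σ ≤ τ / 2) {c₁ c₂ : E} (hc₁ : c₁ ∈ C) (hc₂ : c₂ ∈ C) {x y : E}
    (hx : x ∈ D) (hx' : x + σ • (c₁ - c₂) ∈ D) (hy : y ∈ D) (hy' : y + σ • (c₁ - c₂) ∈ D) :
    |(p (x + σ • (c₁ - c₂)) - p x) - (p (y + σ • (c₁ - c₂)) - p y)| ≤ 4 * K / τ := by
  classical
  have hN0 : (0 : ℝ) < N := (by positivity : 0 < 2 / τ).trans_le hNτ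
  have hN : N ≠ 0 := by rintro rfl; simp at hN0
  have hb0 : 0 < b := hτ.trans_le hb
  have ha0 : 0 < a := hτ.trans_le ha
  have hNτ' : 1 / (N : ℝ) ≤ τ / 2 := by
    rw [div_le_iff₀ hN0]
    rw [div_le_iff₀ hτ] at hNτ
    linarith
  set s : ℝ := a * σ / b with hs
  have hbs : b * s = a * σ := by rw [hs]; field_simp
  have hs0 : 0 ≤ s := by positivity
  have hs1 : s ≤ 1 / 2 := by
    rw [hs, div_le_iff₀ hb0]
    nlinarith
  obtain ⟨c, hc, hall⟩ := exists_forall_homothety_mem hμ hN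
    {(1 - s, s • c₁), (1 - s, s • c₂), (b * (1 - s), a • x + (b * s) • c₁),
      (b * (1 - s), a • y + (b * s) • c₁)} (Finset.card_le_four.trans (by omega)) (by
      simp only [Finset.mem_insert, Finset.mem_singleton, forall_eq_or_imp, forall_eq]
      refine ⟨?_, ?_, ?_, ?_⟩ <;> nlinarith) (by
      simp only [Finset.mem_insert, Finset.mem_singleton, forall_eq_or_imp, forall_eq]
      have h1 : ∀ c ∈ C, (1 - s) • c + s • c₁ ∈ C := fun c hc =>
        hC hc hc₁ (by linarith) hs0 (by ring)
      have h3 : ∀ z ∈ D, ∀ c ∈ C, (b * (1 - s)) • c + (a • z + (b * s) • c₁) ∈ C := by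
        intro z hz c hc
        convert hC (hDC hz) (h1 c hc) ha0.le hb0.le hab using 1
        module
      exact ⟨h1, fun c hc => hC hc hc₂ (by linarith) hs0 (by ring), h3 x hx, h3 y hy⟩)
  simp only [Finset.mem_insert, Finset.mem_singleton, forall_eq_or_imp, forall_eq] at hall
  obtain ⟨h1, h2, h3, h4⟩ := hall
  have e : ∀ z : E, a • (z + σ • (c₁ - c₂)) + b • ((1 - s) • c + s • c₂) =
      a • z + b • ((1 - s) • c + s • c₁) := by
    intro z
    have : a • (z + σ • (c₁ - c₂)) = a • z + (b * s) • (c₁ - c₂) := by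
      rw [hbs]; module
    rw [this]; module
  have key : ∀ z ∈ D, z + σ • (c₁ - c₂) ∈ D →
      (b * (1 - s)) • c + (a • z + (b * s) • c₁) ∈ D →
      |a * (p (z + σ • (c₁ - c₂)) - p z) -
        b * (q ((1 - s) • c + s • c₁) - q ((1 - s) • c + s • c₂))| ≤ 2 * K := by
    intro z hz hz' hzD
    have e' : (b * (1 - s)) • c + (a • z + (b * s) • c₁) =
        a • z + b • ((1 - s) • c + s • c₁) := by module
    rw [e'] at hzD
    have k1 := abs_le.1 (hpq z hz _ h1 hzD)
    have k2 := hpq _ hz' _ h2 (by rwa [e])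
    rw [e] at k2
    have k2 := abs_le.1 k2
    rw [abs_le]
    constructor <;> linarith [k1.1, k1.2, k2.1, k2.2]
  have k1 := abs_le.1 (key x hx hx' h3)
  have k2 := abs_le.1 (key y hy hy' h4)
  have k3 : a * |(p (x + σ • (c₁ - c₂)) - p x) - (p (y + σ • (c₁ - c₂)) - p y)| ≤ 4 * K := by
    rw [← abs_of_pos ha0, ← abs_mul, abs_le]
    constructor <;> linarith [k1.1, k1.2, k2.1, k2.2]
  rw [le_div_iff₀ hτ]
  nlinarith [abs_nonneg ((p (x + σ • (c₁ - c₂)) - p x) - (p (y + σ • (c₁ - c₂)) - p y))]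

/-- A large part of a convex set contains the vertices of a translate of a given small triangle. -/
lemma exists_add_mem_add_mem (hC : Convex ℝ C)
    (hμ : ((2 * N + 4 : ℕ) : ℝ≥0∞) * ((N ^ Module.finrank ℝ E : ℕ) * μ (C \ D)) < μ C)
    (hN : 2 ≤ N) {σ : ℝ} (hσ : 0 ≤ σ) (hσ4 : σ ≤ 1 / 4) {c₁ c₂ c₃ c₄ : E} (hc₁ : c₁ ∈ C)
    (hc₂ : c₂ ∈ C) (hc₃ : c₃ ∈ C) (hc₄ : c₄ ∈ C) :
    ∃ x ∈ D, x + σ • (c₁ - c₂) ∈ D ∧ x + σ • (c₃ - c₄) ∈ D := by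
  classical
  have hmem : ∀ u ∈ C, ∀ v ∈ C, ∀ c ∈ C, (1 - 2 * σ) • c + (σ • u + σ • v) ∈ C := by
    intro u hu v hv c hc
    have h1 : (1 / 2 : ℝ) • u + (1 / 2 : ℝ) • v ∈ C :=
      hC hu hv (by norm_num) (by norm_num) (by norm_num)
    convert hC hc h1 (by linarith : 0 ≤ 1 - 2 * σ) (by linarith : 0 ≤ 2 * σ) (by ring) using 1
    module
  have hN' : 1 / (N : ℝ) ≤ 1 / 2 := by
    gcongr
    exact_mod_cast hN
  obtain ⟨c, hc, hall⟩ := exists_forall_homothety_mem hμ (by omega)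
    {(1 - 2 * σ, σ • c₂ + σ • c₄), (1 - 2 * σ, σ • c₁ + σ • c₄), (1 - 2 * σ, σ • c₃ + σ • c₂)}
    (Finset.card_le_three.trans (by omega)) (by
      simp only [Finset.mem_insert, Finset.mem_singleton, forall_eq_or_imp, forall_eq]
      refine ⟨?_, ?_, ?_⟩ <;> linarith) (by
      simp only [Finset.mem_insert, Finset.mem_singleton, forall_eq_or_imp, forall_eq]
      exact ⟨hmem _ hc₂ _ hc₄, hmem _ hc₁ _ hc₄, hmem _ hc₃ _ hc₂⟩)
  simp only [Finset.mem_insert, Finset.mem_singleton, forall_eq_or_imp, forall_eq] at hall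
  obtain ⟨h1, h2, h3⟩ := hall
  refine ⟨_, h1, ?_, ?_⟩
  · convert h2 using 1
    module
  · convert h3 using 1
    module

end

section

set_option linter.unusedSectionVars false

variable {E : Type*} [NormedAddCommGroup E] [NormedSpace ℝ E] [FiniteDimensional ℝ E]
    [MeasurableSpace E] [BorelSpace E] {μ : Measure E} [μ.IsAddHaarMeasure] {C D : Set E} {N : ℕ}
    {τ a b K : ℝ} {p q : E → ℝ}

lemma span_sub_eq_top (hμ : μ C ≠ 0) : Submodule.span ℝ (C - C) = ⊤ := by
  by_contra h
  obtain ⟨c, hc⟩ := nonempty_of_measure_ne_zero hμ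
  refine hμ (measure_mono_null (t := (· + (-c)) ⁻¹' (Submodule.span ℝ (C - C) : Set E)) ?_ ?_)
  · intro x hx
    rw [mem_preimage, ← sub_eq_add_neg]
    exact Submodule.subset_span (sub_mem_sub hx hc)
  · rw [measure_preimage_add_right]
    exact Measure.addHaar_submodule μ _ h

/-- On a large part of a convex set, `p` has linear increments up to a bounded error. -/
lemma exists_linear_increment (hn : Module.finrank ℝ E ≠ 0) (hC : Convex ℝ C)
    (hCb : Bornology.IsBounded C) (hDC : D ⊆ C)
    (hμ : ((2 * N + 4 : ℕ) : ℝ≥0∞) * ((N ^ Module.finrank ℝ E : ℕ) * μ (C \ D)) < μ C)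
    (hτ : 0 < τ) (hNτ : 8 * Module.finrank ℝ E / τ ≤ N) (ha : τ ≤ a) (hb : τ ≤ b) (hab : a + b = 1)
    (hpq : ∀ x ∈ D, ∀ y ∈ D, a • x + b • y ∈ D →
      |a * p x + b * q y - (a * p (a • x + b • y) + b * q (a • x + b • y))| ≤ K)
    {P : ℝ} (hP : ∀ x ∈ D, |p x| ≤ P) :
    ∃ l : E →ₗ[ℝ] ℝ, ∀ x ∈ D, ∀ c₁ ∈ C, ∀ c₂ ∈ C, x + (1 / N : ℝ) • (c₁ - c₂) ∈ D →
      |p (x + (1 / N : ℝ) • (c₁ - c₂)) - p x - l ((1 / N : ℝ) • (c₁ - c₂))| ≤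
        (72 * Module.finrank ℝ E + 16) * K / τ := by
  set n := Module.finrank ℝ E with hn'
  have hn1 : (1 : ℝ) ≤ n := by exact_mod_cast Nat.one_le_iff_ne_zero.2 hn
  have hn0 : (0 : ℝ) < n := by linarith
  have hτ1 : τ ≤ 1 / 2 := by linarith
  have hNτ2 : 2 / τ ≤ N := le_trans (by gcongr; linarith) hNτ
  have hN2 : 2 ≤ N := by
    have : (2 : ℝ) ≤ N := le_trans (by rw [le_div_iff₀ hτ]; linarith) hNτ2
    exact_mod_cast this
  have hN0 : (0 : ℝ) < N := by positivity
  have hinc : ∀ w : E, ∃ d : ℝ, ∀ c₁ ∈ C, ∀ c₂ ∈ C, w = (τ / 4) • (c₁ - c₂) → ∀ x ∈ D, x + w ∈ D →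
      |p (x + w) - p x - d| ≤ 4 * K / τ := by
    intro w
    by_cases h : ∃ x ∈ D, x + w ∈ D
    · obtain ⟨y, hy, hy'⟩ := h
      refine ⟨p (y + w) - p y, ?_⟩
      rintro c₁ hc₁ c₂ hc₂ rfl x hx hx'
      exact abs_increment_sub_increment_le hC hDC hμ hτ hNτ2 ha hb hab hpq (by positivity)
        (by linarith) hc₁ hc₂ hx hx' hy hy'
    · exact ⟨0, fun c₁ _ c₂ _ _ x hx hx' => absurd ⟨x, hx, hx'⟩ h⟩
  choose Δ hΔ using hinc
  have hex : ∀ c₁ ∈ C, ∀ c₂ ∈ C, ∀ c₃ ∈ C, ∀ c₄ ∈ C,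
      ∃ x ∈ D, x + (τ / 4) • (c₁ - c₂) ∈ D ∧ x + (τ / 4) • (c₃ - c₄) ∈ D :=
    fun c₁ h₁ c₂ h₂ c₃ h₃ c₄ h₄ =>
      exists_add_mem_add_mem hC hμ hN2 (by positivity) (by linarith) h₁ h₂ h₃ h₄
  have hbound : ∀ w ∈ C - C, |Δ ((τ / 4) • w)| ≤ 2 * P + 4 * K / τ := by
    rintro _ ⟨c₁, h₁, c₂, h₂, rfl⟩
    obtain ⟨x, hx, hx', -⟩ := hex c₁ h₁ c₂ h₂ c₁ h₁ c₂ h₂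
    have k1 := abs_le.1 (hΔ _ c₁ h₁ c₂ h₂ rfl x hx hx')
    have k2 := abs_le.1 (hP x hx)
    have k3 := abs_le.1 (hP _ hx')
    simp only
    rw [abs_le]
    constructor <;> linarith [k1.1, k1.2, k2.1, k2.2, k3.1, k3.2]
  have hadd : ∀ w ∈ C - C, ∀ w' ∈ C - C, w + w' ∈ C - C →
      |Δ ((τ / 4) • w + (τ / 4) • w') - Δ ((τ / 4) • w) - Δ ((τ / 4) • w')| ≤ 12 * K / τ := by
    rintro _ ⟨c₁, h₁, c₂, h₂, rfl⟩ _ ⟨c₅, h₅, c₆, h₆, rfl⟩ ⟨c₃, h₃, c₄, h₄, h34⟩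
    simp only at h34 ⊢
    have e : (τ / 4) • (c₁ - c₂) + (τ / 4) • (c₅ - c₆) = (τ / 4) • (c₃ - c₄) := by
      rw [h34, smul_add]
    obtain ⟨x, hx, hx', hx''⟩ := hex c₁ h₁ c₂ h₂ c₃ h₃ c₄ h₄
    have k1 := abs_le.1 (hΔ _ c₁ h₁ c₂ h₂ rfl x hx hx')
    have k2 := abs_le.1 (hΔ _ c₃ h₃ c₄ h₄ rfl x hx hx'')
    have k3 := hΔ _ c₅ h₅ c₆ h₆ rfl _ hx' (by rwa [add_assoc, e])
    rw [add_assoc, e] at k3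
    have k3 := abs_le.1 k3
    rw [e, abs_le]
    have : 12 * K / τ = 3 * (4 * K / τ) := by ring
    constructor <;> linarith [k1.1, k1.2, k2.1, k2.2, k3.1, k3.2]
  have hμC : μ C ≠ 0 := (lt_of_le_of_lt zero_le hμ).ne'
  obtain ⟨e, heW, hrepr⟩ := exists_basis_repr_le (hCb.sub hCb) (span_sub_eq_top hμC)
  have hWc : Convex ℝ (C - C) := hC.sub hC
  have hneg : ∀ w ∈ C - C, -w ∈ C - C := by
    rintro _ ⟨c₁, h₁, c₂, h₂, rfl⟩
    exact ⟨c₂, h₂, c₁, h₁, by simp⟩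
  have hball : ∀ w ∈ C - C, ∀ r : ℝ, |r| ≤ 1 → r • w ∈ C - C := by
    intro w hw r hr
    have hr := abs_le.1 hr
    convert hWc hw (hneg w hw) (by linarith : 0 ≤ (1 + r) / 2) (by linarith : 0 ≤ (1 - r) / 2)
      (by ring) using 1
    module
  set φ : (Fin n → ℝ) →ₗ[ℝ] E := (1 / n : ℝ) • (e.equivFun.symm : (Fin n → ℝ) →ₗ[ℝ] E) with hφ
  have hφt : ∀ t, φ t = ∑ i, (1 / n : ℝ) • (t i • e i) := fun t => by
    simp only [hφ, LinearMap.smul_apply, LinearEquiv.coe_coe, Module.Basis.equivFun_symm_apply,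
      Finset.smul_sum]
    rfl
  have hφW : ∀ t, ‖t‖ ≤ 1 → φ t ∈ C - C := by
    intro t ht
    rw [hφt]
    refine hWc.sum_mem (fun _ _ => by positivity) ?_ fun i _ =>
      hball _ (heW i) _ ((norm_le_pi_norm t i).trans ht)
    simp [hn0.ne']
  have hF := fun t (ht : ‖t‖ ≤ 1) =>
    abs_sub_sum_le_of_approx_additive (F := fun t => Δ ((τ / 4) • φ t))
      (fun t ht => hbound _ (hφW t ht)) (K := 12 * K / τ)
      (fun s t hs ht hst => by
        rw [map_add, smul_add]
        exact hadd _ (hφW s hs) _ (hφW t ht) (by rw [← map_add]; exact hφW _ hst)) ht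
  refine ⟨e.constr ℝ fun i => (n * (4 / τ)) * Δ ((τ / 4) • φ (Pi.single i 1)), ?_⟩
  intro x hx c₁ hc₁ c₂ hc₂ hx'
  set t : Fin n → ℝ := fun i => (n * (4 / τ) / N) * e.repr (c₁ - c₂) i with ht
  have ht1 : ‖t‖ ≤ 1 := by
    rw [pi_norm_le_iff_of_nonneg zero_le_one]
    intro i
    rw [Real.norm_eq_abs, ht, abs_mul, abs_of_nonneg (by positivity)]
    calc n * (4 / τ) / N * |e.repr (c₁ - c₂) i| ≤ n * (4 / τ) / N * 2 := by
          gcongr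
          exact hrepr _ (sub_mem_sub hc₁ hc₂) i
      _ = (8 * n / τ) / N := by ring
      _ ≤ 1 := (div_le_one hN0).2 hNτ
  have hw : (τ / 4) • φ t = (1 / N : ℝ) • (c₁ - c₂) := by
    have h1 : t = (n * (4 / τ) / N : ℝ) • e.equivFun (c₁ - c₂) := by
      ext i
      simp [ht]
    rw [h1, map_smul, hφ]
    simp only [LinearMap.smul_apply, LinearEquiv.coe_coe, LinearEquiv.symm_apply_apply, smul_smul]
    congr 1
    field_simp
  have k1 := hF t ht1
  simp only [hw] at k1
  obtain ⟨c₃, h₃, c₄, h₄, h34⟩ := hφW t ht1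
  simp only at h34
  have k2 := hΔ _ c₃ h₃ c₄ h₄ (by rw [h34, hw]) x hx hx'
  have k3 : (e.constr ℝ fun i => (n * (4 / τ)) * Δ ((τ / 4) • φ (Pi.single i 1)))
      ((1 / N : ℝ) • (c₁ - c₂)) = ∑ i, t i * Δ ((τ / 4) • φ (Pi.single i 1)) := by
    rw [Module.Basis.constr_apply_fintype]
    refine Finset.sum_congr rfl fun i _ => ?_
    simp only [ht, map_smul, Pi.smul_apply, smul_eq_mul, Module.Basis.equivFun_apply]
    ring
  rw [k3]
  have k1 := abs_le.1 k1
  have k2 := abs_le.1 k2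
  have : (72 * n + 16) * K / τ = (6 * n + 1) * (12 * K / τ) + 4 * K / τ := by ring
  rw [abs_le, this]
  constructor <;> linarith [k1.1, k1.2, k2.1, k2.2]

/-- If `p` and `q` satisfy an approximate Jensen equation on a large part of a convex set, then both
are close to affine functions with the same linear part. -/
theorem exists_linear_approx (hn : Module.finrank ℝ E ≠ 0) (hτ : 0 < τ) (K : ℝ) :
    ∃ (N : ℕ) (K' : ℝ), ∀ (μ : Measure E) [μ.IsAddHaarMeasure] (C D : Set E) (a b P : ℝ)
      (p q : E → ℝ), Convex ℝ C → Bornology.IsBounded C → D ⊆ C →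
      ((2 * N + 4 : ℕ) : ℝ≥0∞) * ((N ^ Module.finrank ℝ E : ℕ) * μ (C \ D)) < μ C →
      τ ≤ a → τ ≤ b → a + b = 1 →
      (∀ x ∈ D, ∀ y ∈ D, a • x + b • y ∈ D →
        |a * p x + b * q y - (a * p (a • x + b • y) + b * q (a • x + b • y))| ≤ K) →
      (∀ x ∈ D, |p x| ≤ P) →
      ∃ l : E →ₗ[ℝ] ℝ, ∀ x ∈ D, ∀ x' ∈ D,
        |p x - p x' - l (x - x')| ≤ K' ∧ |q x - q x' - l (x - x')| ≤ K' := by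
  classical
  obtain ⟨N, hN⟩ := exists_nat_ge (8 * Module.finrank ℝ E / τ)
  have hn1 : (1 : ℝ) ≤ Module.finrank ℝ E := by exact_mod_cast Nat.one_le_iff_ne_zero.2 hn
  have hNτ2 : 2 / τ ≤ N := le_trans (by gcongr; linarith) hN
  have hN0 : (0 : ℝ) < N := (by positivity : 0 < 2 / τ).trans_le hNτ2
  have hN00 : N ≠ 0 := by rintro rfl; simp at hN0
  set K₁ := 2 * N * ((72 * Module.finrank ℝ E + 16) * K / τ) with hK₁
  set K₂ := 2 * N * ((2 * K + K₁) / τ) with hK₂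
  refine ⟨N, max K₁ K₂, ?_⟩
  intro μ _ C D a b P p q hC hCb hDC hμ ha hb hab hpq hP
  have ha0 := hτ.trans_le ha
  have hb0 := hτ.trans_le hb
  obtain ⟨l, hl⟩ := exists_linear_increment hn hC hCb hDC hμ hτ hN ha hb hab hpq hP
  have hp : ∀ x ∈ D, ∀ x' ∈ D, |p x - p x' - l (x - x')| ≤ K₁ := by
    intro x hx x' hx'
    have := abs_sub_le_of_increment_le hC hDC hμ hN00 (f := fun x => p x - l x)
      (K := (72 * Module.finrank ℝ E + 16) * K / τ) (fun x hx c₁ h₁ c₂ h₂ hD => by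
        convert hl x hx c₁ h₁ c₂ h₂ hD using 2
        rw [map_add]
        ring) hx hx'
    convert this using 2
    rw [map_sub]
    ring
  refine ⟨l, fun x hx x' hx' => ⟨(hp x hx x' hx').trans (le_max_left _ _), ?_⟩⟩
  refine le_trans ?_ (le_max_right K₁ K₂)
  have := abs_sub_le_of_increment_le hC hDC hμ hN00 (f := fun x => q x - l x)
      (K := (2 * K + K₁) / τ) (fun y hy c₁ h₁ c₂ h₂ hD => by
    set y' := y + (1 / N : ℝ) • (c₁ - c₂) with hy'
    have hNτ' : 1 / (N : ℝ) ≤ τ / 2 := by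
      rw [div_le_iff₀ hN0]
      rw [div_le_iff₀ hτ] at hNτ2
      linarith
    set σ : ℝ := b / (a * N) with hσ
    have hσ0 : 0 ≤ σ := by positivity
    have haσ : a * σ = b * (1 / N) := by rw [hσ]; field_simp
    have hσ1 : σ ≤ 1 / 2 := by
      have h1 : a * σ ≤ τ / 2 := by
        rw [haσ]
        have : b * (1 / N) ≤ 1 * (1 / N) := by gcongr; linarith
        linarith
      nlinarith
    have hmem : ∀ v ∈ C, ∀ c ∈ C, (1 - σ) • c + σ • v ∈ C := fun v hv c hc =>
      hC hc hv (by linarith) hσ0 (by ring)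
    obtain ⟨c, hc, hall⟩ := exists_forall_homothety_mem hμ hN00
      {(1 - σ, σ • c₁), (1 - σ, σ • c₂), (a * (1 - σ), (a * σ) • c₁ + b • y)}
      (Finset.card_le_three.trans (by omega)) (by
        simp only [Finset.mem_insert, Finset.mem_singleton, forall_eq_or_imp, forall_eq]
        refine ⟨?_, ?_, ?_⟩ <;> nlinarith) (by
        simp only [Finset.mem_insert, Finset.mem_singleton, forall_eq_or_imp, forall_eq]
        refine ⟨hmem _ h₁, hmem _ h₂, fun c hc => ?_⟩
        convert hC (hmem _ h₁ _ hc) (hDC hy) ha0.le hb0.le hab using 1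
        module)
    simp only [Finset.mem_insert, Finset.mem_singleton, forall_eq_or_imp, forall_eq] at hall
    obtain ⟨k1, k2, k3⟩ := hall
    set u := (1 - σ) • c + σ • c₁ with hu
    set v := (1 - σ) • c + σ • c₂ with hv
    have e1 : (a * (1 - σ)) • c + ((a * σ) • c₁ + b • y) = a • u + b • y := by
      rw [hu]; module
    have huv : a • (u - v) = b • (y' - y) := by
      have : u - v = σ • (c₁ - c₂) := by rw [hu, hv]; module
      rw [this, hy', smul_smul, haσ, add_sub_cancel_left, smul_smul]
    have e2 : a • u + b • y = a • v + b • y' := by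
      have h3 : a • u = a • v + b • (y' - y) := by rw [← huv]; module
      rw [h3]; module
    rw [e1] at k3
    have j1 := abs_le.1 (hpq u k1 y hy k3)
    have j2 := hpq v k2 y' hD (e2 ▸ k3)
    rw [← e2] at j2
    have j2 := abs_le.1 j2
    have j3 := abs_le.1 (hp u k1 v k2)
    have j4 : a * l (u - v) = b * l (y' - y) := by
      have := congrArg l huv
      simpa using this
    have j5 : b * |q y' - q y - l (y' - y)| ≤ 2 * K + K₁ := by
      have ha1 : a ≤ 1 := by linarith
      have j6 : |a * (p u - p v - l (u - v))| ≤ 1 * K₁ := by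
        rw [abs_mul, abs_of_pos ha0]
        gcongr
        exact hp u k1 v k2
      have j6 := abs_le.1 j6
      rw [← abs_of_pos hb0, ← abs_mul, abs_le]
      constructor <;> linarith [j1.1, j1.2, j2.1, j2.2, j6.1, j6.2]
    have e3 : q y' - l y' - (q y - l y) = q y' - q y - l (y' - y) := by rw [map_sub]; ring
    rw [e3, le_div_iff₀ hτ]
    nlinarith [abs_nonneg (q y' - q y - l (y' - y))]) hx hx'
  have e : q x - q x' - l (x - x') = q x - l x - (q x' - l x') := by rw [map_sub]; ring
  rw [e]
  exact this

end

section

variable {n : ℕ} {τ δ a b η R : ℝ} {A B S : Set (Sp n)}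

lemma NearExtremal.add_right (h : NearExtremal volume τ δ a b A B S) (v : Sp n) :
    NearExtremal volume τ δ a b A ((fun z => z + v) '' B) ((fun z => z + b • v) '' S) := by
  simpa using h.image (e := ContinuousLinearEquiv.refl ℝ (Sp n)) (MeasurePreserving.id volume) 0 v

lemma fib_image_add (K : Set (Sp n)) (v : Sp n) (x : Edim n) :
    fib ((fun z => z + v) '' K) x = fib K (x - v.1) := by
  rw [image_add_right, fib_preimage_add, Prod.fst_neg, sub_eq_add_neg]

/-- Vertical structure of almost extremal sets contained in a fixed cylinder, after a
translation of the second set. -/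
theorem exists_structure_translate (n : ℕ) (hτ : 0 < τ) (hR : 0 < R) :
    ∃ c C' η0 : ℝ, 0 < c ∧ 0 < C' ∧ 0 < η0 ∧ ∀ η, 0 < η → η < η0 → ∃ δ > 0,
      ∀ (a b : ℝ) (A B S : Set (Sp n)), NearExtremal volume τ δ a b A B S →
      (∀ x ∈ A, ‖x.1‖ ≤ R) → (∀ x ∈ B, ‖x.1‖ ≤ R) →
      (∀ x, fib A x ≤ ENNReal.ofReal R) → (∀ x, fib B x ≤ ENNReal.ofReal R) →
      ∃ (v : Sp n) (C D : Set (Edim n)), Convex ℝ C ∧ C ⊆ Metric.closedBall 0 R ∧ D ⊆ C ∧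
        MeasurableSet C ∧ MeasurableSet D ∧
        ENNReal.ofReal c ≤ volume C ∧ volume C ≤ ENNReal.ofReal c⁻¹ ∧
        volume (C \ D) ≤ ENNReal.ofReal (C' * η) ∧
        volume (A ∩ Prod.fst ⁻¹' Dᶜ) ≤ ENNReal.ofReal (C' * η) ∧
        volume ((fun z => z + v) '' B ∩ Prod.fst ⁻¹' Dᶜ) ≤ ENNReal.ofReal (C' * η) ∧
        ∀ x ∈ D, ENNReal.ofReal η ≤ fib A x ∧ ENNReal.ofReal η ≤ fib ((fun z => z + v) '' B) x ∧
          fib ((fun z => z + b • v) '' S) x ≤ ENNReal.ofReal a * fib A x +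
            ENNReal.ofReal b * fib ((fun z => z + v) '' B) x + ENNReal.ofReal (η ^ 2) := by
  obtain ⟨c, C', η0, hc, hC', hη0, H⟩ := exists_structure (n := n) hτ hR
  refine ⟨c, C', η0, hc, hC', hη0, fun η hη hη' => ?_⟩
  obtain ⟨δ, hδ, H⟩ := H η hη hη'
  refine ⟨δ, hδ, fun a b A B S h hA hB hAR hBR => ?_⟩
  obtain ⟨u, C, D, hC, hCR, hDC, hCm, hDm, hcC, hCc, hCD, hAD, hBD, hD⟩ :=
    H a b A B S h hA hB hAR hBR
  have hfB : ∀ x, fib ((fun z => z + ((u, 0) : Sp n)) '' B) x = fib B (x - u) := fun x =>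
    fib_image_add B _ x
  have hfS : ∀ x, fib ((fun z => z + b • ((u, 0) : Sp n)) '' S) x = fib S (x - b • u) := fun x =>
    fib_image_add S _ x
  refine ⟨(u, 0), C, D, hC, hCR, hDC, hCm, hDm, hcC, hCc, hCD, ?_, ?_, fun x hx => ?_⟩
  · rwa [← setLIntegral_fib h.meas_A hDm.compl]
  · rw [← setLIntegral_fib (h.add_right (u, 0)).meas_B hDm.compl]
    simpa only [hfB] using hBD
  · simpa only [hfB, hfS] using hD x hx

lemma NearExtremal.abs_sub_le_of_fib (h : NearExtremal volume τ δ a b A B S) (hη : 0 < η)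
    (hητ : η < τ) (hR : 0 ≤ R) {x : Edim n} (hA : ENNReal.ofReal η ≤ fib A x)
    (hB : ENNReal.ofReal η ≤ fib B x) (hAR : fib A x ≤ ENNReal.ofReal R)
    (hBR : fib B x ≤ ENNReal.ofReal R)
    (hS : fib S x ≤ ENNReal.ofReal a * fib A x + ENNReal.ofReal b * fib B x +
      ENNReal.ofReal (η ^ 2)) {s t : ℝ} (hs : (x, s) ∈ A) (ht : (x, t) ∈ A) :
    |s - t| ≤ R / τ := by
  have hτ := h.τ_pos
  have ha := h.a_pos
  have hb := h.b_pos
  have vol : ∀ {c : ℝ} {X : Set ℝ}, 0 < c → volume (c • X) = ENNReal.ofReal c * volume X := by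
    intro c X hc
    rw [Measure.addHaar_smul, Module.finrank_self, pow_one, abs_of_pos hc]
  have lo : ∀ {c : ℝ} {X : Set ℝ}, τ ≤ c → ENNReal.ofReal η ≤ volume X →
      ENNReal.ofReal (τ * η) ≤ volume (c • X) := by
    intro c X hc hX
    rw [vol (hτ.trans_le hc), ENNReal.ofReal_mul hτ.le]
    gcongr
  have hi : ∀ {c : ℝ} {X : Set ℝ}, 0 < c → volume X ≤ ENNReal.ofReal R →
      volume (c • X) ≤ ENNReal.ofReal (c * R) := by
    intro c X hc hX
    rw [vol hc, ENNReal.ofReal_mul hc.le]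
    gcongr
  have hA0 := lo h.le_a hA
  have hB0 := lo h.le_b hB
  have hA1 := hi ha hAR
  have hB1 := hi hb hBR
  have hpos : 0 < ENNReal.ofReal (τ * η) := ENNReal.ofReal_pos.2 (by positivity)
  have key := dist_le_of_volume_lt ((measurableSet_vslice h.meas_A x).const_smul₀ a)
    ((measurableSet_vslice h.meas_B x).const_smul₀ b) (hpos.trans_le hA0).ne'
    (hpos.trans_le hB0).ne' (S := vslice S x)
    (by
      rintro _ ⟨s, hs, rfl⟩ _ ⟨t, ht, rfl⟩
      have := h.combo (x, s) hs (x, t) ht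
      rw [Prod.smul_mk, Prod.smul_mk, Prod.mk_add_mk, ← add_smul, h.add_eq, one_smul] at this
      exact this)
    (by
      refine lt_of_le_of_lt hS ?_
      rw [vol ha, vol hb]
      refine ENNReal.add_lt_add_left ?_ ?_
      · exact ((add_le_add (mul_le_mul_right hAR _) (mul_le_mul_right hBR _)).trans_lt
          (by finiteness)).ne
      · refine lt_of_lt_of_le ?_ (le_min (hA0.trans_eq (vol ha)) (hB0.trans_eq (vol hb)))
        rw [ENNReal.ofReal_lt_ofReal_iff (by positivity), sq]
        gcongr)
    (smul_mem_smul_set (show s ∈ vslice A x from hs)) (smul_mem_smul_set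
    (show t ∈ vslice A x from ht))
  have := key.trans (add_le_add hA1 hB1)
  rw [← ENNReal.ofReal_add (by positivity) (by positivity),
    ENNReal.ofReal_le_ofReal_iff (by positivity), ← smul_sub, smul_eq_mul, abs_mul,
    abs_of_pos ha, ← add_mul, h.add_eq, one_mul] at this
  rw [le_div_iff₀ hτ, mul_comm]
  exact (mul_le_mul_of_nonneg_right h.le_a (abs_nonneg _)).trans this

lemma NearExtremal.abs_combo_sub_le (h : NearExtremal volume τ δ a b A B S) (hη : 0 < η)
    (hη1 : η < 1) {p q r s K : ℝ} {x y : Edim n}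
    (hAx : ENNReal.ofReal η ≤ fib A x) (hBy : ENNReal.ofReal η ≤ fib B y)
    (hAz : ENNReal.ofReal η ≤ fib A (a • x + b • y))
    (hBz : ENNReal.ofReal η ≤ fib B (a • x + b • y))
    (hAR : fib A (a • x + b • y) ≤ ENNReal.ofReal R)
    (hBR : fib B (a • x + b • y) ≤ ENNReal.ofReal R)
    (hS : fib S (a • x + b • y) ≤ ENNReal.ofReal a * fib A (a • x + b • y) +
      ENNReal.ofReal b * fib B (a • x + b • y) + ENNReal.ofReal (η ^ 2))
    (hp : ∀ t, (x, t) ∈ A → |t - p| ≤ K) (hq : ∀ t, (y, t) ∈ B → |t - q| ≤ K)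
    (hr : ∀ t, (a • x + b • y, t) ∈ A → |t - r| ≤ K)
    (hs : ∀ t, (a • x + b • y, t) ∈ B → |t - s| ≤ K) :
    |a * p + b * q - (a * r + b * s)| ≤ 2 * K := by
  have ha := h.a_pos
  have hb := h.b_pos
  have hab := h.add_eq
  set z := a • x + b • y with hz
  have hη' : ENNReal.ofReal η ≠ 0 := by simpa using hη
  by_contra! hlt
  set I := Metric.closedBall (a * r + b * s) K with hI
  have hIm : MeasurableSet I := Metric.isClosed_closedBall.measurableSet
  have mem : ∀ t u p' q' : ℝ, |t - p'| ≤ K → |u - q'| ≤ K →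
      |a * t + b * u - (a * p' + b * q')| ≤ K := by
    intro t u p' q' ht hu
    have ht := abs_le.1 ht
    have hu := abs_le.1 hu
    rw [abs_le]
    constructor <;> nlinarith [ht.1, ht.2, hu.1, hu.2]
  have ne : ∀ {X : Set (Sp n)} {w : Edim n}, ENNReal.ofReal η ≤ fib X w → (vslice X w).Nonempty :=
    fun hX => nonempty_of_measure_ne_zero
      (lt_of_lt_of_le (pos_iff_ne_zero.2 hη') hX).ne'
  have h1 : ENNReal.ofReal a * fib A z + ENNReal.ofReal b * fib B z ≤ volume (vslice S z ∩ I) := by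
    refine volume_combo_ge (measurableSet_vslice h.meas_A z) (measurableSet_vslice h.meas_B z)
      (ne hAz) (ne hBz) ha.le hb.le fun t ht u hu => ⟨?_, ?_⟩
    · have := h.combo (z, t) ht (z, u) hu
      rw [Prod.smul_mk, Prod.smul_mk, Prod.mk_add_mk, ← add_smul, hab, one_smul] at this
      exact this
    · rw [hI, Metric.mem_closedBall, Real.dist_eq]
      exact mem _ _ _ _ (hr t ht) (hs u hu)
  have h2 : ENNReal.ofReal a * fib A x + ENNReal.ofReal b * fib B y ≤ volume (vslice S z \ I) := by
    refine volume_combo_ge (measurableSet_vslice h.meas_A x) (measurableSet_vslice h.meas_B y)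
      (ne hAx) (ne hBy) ha.le hb.le fun t ht u hu => ⟨h.combo (x, t) ht (y, u) hu, ?_⟩
    rw [hI, Metric.mem_closedBall, Real.dist_eq]
    intro hle
    have := abs_sub_le (a * p + b * q) (a * t + b * u) (a * r + b * s)
    rw [abs_sub_comm (a * p + b * q) (a * t + b * u)] at this
    linarith [mem _ _ _ _ (hp t ht) (hq u hu)]
  have h3 : ENNReal.ofReal η ≤ ENNReal.ofReal a * fib A x + ENNReal.ofReal b * fib B y := by
    calc ENNReal.ofReal η = ENNReal.ofReal a * ENNReal.ofReal η +
          ENNReal.ofReal b * ENNReal.ofReal η := by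
          rw [← add_mul, ← ENNReal.ofReal_add ha.le hb.le, hab, ENNReal.ofReal_one, one_mul]
      _ ≤ _ := by gcongr
  have hfin : ENNReal.ofReal a * fib A z + ENNReal.ofReal b * fib B z ≠ ⊤ := by
    refine (lt_of_le_of_lt (add_le_add (mul_le_mul_right hAR _) (mul_le_mul_right hBR _)) ?_).ne
    finiteness
  have h4 := ((add_le_add h1 (h3.trans h2)).trans_eq (measure_inter_add_sdiff _ hIm)).trans hS
  rw [ENNReal.add_le_add_iff_left hfin, ENNReal.ofReal_le_ofReal_iff (by positivity)] at h4
  nlinarith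

/-- The shear `(x, y) ↦ (x, y - l x)`. -/
def shear (l : Edim n →L[ℝ] ℝ) : Sp n ≃L[ℝ] Sp n :=
  (ContinuousLinearEquiv.refl ℝ (Edim n)).skewProd (ContinuousLinearEquiv.refl ℝ ℝ) (-l)

lemma shear_apply (l : Edim n →L[ℝ] ℝ) (z : Sp n) : shear l z = (z.1, z.2 - l z.1) := by
  simp [shear, sub_eq_add_neg]

lemma measurePreserving_shear (l : Edim n →L[ℝ] ℝ) :
    MeasurePreserving (shear l) (volume : Measure (Sp n)) volume := by
  rw [Measure.volume_eq_prod]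
  have : ⇑(shear l) = fun z : Sp n => (id z.1, z.2 - l z.1) := funext (shear_apply l)
  rw [this]
  refine (MeasurePreserving.id volume).skew_product (g := fun x y => y - l x) (by fun_prop) ?_
  exact Eventually.of_forall fun x => (measurePreserving_sub_right volume (l x)).map_eq

end

section

variable {n : ℕ}

/-- Mass of the part of an almost full set lying over a large set of the base. -/
lemma ofReal_le_volume_inter {A : Set (Sp n)} {D : Set (Edim n)} (hD : MeasurableSet D) {r s : ℝ}
    (hs : 0 ≤ s) (hA : ENNReal.ofReal r ≤ volume A)
    (hAD : volume (A ∩ Prod.fst ⁻¹' Dᶜ) ≤ ENNReal.ofReal s) :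
    ENNReal.ofReal (r - s) ≤ volume (A ∩ Prod.fst ⁻¹' D) := by
  rw [ENNReal.ofReal_sub _ hs, tsub_le_iff_right]
  refine hA.trans ?_
  rw [← measure_inter_add_sdiff A (measurable_fst hD)]
  exact add_le_add_right hAD _

theorem tightExtremal_prod (hn : n ≠ 0)
    (hT : ∀ (m : Measure (Edim n)) [m.IsAddHaarMeasure], TightExtremal m) :
    TightExtremal (volume : Measure (Sp n)) := by
  intro τ hτ
  obtain ⟨R₀, δ₀, hδ₀, hcyl⟩ := exists_cylinder_bound hn hT hτ
  set R := max R₀ 1 with hR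
  have hR0 : 0 < R := lt_max_of_lt_right one_pos
  obtain ⟨c, C', η₀, hc, hC', hη₀, hstr⟩ := exists_structure_translate n hτ hR0
  have hfr : Module.finrank ℝ (Edim n) = n := finrank_euclideanSpace_fin
  have hfr' : Module.finrank ℝ (Sp n) = n + 1 := by
    rw [Module.finrank_prod, hfr, Module.finrank_self]
  obtain ⟨N, K', hlin⟩ := exists_linear_approx (E := Edim n) (by rwa [hfr]) hτ (2 * (R / τ))
  set M : ℝ := ((2 * N + 4 : ℕ) : ℝ) * (N ^ n : ℕ) * C' with hM
  have hM0 : 0 ≤ M := by positivity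
  set θ := τ ^ (n + 1) with hθ
  have hθ0 : 0 < θ := by positivity
  obtain ⟨η, hη, hη'⟩ : ∃ η, 0 < η ∧
      η < min (min η₀ (min τ 1)) (min (c / (M + 1)) (θ / (8 * C'))) :=
    exists_between (by positivity)
  simp only [lt_min_iff] at hη'
  obtain ⟨⟨hηη₀, hητ, hη1⟩, hηc, hηθ⟩ := hη'
  have hηM : M * η < c := by
    rw [lt_div_iff₀ (by positivity)] at hηc
    nlinarith
  have hηθ' : C' * η ≤ θ / 8 := by
    rw [lt_div_iff₀ (by positivity)] at hηθ
    linarith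
  obtain ⟨δ₁, hδ₁, hstr⟩ := hstr η hη hηη₀
  refine ⟨2 * max R (R / τ + K') / τ, min (min δ₀ δ₁) (θ / 8), by positivity, ?_⟩
  intro a b A B S h hAb hBb
  have hτ1 : τ ≤ 1 := h.le_a.trans h.a_le_one
  obtain ⟨L, p₁, q₁, hL, hA1, hB1, hAR, hBR⟩ :=
    hcyl a b A B S (h.mono ((min_le_left _ _).trans (min_le_left _ _))) hAb hBb
  have h₁ := h.image hL p₁ q₁
  set A₁ := (fun z => L z + p₁) '' A with hA₁
  set B₁ := (fun z => L z + q₁) '' B with hB₁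
  set S₁ := (fun z => L z + (a • p₁ + b • q₁)) '' S with hS₁
  have hR₀ : R₀ ≤ R := le_max_left _ _
  have hAR' : ∀ x, fib A₁ x ≤ ENNReal.ofReal R := fun x =>
    (hAR x).trans (ENNReal.ofReal_le_ofReal hR₀)
  have hBR' : ∀ x, fib B₁ x ≤ ENNReal.ofReal R := fun x =>
    (hBR x).trans (ENNReal.ofReal_le_ofReal hR₀)
  obtain ⟨v, C, D, hC, hCR, hDC, hCm, hDm, hcC, hCc, hCD, hAD, hBD, hD⟩ :=
    hstr a b A₁ B₁ S₁ (h₁.mono ((min_le_left _ _).trans (min_le_right _ _)))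
      (by rintro _ ⟨x, hx, rfl⟩; exact (hA1 x hx).trans hR₀)
      (by rintro _ ⟨x, hx, rfl⟩; exact (hB1 x hx).trans hR₀) hAR' hBR'
  have h₂ := h₁.add_right v
  have hBR₂ : ∀ x, fib ((fun z => z + v) '' B₁) x ≤ ENNReal.ofReal R := fun x => by
    rw [fib_image_add]; exact hBR' _
  set B₂ := (fun z => z + v) '' B₁ with hB₂
  set S₂ := (fun z => z + b • v) '' S₁ with hS₂
  have hne : ∀ {X : Set (Sp n)} {x}, ENNReal.ofReal η ≤ fib X x → ∃ t, (x, t) ∈ X := fun hX =>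
    nonempty_of_measure_ne_zero (lt_of_lt_of_le (ENNReal.ofReal_pos.2 hη) hX).ne'
  have hp : ∀ x, ∃ t, x ∈ D → (x, t) ∈ A₁ := fun x => by
    by_cases hx : x ∈ D
    · exact (hne (hD x hx).1).imp fun t ht _ => ht
    · exact ⟨0, fun h => absurd h hx⟩
  have hq : ∀ x, ∃ t, x ∈ D → (x, t) ∈ B₂ := fun x => by
    by_cases hx : x ∈ D
    · exact (hne (hD x hx).2.1).imp fun t ht _ => ht
    · exact ⟨0, fun h => absurd h hx⟩
  choose p hp using hp
  choose q hq using hq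
  have hAp : ∀ x ∈ D, ∀ t, (x, t) ∈ A₁ → |t - p x| ≤ R / τ := fun x hx t ht =>
    h₂.abs_sub_le_of_fib hη hητ hR0.le (hD x hx).1 (hD x hx).2.1 (hAR' x) (hBR₂ x) (hD x hx).2.2 ht
      (hp x hx)
  have hBq : ∀ x ∈ D, ∀ t, (x, t) ∈ B₂ → |t - q x| ≤ R / τ := fun x hx t ht =>
    h₂.swap.abs_sub_le_of_fib hη hητ hR0.le (hD x hx).2.1 (hD x hx).1 (hBR₂ x) (hAR' x)
      (by rw [add_comm (ENNReal.ofReal b * _)]; exact (hD x hx).2.2) ht (hq x hx)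
  obtain ⟨P, hP⟩ : ∃ P, ∀ z ∈ A₁, ‖z‖ ≤ P := by
    obtain ⟨P, hP⟩ := hAb.exists_norm_le
    refine ⟨‖(L : Sp n →L[ℝ] Sp n)‖ * P + ‖p₁‖, ?_⟩
    rintro _ ⟨x, hx, rfl⟩
    refine (norm_add_le _ _).trans (add_le_add_left ?_ _)
    exact ((L : Sp n →L[ℝ] Sp n).le_opNorm x).trans (by gcongr; exact hP x hx)
  obtain ⟨l, hl⟩ := hlin volume C D a b P p q hC (Metric.isBounded_closedBall.subset hCR) hDC (by
      rw [hfr]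
      refine lt_of_le_of_lt ?_ ((ENNReal.ofReal_lt_ofReal_iff hc).2 hηM |>.trans_le hcC)
      have e : M * η = ((2 * N + 4 : ℕ) : ℝ) * ((N ^ n : ℕ) * (C' * η)) := by rw [hM]; ring
      rw [e, ENNReal.ofReal_mul (by positivity), ENNReal.ofReal_mul (by positivity),
        ENNReal.ofReal_natCast, ENNReal.ofReal_natCast]
      gcongr) h.le_a h.le_b h.add_eq (fun x hx y hy hz =>
      h₂.abs_combo_sub_le hη hη1 (hD x hx).1 (hD y hy).2.1 (hD _ hz).1 (hD _ hz).2.1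
        (hAR' _) (hBR₂ _)
        (hD _ hz).2.2 (hAp x hx) (hBq y hy) (hAp _ hz) (hBq _ hz))
    (fun x hx => (norm_snd_le (x, p x)).trans (hP _ (hp x hx)))
  obtain ⟨x₀, hx₀⟩ : ∃ x₀, ∀ x ∈ D,
      |p x - p x₀ - l (x - x₀)| ≤ K' ∧ |q x - q x₀ - l (x - x₀)| ≤ K' := by
    rcases D.eq_empty_or_nonempty with hD0 | ⟨x₀, h₀⟩
    · exact ⟨0, fun x hx => by simp [hD0] at hx⟩
    · exact ⟨x₀, fun x hx => hl x hx x₀ h₀⟩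
  set e := shear l.toContinuousLinearMap with he
  have hemp : MeasurePreserving e (volume : Measure (Sp n)) volume := measurePreserving_shear _
  have h₃ := h₂.image hemp (0, l x₀ - p x₀) (0, l x₀ - q x₀)
  have hball : ∀ (X : Set (Sp n)) (f : Edim n → ℝ), (∀ x ∈ D, ∀ t, (x, t) ∈ X → |t - f x| ≤ R / τ) →
      (∀ x ∈ D, |f x - f x₀ - l (x - x₀)| ≤ K') →
      ∀ z ∈ (fun z => e z + ((0, l x₀ - f x₀) : Sp n)) '' (X ∩ Prod.fst ⁻¹' D),
        ‖(ContinuousLinearMap.id ℝ (Sp n)) z‖ ≤ max R (R / τ + K') := by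
    rintro X f hX hf _ ⟨⟨x, t⟩, ⟨hxt, hx⟩, rfl⟩
    simp only [he, shear_apply, ContinuousLinearMap.id_apply, Prod.mk_add_mk, add_zero,
      LinearMap.coe_toContinuousLinearMap']
    refine norm_prod_le_iff.2 ⟨?_, ?_⟩
    · exact (mem_closedBall_zero_iff.1 (hCR (hDC hx))).trans (le_max_left _ _)
    · refine le_trans ?_ (le_max_right _ _)
      have k1 := abs_le.1 (hX x hx t hxt)
      have k2 := abs_le.1 (hf x hx)
      rw [map_sub] at k2
      rw [Real.norm_eq_abs, abs_le]
      constructor <;> simp only <;> linarith [k1.1, k1.2, k2.1, k2.2]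
  have hAball := hball A₁ p hAp fun x hx => (hx₀ x hx).1
  have hBball := hball B₂ q hBq fun x hx => (hx₀ x hx).2
  set δ := min (min δ₀ δ₁) (θ / 8) with hδ
  have hδθ : δ ≤ θ / 8 := min_le_right _ _
  have hθ1 : θ ≤ 1 := pow_le_one₀ hτ.le hτ1
  have hε : 1 - (δ + C' * η) = (1 - δ) - C' * η := by ring
  have hmass : ∀ (X : Set (Sp n)) (w : Sp n), ENNReal.ofReal (1 - δ) ≤ volume X →
      volume (X ∩ Prod.fst ⁻¹' Dᶜ) ≤ ENNReal.ofReal (C' * η) →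
      ENNReal.ofReal (1 - (δ + C' * η)) ≤
        volume ((fun z => e z + w) '' (X ∩ Prod.fst ⁻¹' D)) := by
    intro X w hX hXD
    rw [measure_image_affine hemp, hε]
    exact ofReal_le_volume_inter hDm (by positivity) hX hXD
  have hAm := hmass A₁ (0, l x₀ - p x₀) h₂.le_A hAD
  have hBm := hmass B₂ (0, l x₀ - q x₀) h₂.le_B hBD
  have hmeas : ∀ (X : Set (Sp n)) (w : Sp n), MeasurableSet X →
      MeasurableSet ((fun z => e z + w) '' (X ∩ Prod.fst ⁻¹' D)) := fun X w hX =>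
    (measurableEmbedding_affine e w).measurableSet_image.2 (hX.inter (measurable_fst hDm))
  have hfar : 1 + δ < (1 - (δ + C' * η)) * (1 + τ ^ Module.finrank ℝ (Sp n)) := by
    rw [hfr', ← hθ]
    have : (1 - θ / 4) * (1 + θ) ≤ (1 - (δ + C' * η)) * (1 + θ) := by gcongr; linarith
    nlinarith
  refine ⟨L.trans e, e p₁ + (0, l x₀ - p x₀), e (q₁ + v) + (0, l x₀ - q x₀), hemp.comp hL, ?_, ?_⟩
  · intro x hx
    have := h₃.norm_le_of_subset (ContinuousLinearMap.id ℝ (Sp n))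
      (image_mono inter_subset_left) (image_mono inter_subset_left)
      (hmeas A₁ _ h₂.meas_A) (hmeas B₂ _ h₂.meas_B) hAball hBball hAm hBm (by linarith) hfar
      (mem_image_of_mem _ (mem_image_of_mem _ hx))
    simpa [map_add, add_assoc] using this
  · intro x hx
    have := h₃.swap.norm_le_of_subset (ContinuousLinearMap.id ℝ (Sp n))
      (image_mono inter_subset_left) (image_mono inter_subset_left)
      (hmeas B₂ _ h₂.meas_B) (hmeas A₁ _ h₂.meas_A) hBball hAball hBm hAm (by linarith) hfar
      (mem_image_of_mem _ (mem_image_of_mem _ (mem_image_of_mem _ hx)))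
    simpa [map_add, add_assoc] using this

/-- Almost extremal sets are tight in every dimension. -/
theorem tightExtremal (hn : n ≠ 0) (m : Measure (Edim n)) [m.IsAddHaarMeasure] :
    TightExtremal m := by
  induction n with
  | zero => exact absurd rfl hn
  | succ k ih =>
    rcases eq_or_ne k 0 with rfl | hk
    · have e : Edim (0 + 1) ≃L[ℝ] ℝ := ContinuousLinearEquiv.ofFinrankEq (by simp)
      exact tightExtremal_real.congr m e.symm
    · have e : Edim (k + 1) ≃L[ℝ] Sp k := ContinuousLinearEquiv.ofFinrankEq (by simp)
      have : Nonempty (Fin k) := ⟨⟨0, Nat.pos_of_ne_zero hk⟩⟩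
      exact (tightExtremal_prod hk fun m _ => ih hk m).congr m e.symm

end

section

variable {n : ℕ}

/-- A property that holds, for each small `η`, for all small enough `δ` holds along a function
`η(δ)` tending to `0`. -/
lemma exists_diagonal {P : ℝ → ℝ → Prop} {η₀ : ℝ} (hη₀ : 0 < η₀)
    (h : ∀ η, 0 < η → η < η₀ → ∃ d > 0, ∀ δ, 0 < δ → δ < d → P η δ) :
    ∃ (f : ℝ → ℝ) (δ₀ : ℝ), 0 < δ₀ ∧ (∀ δ, 0 < f δ) ∧
      Tendsto f (nhdsWithin 0 (Ioi 0)) (nhds 0) ∧ ∀ δ, 0 < δ → δ < δ₀ → P (f δ) δ := by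
  classical
  set u : ℕ → ℝ := fun k => η₀ / (k + 2 : ℕ) with hu
  have hu0 : ∀ k, 0 < u k := fun k => by positivity
  have hu1 : ∀ k, u k < η₀ := fun k => div_lt_self hη₀ (by norm_cast; omega)
  have hut : Tendsto u atTop (nhds 0) :=
    (tendsto_const_div_atTop_nhds_zero_nat η₀).comp (tendsto_add_atTop_nat 2)
  choose d hd hdP using fun k => h (u k) (hu0 k) (hu1 k)
  set K : ℝ → ℕ := fun δ => Nat.findGreatest (fun k => δ < d k) ⌊δ⁻¹⌋₊ with hK
  refine ⟨u ∘ K, d 0, hd 0, fun δ => hu0 _, hut.comp ?_, fun δ hδ hδ0 => ?_⟩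
  · refine tendsto_atTop.2 fun N => ?_
    have h1 : ∀ᶠ δ in nhdsWithin (0 : ℝ) (Ioi 0), δ < d N :=
      nhdsWithin_le_nhds (eventually_lt_nhds (hd N))
    have h2 : ∀ᶠ δ in nhdsWithin (0 : ℝ) (Ioi 0), (N : ℝ) ≤ δ⁻¹ :=
      tendsto_inv_nhdsGT_zero.eventually_ge_atTop _
    filter_upwards [h1, h2] with δ h1 h2
    exact Nat.le_findGreatest (Nat.le_floor h2) h1
  · exact hdP _ _ hδ (Nat.findGreatest_spec (P := fun k => δ < d k) (Nat.zero_le _) hδ0)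

lemma innerVol_le {s s' : Set ℝ} (h : s ⊆ s') : innerVol s ≤ volume s' :=
  iSup_le fun _ => iSup_le fun hK => iSup_le fun _ => measure_mono (hK.trans h)

lemma fib_mono {A B : Set (Sp n)} (h : A ⊆ B) (x : Edim n) : fib A x ≤ fib B x :=
  measure_mono fun _ hy => h hy

lemma exists_uniform_margin {Λ : Set ℝ} (hΛc : IsCompact Λ) (hΛ : Λ ⊆ Ioo (0 : ℝ) 1) :
    ∃ τ : ℝ, 0 < τ ∧ ∀ t ∈ Λ, τ ≤ t ∧ τ ≤ 1 - t := by
  rcases Λ.eq_empty_or_nonempty with rfl | hne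
  · exact ⟨1, one_pos, by simp⟩
  · obtain ⟨s, hs, hmin⟩ := hΛc.exists_isMinOn hne
      (f := fun t : ℝ => min t (1 - t)) (by fun_prop)
    exact ⟨min s (1 - s), lt_min (hΛ hs).1 (sub_pos.2 (hΛ hs).2),
      fun t ht => le_min_iff.1 (hmin ht)⟩

/-- Passing to a compact subset of almost full measure. -/
lemma exists_isCompact_of_abs_sub_lt {A : Set (Sp n)} (hA : MeasurableSet A) {δ ε : ℝ}
    (hδ : 0 < δ) (hδ1 : δ < 1) (hε : 0 < ε) (h : |(volume A).toReal - 1| < δ) :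
    ∃ K ⊆ A, IsCompact K ∧ volume (A \ K) ≤ ENNReal.ofReal ε ∧
      ENNReal.ofReal (1 - 2 * δ) ≤ volume K ∧ volume K ≤ ENNReal.ofReal (1 + 2 * δ) := by
  rw [abs_lt] at h
  have hfin : volume A ≠ ∞ := fun h0 => by
    rw [h0, ENNReal.toReal_top] at h; linarith [h.1]
  obtain ⟨K, hKA, hK, hAK⟩ := hA.exists_isCompact_sdiff_lt hfin
    (ENNReal.ofReal_pos.2 (lt_min hδ hε)).ne'
  refine ⟨K, hKA, hK, hAK.le.trans (ENNReal.ofReal_le_ofReal (min_le_right _ _)), ?_, ?_⟩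
  · have h1 : 1 - 2 * δ = (1 - δ) - δ := by ring
    rw [h1, ENNReal.ofReal_sub _ hδ.le, tsub_le_iff_right]
    calc ENNReal.ofReal (1 - δ) ≤ volume A := ENNReal.ofReal_le_of_le_toReal (by linarith [h.1])
      _ ≤ volume K + volume (A \ K) := by
        rw [← measure_inter_add_sdiff A hK.measurableSet, inter_eq_self_of_subset_right hKA]
      _ ≤ _ := add_le_add_right (hAK.le.trans (ENNReal.ofReal_le_ofReal (min_le_left _ _))) _
  · exact (measure_mono hKA).trans (ENNReal.le_ofReal_iff_toReal_le hfin (by linarith) |>.2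
      (by linarith [h.2]))

/-- The mass over `D` of the image of a set exceeds that of a subset by at most the difference. -/
lemma volume_image_inter_le {L : Sp n ≃L[ℝ] Sp n} (hL : MeasurePreserving L volume volume)
    {A K : Set (Sp n)} {X : Set (Sp n)} (p : Sp n) {r s : ℝ} (hr : 0 ≤ r) (hs : 0 ≤ s)
    (hK : volume ((fun z => L z + p) '' K ∩ X) ≤ ENNReal.ofReal r)
    (hA : volume (A \ K) ≤ ENNReal.ofReal s) :
    volume ((fun z => L z + p) '' A ∩ X) ≤ ENNReal.ofReal (r + s) := by
  rw [ENNReal.ofReal_add hr hs]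
  calc volume ((fun z => L z + p) '' A ∩ X)
      ≤ volume ((fun z => L z + p) '' K ∩ X ∪ (fun z => L z + p) '' (A \ K)) := by
        refine measure_mono ?_
        rintro _ ⟨⟨z, hz, rfl⟩, hX⟩
        by_cases hzK : z ∈ K
        · exact Or.inl ⟨mem_image_of_mem _ hzK, hX⟩
        · exact Or.inr (mem_image_of_mem _ ⟨hz, hzK⟩)
    _ ≤ _ := measure_union_le _ _
    _ ≤ _ := by
      rw [measure_image_affine hL p (A \ K)]
      exact add_le_add hK hA

end

/-- Lemma 7.2 (vertical structure): there are `η(δ), ω(δ) → 0` and `c > 0` such that for all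
`t ∈ Λ`, all sufficiently small `δ > 0`, and Borel `A, B` with `||A|-1| < δ`, `||B|-1| < δ`,
`|tA+(1-t)B| < 1+δ`, after a measure-preserving linear map and translations producing
`A' = L(A)+a`, `B' = L(B)+b`, `S' = tA'+(1-t)B'`, there exist a convex `𝒞 ⊆ ℝ^{d-1}` and a
measurable `𝒟 ⊆ 𝒞` with `c ≤ |𝒞| ≤ c⁻¹`, `|𝒞 \ 𝒟| ≤ ω(δ)`,
`|A' ∩ π⁻¹(𝒟ᶜ)| ≤ ω(δ)`, `|B' ∩ π⁻¹(𝒟ᶜ)| ≤ ω(δ)`, and for every `x ∈ 𝒟`: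
`min(|A'_x|, |B'_x|) ≥ η(δ)` and `|S'_x| − t|A'_x| − (1−t)|B'_x| ≤ η(δ)^{3/2}`. -/
theorem vertical_structure
    (d : ℕ) (hd : 2 ≤ d) (Λ : Set ℝ) (hΛc : IsCompact Λ) (hΛ : Λ ⊆ Set.Ioo (0:ℝ) 1) :
    ∃ (η ω : ℝ → ℝ) (c δ₀ : ℝ), 0 < c ∧ 0 < δ₀ ∧
      (∀ δ, 0 < δ → 0 < η δ) ∧ (∀ δ, 0 < δ → 0 < ω δ) ∧
      Filter.Tendsto η (nhdsWithin 0 (Set.Ioi 0)) (nhds 0) ∧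
      Filter.Tendsto ω (nhdsWithin 0 (Set.Ioi 0)) (nhds 0) ∧
      ∀ t ∈ Λ, ∀ δ : ℝ, 0 < δ → δ < δ₀ → ∀ A B : Set (Sp (d-1)),
        MeasurableSet A → MeasurableSet B →
        |(volume A).toReal - 1| < δ → |(volume B).toReal - 1| < δ →
        volume (t • A + (1-t) • B) < ENNReal.ofReal (1 + δ) →
        ∃ (L : Sp (d-1) ≃ₗ[ℝ] Sp (d-1)) (a b : Sp (d-1)),
          MeasurePreserving L volume volume ∧
          ∃ (𝒞 𝒟 : Set (Edim (d-1))),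
            Convex ℝ 𝒞 ∧ 𝒟 ⊆ 𝒞 ∧ MeasurableSet 𝒟 ∧
            ENNReal.ofReal c ≤ volume 𝒞 ∧ volume 𝒞 ≤ ENNReal.ofReal c⁻¹ ∧
            volume (𝒞 \ 𝒟) ≤ ENNReal.ofReal (ω δ) ∧
            volume (((fun p => L p + a) '' A) ∩ Prod.fst ⁻¹' 𝒟ᶜ) ≤ ENNReal.ofReal (ω δ) ∧
            volume (((fun p => L p + b) '' B) ∩ Prod.fst ⁻¹' 𝒟ᶜ) ≤ ENNReal.ofReal (ω δ) ∧
            ∀ x ∈ 𝒟,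
              (ENNReal.ofReal (η δ) ≤ volume (vslice ((fun p => L p + a) '' A) x) ∧
               ENNReal.ofReal (η δ) ≤ volume (vslice ((fun p => L p + b) '' B) x)) ∧
              innerVol (vslice (t • ((fun p => L p + a) '' A)
                  + (1-t) • ((fun p => L p + b) '' B)) x)
                ≤ ENNReal.ofReal t * volume (vslice ((fun p => L p + a) '' A) x)
                  + ENNReal.ofReal (1-t) * volume (vslice ((fun p => L p + b) '' B) x)
                  + ENNReal.ofReal (η δ ^ ((3:ℝ)/2)) := by
  obtain ⟨τ, hτ, hτΛ⟩ := exists_uniform_margin hΛc hΛ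
  have hn : d - 1 ≠ 0 := by omega
  generalize d - 1 = n at *
  obtain ⟨R₀, δ₀, hδ₀, hcyl⟩ := exists_cylinder_bound hn (fun m _ => tightExtremal hn m) hτ
  obtain ⟨c, C', η₀, hc, hC', hη₀, hstr⟩ :=
    exists_structure_translate n hτ (R := max R₀ 1) (lt_max_of_lt_right one_pos)
  have hR₀ : R₀ ≤ max R₀ 1 := le_max_left _ _
  obtain ⟨η, δ₁, hδ₁, hη, hηt, hP⟩ := exists_diagonal (η₀ := min η₀ 1)
    (P := fun η δ => η < 1 ∧ δ < 1 ∧ 2 * δ < δ₀ ∧ ∀ a b A B S,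
      NearExtremal volume τ (2 * δ) a b A B S →
      (∀ x ∈ A, ‖x.1‖ ≤ max R₀ 1) → (∀ x ∈ B, ‖x.1‖ ≤ max R₀ 1) →
      (∀ x, fib A x ≤ ENNReal.ofReal (max R₀ 1)) → (∀ x, fib B x ≤ ENNReal.ofReal (max R₀ 1)) →
      ∃ (v : Sp n) (C D : Set (Edim n)), Convex ℝ C ∧ C ⊆ Metric.closedBall 0 (max R₀ 1) ∧ D ⊆ C ∧
        MeasurableSet C ∧ MeasurableSet D ∧ ENNReal.ofReal c ≤ volume C ∧
        volume C ≤ ENNReal.ofReal c⁻¹ ∧ volume (C \ D) ≤ ENNReal.ofReal (C' * η) ∧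
        volume (A ∩ Prod.fst ⁻¹' Dᶜ) ≤ ENNReal.ofReal (C' * η) ∧
        volume ((fun z => z + v) '' B ∩ Prod.fst ⁻¹' Dᶜ) ≤ ENNReal.ofReal (C' * η) ∧
        ∀ x ∈ D, ENNReal.ofReal η ≤ fib A x ∧ ENNReal.ofReal η ≤ fib ((fun z => z + v) '' B) x ∧
          fib ((fun z => z + b • v) '' S) x ≤ ENNReal.ofReal a * fib A x +
            ENNReal.ofReal b * fib ((fun z => z + v) '' B) x + ENNReal.ofReal (η ^ 2))
    (by positivity) (by
      intro η hη hηlt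
      obtain ⟨δ, hδ, h⟩ := hstr η hη (hηlt.trans_le (min_le_left _ _))
      refine ⟨min 1 (min (δ₀ / 2) (δ / 2)), by positivity, fun δ' _ hlt => ?_⟩
      simp only [lt_min_iff] at hlt
      exact ⟨hηlt.trans_le (min_le_right _ _), hlt.1, by linarith [hlt.2.1],
        fun a b A B S hN => h a b A B S (hN.mono (by linarith [hlt.2.2]))⟩)
  refine ⟨η, fun δ => C' * η δ + η δ, c, δ₁, hc, hδ₁, fun δ _ => hη δ,
    fun δ _ => by have := hη δ; positivity, hηt, ?_, ?_⟩
  · simpa using (hηt.const_mul C').add hηt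
  intro t ht δ hδ hδlt A B hA hB hA1 hB1 hAB
  obtain ⟨hη1, hδ1, hδδ₀, hstr⟩ := hP δ hδ hδlt
  have hη0 := hη δ
  have hω : ENNReal.ofReal (C' * η δ) ≤ ENNReal.ofReal (C' * η δ + η δ) :=
    ENNReal.ofReal_le_ofReal (by linarith)
  obtain ⟨A₀, hA₀, hA₀c, hAA₀, hA₀l, hA₀u⟩ := exists_isCompact_of_abs_sub_lt hA hδ hδ1 hη0 hA1
  obtain ⟨B₀, hB₀, hB₀c, hBB₀, hB₀l, hB₀u⟩ := exists_isCompact_of_abs_sub_lt hB hδ hδ1 hη0 hB1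
  set S := toMeasurable volume (t • A + (1 - t) • B) with hS
  have hcombo : ∀ x ∈ A, ∀ y ∈ B, t • x + (1 - t) • y ∈ S := fun x hx y hy =>
    subset_toMeasurable _ _ (add_mem_add (smul_mem_smul_set hx) (smul_mem_smul_set hy))
  have hN : NearExtremal volume τ (2 * δ) t (1 - t) A₀ B₀ S :=
    ⟨hτ, (hτΛ t ht).1, (hτΛ t ht).2, by ring, hA₀c.measurableSet, hB₀c.measurableSet,
      measurableSet_toMeasurable _ _, fun x hx y hy => hcombo x (hA₀ hx) y (hB₀ hy), hA₀l, hA₀u,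
      hB₀l, hB₀u, by
        rw [hS, measure_toMeasurable]
        exact hAB.le.trans (ENNReal.ofReal_le_ofReal (by linarith))⟩
  obtain ⟨L, p, q, hL, hAp, hBq, hfA, hfB⟩ :=
    hcyl _ _ _ _ _ (hN.mono hδδ₀.le) hA₀c.isBounded hB₀c.isBounded
  obtain ⟨v, C, D, hC, -, hDC, -, hDm, hcC, hCc, hCD, hAD, hBD, hD⟩ :=
    hstr _ _ _ _ _ (hN.image hL p q)
      (by rintro _ ⟨x, hx, rfl⟩; exact (hAp x hx).trans hR₀)
      (by rintro _ ⟨x, hx, rfl⟩; exact (hBq x hx).trans hR₀)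
      (fun x => (hfA x).trans (ENNReal.ofReal_le_ofReal hR₀))
      (fun x => (hfB x).trans (ENNReal.ofReal_le_ofReal hR₀))
  have hBv : (fun z => z + v) '' ((fun z => L z + q) '' B₀) = (fun z => L z + (q + v)) '' B₀ := by
    simp only [image_image, add_assoc]
  rw [hBv] at hBD hD
  refine ⟨L.toLinearEquiv, p, q + v, hL, C, D, hC, hDC, hDm, hcC, hCc, hCD.trans hω,
    volume_image_inter_le hL p (by positivity) hη0.le hAD hAA₀,
    volume_image_inter_le hL (q + v) (by positivity) hη0.le hBD hBB₀, fun x hx => ?_⟩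
  obtain ⟨hxA, hxB, hxS⟩ := hD x hx
  have hA' := fib_mono (image_mono (f := fun z => L z + p) hA₀) x
  have hB' := fib_mono (image_mono (f := fun z => L z + (q + v)) hB₀) x
  refine ⟨⟨hxA.trans hA', hxB.trans hB'⟩, ?_⟩
  refine (innerVol_le ?_).trans (hxS.trans (add_le_add (add_le_add ?_ ?_) ?_))
  · rintro y ⟨_, ⟨_, ⟨z, hz, rfl⟩, rfl⟩, _, ⟨_, ⟨w, hw, rfl⟩, rfl⟩, hzw⟩
    refine ⟨_, ⟨_, hcombo z hz w hw, rfl⟩, ?_⟩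
    rw [← hzw]
    simp only [map_add, map_smul, smul_add, ContinuousLinearEquiv.coe_toLinearEquiv]
    abel
  · gcongr
    exact hA'
  · gcongr
    exact hB'
  · refine ENNReal.ofReal_le_ofReal ?_
    rw [← Real.rpow_natCast]
    exact Real.rpow_le_rpow_of_exponent_ge hη0 hη1.le (by norm_num)
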